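/- Let 1 ≤ j < k be integers and let ε > 0. Then there exists μ > 0 such that for any sufficiently large n divisible by k-1 the following holds: if G is an n-vertex k-graph with δ_j(G) ≥ (δ_j^k(1)+ε)·n^{k-j}, then for every colouring χ : E(G) → ℕ that is globally μn^{k-1}-bounded, G contains a loose Hamilton cycle that is rainbow with respect to χ. -/

import Mathlib

open Finset

open scoped Classical

noncomputable section

/-- A `k`-uniform hypergraph with vertices drawn from `ℕ`. -/
structure HGraph (k : ℕ) where
  verts : Finset ℕ
  edges : Finset (Finset ℕ)
  edge_sub : ∀ e ∈ edges, e ⊆ verts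
  edge_card : ∀ e ∈ edges, e.card = k

namespace HGraph

variable {k : ℕ}

/-- The number of edges of `G` containing the vertex set `S`. -/
def degOn (G : HGraph k) (S : Finset ℕ) : ℕ :=
  (G.edges.filter fun e => S ⊆ e).card

/-- The relative degree `deg_G(S; W)`: edges containing `S` whose other vertices lie in `W`. -/
def degIn (G : HGraph k) (S W : Finset ℕ) : ℕ :=
  (G.edges.filter fun e => S ⊆ e ∧ e \ S ⊆ W).card

/-- The edge set of the induced subhypergraph `G[U]`. -/
def inducedEdges (G : HGraph k) (U : Finset ℕ) : Finset (Finset ℕ) :=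
  G.edges.filter fun e => e ⊆ U

/-- `δ_j(G) ≥ d`. -/
def MinDegGe (G : HGraph k) (j : ℕ) (d : ℝ) : Prop :=
  ∀ T ⊆ G.verts, T.card = j → d ≤ (G.degOn T : ℝ)

/-- `δ_j(G[U]) ≥ d`. -/
def MinDegOnGe (G : HGraph k) (j : ℕ) (U : Finset ℕ) (d : ℝ) : Prop :=
  ∀ T ⊆ U, T.card = j → d ≤ (((G.inducedEdges U).filter fun e => T ⊆ e).card : ℝ)

end HGraph

/-- A colouring is rainbow on a set of edges if distinct edges receive distinct colours. -/
def RainbowEdges (χ : Finset ℕ → ℕ) (E : Finset (Finset ℕ)) : Prop :=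
  ∀ e ∈ E, ∀ f ∈ E, χ e = χ f → e = f

/-- `χ` is globally `b`-bounded on `G`: every colour class has at most `b` edges. -/
def GloballyBounded {k : ℕ} (G : HGraph k) (χ : Finset ℕ → ℕ) (b : ℝ) : Prop :=
  ∀ c : ℕ, ((G.edges.filter fun e => χ e = c).card : ℝ) ≤ b

/-- The number of edges of a loose Hamilton cycle of `G`. -/
def numE {k : ℕ} (G : HGraph k) : ℕ := G.verts.card / (k - 1)

/-- A loose Hamilton cycle in `G`, recorded by a cyclic ordering of the vertices:
`σ` enumerates the vertices, and the `i`-th edge consists of the `k` consecutive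
vertices starting at position `i(k-1)`, so that consecutive edges share exactly one
vertex (when `(k-1) ∣ |V(G)|`). -/
structure LooseHamCycle (k : ℕ) (G : HGraph k) where
  σ : ℕ → ℕ
  injOn : Set.InjOn σ (Set.Iio G.verts.card)
  image_eq : (Finset.range G.verts.card).image σ = G.verts
  edges_mem : ∀ i < numE G,
    (Finset.range k).image (fun r => σ ((i * (k - 1) + r) % G.verts.card)) ∈ G.edges

namespace LooseHamCycle

variable {k : ℕ} {G : HGraph k}

/-- The `i`-th edge of the cycle. -/
def cedge (H : LooseHamCycle k G) (i : ℕ) : Finset ℕ :=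
  (Finset.range k).image fun r => H.σ ((i * (k - 1) + r) % G.verts.card)

/-- The edge set of the cycle. -/
def cedges (H : LooseHamCycle k G) : Finset (Finset ℕ) :=
  (Finset.range (numE G)).image H.cedge

/-- The edge set of the increasing loose path of length `t` starting at edge `i`. -/
def pEdges (H : LooseHamCycle k G) (i t : ℕ) : Finset (Finset ℕ) :=
  (Finset.range t).image fun r => H.cedge ((i + r) % numE G)

/-- The vertex set of the increasing loose path of length `t` starting at edge `i`. -/
def pVerts (H : LooseHamCycle k G) (i t : ℕ) : Finset ℕ :=
  (Finset.range (t * (k - 1) + 1)).image fun r => H.σ ((i * (k - 1) + r) % G.verts.card)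

/-- The first endvertex of the increasing loose path starting at edge `i`. -/
def pEndA (H : LooseHamCycle k G) (i : ℕ) : ℕ := H.σ ((i * (k - 1)) % G.verts.card)

/-- The last endvertex of the increasing loose path of length `t` starting at edge `i`. -/
def pEndB (H : LooseHamCycle k G) (i t : ℕ) : ℕ :=
  H.σ ((i * (k - 1) + t * (k - 1)) % G.verts.card)

/-- The endvertex pair of the increasing loose path of length `t` starting at edge `i`. -/
def pEnds (H : LooseHamCycle k G) (i t : ℕ) : Finset ℕ := {H.pEndA i, H.pEndB i t}

end LooseHamCycle

/-- The loose Hamilton cycle threshold `δ_j^k(1)`: the least `δ ≥ 0` such that for every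
`ε > 0` all sufficiently large `k`-graphs `G` (with `(k-1) ∣ n`) satisfying
`δ_j(G) ≥ (δ+ε)n^{k-j}` contain a loose Hamilton cycle. -/
noncomputable def looseHamThreshold (j k : ℕ) : ℝ :=
  sInf {δ : ℝ | 0 ≤ δ ∧ ∀ ε : ℝ, 0 < ε → ∃ n₀ : ℕ, ∀ n : ℕ, n₀ ≤ n → (k - 1) ∣ n →
    ∀ G : HGraph k, G.verts.card = n →
      G.MinDegGe j ((δ + ε) * (n : ℝ) ^ (k - j)) → Nonempty (LooseHamCycle k G)}

/-- `T = t(k-1)+1`. -/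
def TOf (k t : ℕ) : ℕ := t * (k - 1) + 1
/-- `m̃ = t^{100k}`. -/
def mtOf (k t : ℕ) : ℕ := t ^ (100 * k)
/-- `m = T·m̃`. -/
def mOf (k t : ℕ) : ℕ := TOf k t * mtOf k t
/-- `M = T·m`. -/
def MOf (k t : ℕ) : ℕ := TOf k t * mOf k t

section Splittings

variable {k : ℕ} {G : HGraph k}

/-- `I` is the index set of a `t`-balanced splitting of `H`: a collection of
pairwise vertex-disjoint increasing loose paths of length `t` of `H`. -/
def IsSplitting (H : LooseHamCycle k G) (t : ℕ) (I : Finset ℕ) : Prop :=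
  (∀ i ∈ I, i < numE G) ∧
    ∀ i ∈ I, ∀ i' ∈ I, i ≠ i' → Disjoint (H.pVerts i t) (H.pVerts i' t)

/-- `V(𝒫)` for the splitting indexed by `I`. -/
def splitVerts (H : LooseHamCycle k G) (t : ℕ) (I : Finset ℕ) : Finset ℕ :=
  I.biUnion fun i => H.pVerts i t

/-- `V^E(𝒫)` for the splitting indexed by `I`. -/
def splitEnds (H : LooseHamCycle k G) (t : ℕ) (I : Finset ℕ) : Finset ℕ :=
  I.biUnion fun i => H.pEnds i t

/-- `V^I(𝒫)` for the splitting indexed by `I`. -/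
def splitInt (H : LooseHamCycle k G) (t : ℕ) (I : Finset ℕ) : Finset ℕ :=
  splitVerts H t I \ splitEnds H t I

/-- A vertex set `S` is transverse with respect to the splitting indexed by `I`. -/
def Transverse (H : LooseHamCycle k G) (t : ℕ) (I : Finset ℕ) (S : Finset ℕ) : Prop :=
  ∀ i ∈ I, (S ∩ H.pVerts i t).card ≤ 1

/-- The splitting indexed by `I` is suitable for the path `P₀` (the increasing path
of length `t` starting at edge `i₀`). -/
def Suitable (χ : Finset ℕ → ℕ) (ε : ℝ) (m : ℕ) (H : LooseHamCycle k G)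
    (t : ℕ) (I : Finset ℕ) (i₀ : ℕ) : Prop :=
  (∀ S ⊆ splitVerts H t I \ H.pVerts i₀ t, S.card = k - 1 → Transverse H t I S →
    ((((G.inducedEdges (splitVerts H t I)).filter
        fun e => S ⊆ e ∧ ∃ f ∈ H.cedges, χ f = χ e).card : ℝ) ≤ ε * (m : ℝ) / 4)) ∧
  (∀ X ⊆ splitVerts H t I \ H.pVerts i₀ t, Transverse H t I X →
    ∀ e ∈ G.inducedEdges X, ∀ f ∈ G.inducedEdges X,
      χ e = χ f → (e ∩ f).card = 1 → False) ∧
  (∀ e ∈ G.inducedEdges (splitVerts H t I \ H.pVerts i₀ t),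
    ∀ f ∈ G.inducedEdges (splitVerts H t I \ H.pVerts i₀ t),
      χ e = χ f → Disjoint e f → Transverse H t I e → Transverse H t I f →
      ∃ i ∈ I, ∃ i' ∈ I, i ≠ i' ∧
        (H.pVerts i t ∩ e).Nonempty ∧ (H.pVerts i t ∩ f).Nonempty ∧
        (H.pVerts i' t ∩ e).Nonempty ∧ (H.pVerts i' t ∩ f).Nonempty)

/-- The cyclic successor of `i` within the index set `I`. -/
def nextIdx (I : Finset ℕ) (i : ℕ) : ℕ :=
  if h : (I.filter fun i' => i < i').Nonempty then (I.filter fun i' => i < i').min' h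
  else if h2 : I.Nonempty then I.min' h2 else 0

/-- `M` is a rerouting of the splitting indexed by `I`: a partition of `V^E(𝒫)` into
pairs such that identifying the two vertices of each pair connects the paths of
`H[V(G) ∖ V^I(𝒫)]` into a single loose cycle (the arcs of `H` between consecutive
paths of the splitting, together with the identified pairs, form a connected graph). -/
def IsRerouting (H : LooseHamCycle k G) (t : ℕ) (I : Finset ℕ)
    (M : Finset (Finset ℕ)) : Prop :=
  (∀ p ∈ M, p.card = 2 ∧ p ⊆ splitEnds H t I) ∧
  (∀ p ∈ M, ∀ q ∈ M, p ≠ q → Disjoint p q) ∧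
  M.biUnion id = splitEnds H t I ∧
  ∀ u ∈ splitEnds H t I, ∀ v ∈ splitEnds H t I,
    Relation.ReflTransGen
      (fun a b => ({a, b} : Finset ℕ) ∈ M ∨
        ∃ i ∈ I, ({a, b} : Finset ℕ) = {H.pEndB i t, H.pEndA (nextIdx I i)}) u v

/-- `X` (indexed over `Finset.range T`) is a viable partition of `V(𝒫)` for the
`t`-balanced splitting indexed by `I`. -/
def IsViablePartition (j : ℕ) (ε : ℝ) (t : ℕ) (H : LooseHamCycle k G)
    (I : Finset ℕ) (X : ℕ → Finset ℕ) : Prop :=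
  (Finset.range (TOf k t)).biUnion X = splitVerts H t I ∧
  (∀ h ∈ Finset.range (TOf k t), ∀ h' ∈ Finset.range (TOf k t), h ≠ h' →
    Disjoint (X h) (X h')) ∧
  (∀ h ∈ Finset.range (TOf k t), Transverse H t I (X h)) ∧
  (∃ M : Finset (Finset ℕ), IsRerouting H t I M ∧
    ∀ h ∈ Finset.range (TOf k t), (M.filter fun p => p ⊆ X h).card = mtOf k t) ∧
  ∀ h ∈ Finset.range (TOf k t),
    G.MinDegOnGe j (X h) ((looseHamThreshold j k + ε / 2) * (mOf k t : ℝ) ^ (k - j))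

/-- The vertex set spanned by a set of edges. -/
def eVerts (E : Finset (Finset ℕ)) : Finset ℕ := E.biUnion id

/-- `(𝒫, H', 𝒫')` is a `(P₀,H)`-switching of size `m`, where `𝒫` is the `t`-balanced
splitting of `H` indexed by `I` containing `P₀` (the increasing path of length `t`
starting at edge `i₀`), and `𝒫'` is the `2t`-bounded splitting of `H'` whose paths are
recorded in `Q` as pairs (edge set, endvertex pair). -/
def IsSwitching (t m : ℕ) (H : LooseHamCycle k G) (i₀ : ℕ) (I : Finset ℕ)
    (H' : LooseHamCycle k G) (Q : Finset (Finset (Finset ℕ) × Finset ℕ)) : Prop :=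
  IsSplitting H t I ∧ I.card = m ∧ i₀ ∈ I ∧
  Q.card = m ∧
  (∀ q ∈ Q, ∃ i ℓ : ℕ, i < numE G ∧ 1 ≤ ℓ ∧ ℓ ≤ 2 * t ∧
    q.1 = H'.pEdges i ℓ ∧ q.2 = H'.pEnds i ℓ) ∧
  (∀ q ∈ Q, ∀ q' ∈ Q, q ≠ q' → Disjoint (eVerts q.1) (eVerts q'.1)) ∧
  splitInt H t I = (Q.biUnion fun q => eVerts q.1) \ (Q.biUnion fun q => q.2) ∧
  H.cedges.filter (fun e => e ⊆ G.verts \ splitInt H t I) =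
    H'.cedges.filter (fun e =>
      e ⊆ G.verts \ ((Q.biUnion fun q => eVerts q.1) \ (Q.biUnion fun q => q.2))) ∧
  ∀ q ∈ Q, (H.pVerts i₀ t ∩ eVerts q.1).card ≤ 1

/-- A feasible `(P₀,H)`-switching: additionally `F' = H'[V(𝒫') ∖ V(P₀)]` is rainbow and
no edge of `F'` shares a colour with an edge of `H[V(G) ∖ V^I(𝒫)]`. -/
def IsFeasibleSwitching (χ : Finset ℕ → ℕ) (t m : ℕ) (H : LooseHamCycle k G)
    (i₀ : ℕ) (I : Finset ℕ) (H' : LooseHamCycle k G)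
    (Q : Finset (Finset (Finset ℕ) × Finset ℕ)) : Prop :=
  IsSwitching t m H i₀ I H' Q ∧
  RainbowEdges χ (H'.cedges.filter fun e =>
    e ⊆ (Q.biUnion fun q => eVerts q.1) \ H.pVerts i₀ t) ∧
  ∀ e ∈ H'.cedges.filter (fun e =>
      e ⊆ (Q.biUnion fun q => eVerts q.1) \ H.pVerts i₀ t),
    ∀ f ∈ H.cedges.filter (fun f => f ⊆ G.verts \ splitInt H t I), χ e ≠ χ f

/-- Two vertices are close (with respect to `H` and `t`) if they lie in edges of `H`
both contained in a loose path of `H` of length at most `2t+1`. -/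
def Close (H : LooseHamCycle k G) (t : ℕ) (u v : ℕ) : Prop :=
  ∃ i < numE G, ∃ i' < numE G, u ∈ H.cedge i ∧ v ∈ H.cedge i' ∧
    ∃ d ≤ 2 * t, (i + d) % numE G = i' ∨ (i' + d) % numE G = i

/-- A vertex set is spread if no two of its vertices are close. -/
def SpreadSet (H : LooseHamCycle k G) (t : ℕ) (S : Finset ℕ) : Prop :=
  ∀ u ∈ S, ∀ v ∈ S, u ≠ v → ¬ Close H t u v

/-- A vertex set is almost spread if exactly one pair of its vertices is close. -/
def AlmostSpreadSet (H : LooseHamCycle k G) (t : ℕ) (S : Finset ℕ) : Prop :=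
  ∃ u ∈ S, ∃ v ∈ S, u ≠ v ∧ Close H t u v ∧
    ∀ u' ∈ S, ∀ v' ∈ S, u' ≠ v' → Close H t u' v' → ({u', v'} : Finset ℕ) = {u, v}

end Splittings

/-- The probability that a `p`-random subset of `Finset.range N` (each element included
independently with probability `p`) satisfies `A`. -/
noncomputable def probOver (N : ℕ) (p : ℝ) (A : Finset ℕ → Prop) : ℝ :=
  ∑ S ∈ (Finset.range N).powerset,
    if A S then p ^ S.card * (1 - p) ^ (N - S.card) else 0

/-- A loose path of length `t` in `G`, recorded by an ordering of its vertices. -/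
structure LoosePath (k t : ℕ) (G : HGraph k) where
  σ : ℕ → ℕ
  injOn : Set.InjOn σ (Set.Iio (t * (k - 1) + 1))
  mem_verts : ∀ r < t * (k - 1) + 1, σ r ∈ G.verts
  edges_mem : ∀ i < t, (Finset.range k).image (fun r => σ (i * (k - 1) + r)) ∈ G.edges

namespace LoosePath

variable {k t : ℕ} {G : HGraph k}

/-- The vertex set of a loose path. -/
def verts (P : LoosePath k t G) : Finset ℕ := (Finset.range (t * (k - 1) + 1)).image P.σ

/-- The edge set of a loose path. -/
def edgeSet (P : LoosePath k t G) : Finset (Finset ℕ) :=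
  (Finset.range t).image fun i => (Finset.range k).image fun r => P.σ (i * (k - 1) + r)

/-- The first endvertex of a loose path. -/
def endA (P : LoosePath k t G) : ℕ := P.σ 0

/-- The last endvertex of a loose path. -/
def endB (P : LoosePath k t G) : ℕ := P.σ (t * (k - 1))

end LoosePath

open Finset
open scoped Classical
noncomputable section

inductive LP (E : Finset (Finset ℕ)) : ℕ → ℕ → Finset ℕ → Prop
  | nil (a : ℕ) : LP E a a {a}
  | cons {a c b : ℕ} {e S : Finset ℕ} : e ∈ E → a ∈ e → c ∈ e → a ≠ c → LP E c b S →
      e ∩ S = {c} → LP E a b (e ∪ S)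

namespace LP
variable {E E' : Finset (Finset ℕ)} {a b c d : ℕ} {S T e : Finset ℕ}

theorem mem_left (h : LP E a b S) : a ∈ S := by
  cases h <;> simp_all

theorem mem_right (h : LP E a b S) : b ∈ S := by
  induction h <;> simp_all

theorem single (he : e ∈ E) (ha : a ∈ e) (hb : b ∈ e) (hab : a ≠ b) : LP E a b e := by
  have := LP.cons he ha hb hab (LP.nil b) (by simpa using hb)
  rwa [Finset.union_eq_left.2 (by simpa using hb)] at this

theorem mono (h : LP E a b S) (hE : ∀ e ∈ E, e ⊆ S → e ∈ E') : LP E' a b S := by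
  induction h with
  | nil a => exact LP.nil a
  | cons he ha hc hac hS hi ih =>
    exact LP.cons (hE _ he subset_union_left) ha hc hac
      (ih fun e he hs => hE e he (hs.trans subset_union_right)) hi

theorem trans (h : LP E a b S) (h' : LP E b d T) (hi : S ∩ T = {b}) : LP E a d (S ∪ T) := by
  induction h with
  | nil a => rwa [Finset.union_eq_right.2 (by simpa using h'.mem_left)]
  | @cons a c b e S he ha hc hac hS hi' ih =>
    have hbS := hS.mem_right
    have hbT := h'.mem_left
    have h1 : S ∩ T = {b} := by
      ext x; have := Finset.ext_iff.1 hi x; simp at this ⊢; grind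
    rw [Finset.union_assoc]
    refine LP.cons he ha hc hac (ih h' h1) ?_
    ext x
    have h2 := Finset.ext_iff.1 hi x
    have h3 := Finset.ext_iff.1 hi' x
    have h4 := Finset.ext_iff.1 hi b
    have h5 := Finset.ext_iff.1 hi' b
    simp at h2 h3 h4 h5 ⊢
    grind

theorem symm (h : LP E a b S) : LP E b a S := by
  induction h with
  | nil a => exact LP.nil a
  | @cons a c b e S he ha hc hac hS hi' ih =>
    rw [Finset.union_comm]
    exact ih.trans (single he hc ha hac.symm) (by rw [Finset.inter_comm, hi'])

theorem sub (h : LP E a b S) : ∀ u ∈ S, ∀ v ∈ S, ∃ S' ⊆ S, LP E u v S' := by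
  induction h with
  | nil a =>
    intro u hu v hv
    simp at hu hv; subst hu; subst hv
    exact ⟨_, subset_rfl, LP.nil _⟩
  | @cons a c b e S he ha hc hac hS hi ih =>
    have hcS := hS.mem_left
    have key : ∀ u ∈ e, ∀ v ∈ S, ∃ S' ⊆ e ∪ S, LP E u v S' := by
      intro u hu v hv
      obtain ⟨S', hS', hp⟩ := ih c hcS v hv
      by_cases huc : u = c
      · subst huc; exact ⟨S', hS'.trans subset_union_right, hp⟩
      · refine ⟨e ∪ S', Finset.union_subset_union_right hS', LP.cons he hu hc huc hp ?_⟩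
        have := hp.mem_left
        ext x
        have h3 := Finset.ext_iff.1 hi x
        have := @hS' x
        simp at h3 ⊢; grind
    intro u hu v hv
    rcases mem_union.1 hu with hu | hu <;> rcases mem_union.1 hv with hv | hv
    · by_cases huv : u = v
      · subst huv; exact ⟨{u}, by simp [hu], LP.nil u⟩
      · exact ⟨e, subset_union_left, single he hu hv huv⟩
    · exact key u hu v hv
    · obtain ⟨S', h1, h2⟩ := key v hv u hu
      exact ⟨S', h1, h2.symm⟩
    · obtain ⟨S', h1, h2⟩ := ih u hu v hv
      exact ⟨S', h1.trans subset_union_right, h2⟩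

theorem card_eq {k : ℕ} (hk : 2 ≤ k) (hE : ∀ e ∈ E, e.card = k) (h : LP E a b S) :
    ∃ l, S.card = l * (k - 1) + 1 := by
  induction h with
  | nil a => exact ⟨0, by simp⟩
  | @cons a c b e S he ha hc hac hS hi ih =>
    obtain ⟨l, hl⟩ := ih
    refine ⟨l + 1, ?_⟩
    have := Finset.card_union_add_card_inter e S
    rw [hi, hE e he, hl] at this
    rw [Nat.add_mul]
    simp at this ⊢
    omega

theorem subset {V : Finset ℕ} (hE : ∀ e ∈ E, e ⊆ V) (h : LP E a b S) (ha : a ∈ V) : S ⊆ V := by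
  induction h with
  | nil a => simpa using ha
  | @cons a c b e S he ha' hc hac hS hi ih =>
    exact Finset.union_subset (hE e he) (ih (hE e he hc))

/-- A bijective enumeration of an edge with prescribed ends. -/
theorem enum {q : ℕ} (hq : 1 ≤ q) (he : e.card = q + 1) (ha : a ∈ e) (hc : c ∈ e) (hac : a ≠ c) :
    ∃ g : ℕ → ℕ, g 0 = a ∧ g q = c ∧ Set.InjOn g (Set.Iio (q + 1)) ∧
      (range (q + 1)).image g = e := by
  have h1 : (Finset.Ioo 0 q).card = ((e.erase a).erase c).card := by
    rw [Finset.card_erase_of_mem (by simp [hc, hac.symm]), Finset.card_erase_of_mem ha]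
    simp; omega
  let f := Finset.equivOfCardEq h1
  let g : ℕ → ℕ := fun t => if t = 0 then a else if t = q then c else
    if h : t ∈ Finset.Ioo 0 q then (f ⟨t, h⟩ : ℕ) else 0
  have g0 : g 0 = a := by simp [g]
  have gq : g q = c := by simp [g]; omega
  have gt : ∀ t (h : t ∈ Finset.Ioo 0 q), g t = f ⟨t, h⟩ := by
    intro t h
    have := Finset.mem_Ioo.1 h
    have h2 : t ≠ 0 := by omega
    have h3 : t ≠ q := by omega
    simp only [g, h2, h3, h, if_false, dif_pos]
  have gm : ∀ t (h : t ∈ Finset.Ioo 0 q), g t ∈ e ∧ g t ≠ a ∧ g t ≠ c := by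
    intro t h
    rw [gt t h]
    have := (f ⟨t, h⟩).2
    simp only [Finset.mem_erase] at this
    tauto
  have cases : ∀ t < q + 1, t = 0 ∨ t = q ∨ t ∈ Finset.Ioo 0 q := by
    intro t ht; simp; omega
  have inj : Set.InjOn g (Set.Iio (q + 1)) := by
    intro s hs t ht hst
    rcases cases s hs with h | h | h <;> rcases cases t ht with h' | h' | h'
    · omega
    · subst h; subst h'; rw [g0, gq] at hst; exact absurd hst hac
    · subst h; rw [g0] at hst; exact absurd hst.symm (gm t h').2.1
    · subst h; subst h'; rw [g0, gq] at hst; exact absurd hst.symm hac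
    · omega
    · subst h; rw [gq] at hst; exact absurd hst.symm (gm t h').2.2
    · subst h'; rw [g0] at hst; exact absurd hst (gm s h).2.1
    · subst h'; rw [gq] at hst; exact absurd hst (gm s h).2.2
    · rw [gt s h, gt t h'] at hst
      have := f.injective (Subtype.ext hst)
      simpa using this
  refine ⟨g, g0, gq, inj, ?_⟩
  apply Finset.eq_of_subset_of_card_le
  · intro x hx
    obtain ⟨t, ht, rfl⟩ := mem_image.1 hx
    rcases cases t (by simpa using ht) with h | h | h
    · rw [h, g0]; exact ha
    · rw [h, gq]; exact hc
    · exact (gm t h).1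
  · rw [Finset.card_image_of_injOn (by simpa using inj), he]; simp

theorem glue {q L : ℕ} {f g : ℕ → ℕ} (hfg : g q = f 0)
    (gi : Set.InjOn g (Set.Iio (q + 1))) (ge : (range (q + 1)).image g = e)
    (fi : Set.InjOn f (Set.Iio (L + 1))) (fe : (range (L + 1)).image f = S)
    (hi : e ∩ S = {f 0}) :
    let h : ℕ → ℕ := fun t => if t < q then g t else f (t - q)
    (∀ t ≤ q, h t = g t) ∧ (∀ t, h (q + t) = f t) ∧
    Set.InjOn h (Set.Iio (q + L + 1)) ∧ (range (q + L + 1)).image h = e ∪ S := by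
  intro h
  have h1 : ∀ t ≤ q, h t = g t := by
    intro t ht
    by_cases h' : t < q
    · simp [h, h']
    · have : t = q := by omega
      subst this; simp [h, hfg]
  have h2 : ∀ t, h (q + t) = f t := by intro t; simp [h]
  have me : ∀ t ≤ q, g t ∈ e := by
    intro t ht; rw [← ge]; exact mem_image_of_mem _ (by simp; omega)
  have mS : ∀ t ≤ L, f t ∈ S := by
    intro t ht; rw [← fe]; exact mem_image_of_mem _ (by simp; omega)
  refine ⟨h1, h2, ?_, ?_⟩
  · have key : ∀ s t, s < q → q ≤ t → t < q + L + 1 → h s ≠ h t := by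
      intro s t hs ht ht' hst
      obtain ⟨t, rfl⟩ := Nat.exists_eq_add_of_le ht
      rw [h1 s hs.le, h2] at hst
      have : g s ∈ e ∩ S := mem_inter.2 ⟨me s hs.le, by rw [hst]; exact mS t (by omega)⟩
      rw [hi, mem_singleton, ← hfg] at this
      have := gi (by simp; omega) (by simp) this
      omega
    intro s hs t ht hst
    simp only [Set.mem_Iio] at hs ht
    by_cases hs' : s < q <;> by_cases ht' : t < q
    · rw [h1 s hs'.le, h1 t ht'.le] at hst
      exact gi (by simp; omega) (by simp; omega) hst
    · exact absurd hst (key s t hs' (by omega) ht)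
    · exact absurd hst.symm (key t s ht' (by omega) hs)
    · obtain ⟨s, rfl⟩ := Nat.exists_eq_add_of_le (not_lt.1 hs')
      obtain ⟨t, rfl⟩ := Nat.exists_eq_add_of_le (not_lt.1 ht')
      rw [h2, h2] at hst
      rw [fi (by simp; omega) (by simp; omega) hst]
  · ext x
    simp only [mem_image, mem_range, mem_union]
    constructor
    · rintro ⟨t, ht, rfl⟩
      by_cases ht' : t < q
      · left; rw [h1 t ht'.le]; exact me t ht'.le
      · right
        obtain ⟨t, rfl⟩ := Nat.exists_eq_add_of_le (not_lt.1 ht')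
        rw [h2]; exact mS t (by omega)
    · rintro (hx | hx)
      · rw [← ge] at hx
        obtain ⟨t, ht, rfl⟩ := mem_image.1 hx
        simp at ht
        exact ⟨t, by omega, h1 t (by omega)⟩
      · rw [← fe] at hx
        obtain ⟨t, ht, rfl⟩ := mem_image.1 hx
        simp at ht
        exact ⟨q + t, by omega, h2 t⟩

theorem toFun {q : ℕ} (hq : 1 ≤ q) (hE : ∀ e ∈ E, e.card = q + 1) (h : LP E a b S) :
    ∃ (l : ℕ) (f : ℕ → ℕ), f 0 = a ∧ f (l * q) = b ∧ Set.InjOn f (Set.Iio (l * q + 1)) ∧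
      (range (l * q + 1)).image f = S ∧
      ∀ i < l, (range (q + 1)).image (fun r => f (i * q + r)) ∈ E := by
  induction h with
  | nil a => exact ⟨0, fun _ => a, rfl, rfl, by intro x hx y hy _; simp at hx hy; omega, by simp, by simp⟩
  | @cons a c b e S he ha hc hac hS hi ih =>
    obtain ⟨l, f, f0, fl, fi, fe, fE⟩ := ih
    obtain ⟨g, g0, gq, gi, ge⟩ := enum hq (hE e he) ha hc hac
    obtain ⟨h1, h2, h3, h4⟩ := glue (by rw [gq, f0]) gi ge fi fe (by rw [hi, f0])
    set h : ℕ → ℕ := fun t => if t < q then g t else f (t - q)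
    have e1 : (l + 1) * q = q + l * q := by ring
    refine ⟨l + 1, h, by rw [h1 0 (by omega), g0], by rw [e1, h2, fl], by rw [e1]; exact h3,
      by rw [e1]; exact h4, ?_⟩
    intro i hi'
    rcases i with _ | i
    · have : (range (q + 1)).image (fun r => h (0 * q + r)) = e := by
        rw [← ge]
        apply image_congr
        intro r hr
        simp at hr
        simp only [zero_mul, zero_add]
        exact h1 r (by omega)
      rw [this]; exact he
    · have : (range (q + 1)).image (fun r => h ((i + 1) * q + r))
          = (range (q + 1)).image (fun r => f (i * q + r)) := by
        apply image_congr
        intro r hr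
        simp only
        rw [show (i + 1) * q + r = q + (i * q + r) by ring, h2]
      rw [this]; exact fE i (by omega)

end LP

/-- `W` is spanned by a loose cycle one of whose edges is `e`, with link vertices `a`, `c`. -/
def CycAt (E : Finset (Finset ℕ)) (W e : Finset ℕ) (a c : ℕ) : Prop :=
  e ∈ E ∧ a ∈ e ∧ c ∈ e ∧ a ≠ c ∧ ∃ S, LP E c a S ∧ e ∩ S = {a, c} ∧ e ∪ S = W

theorem CycAt.toHam {k : ℕ} (hk : 2 ≤ k) {G : HGraph k} {e : Finset ℕ} {a c : ℕ}
    (h : CycAt G.edges G.verts e a c) : Nonempty (LooseHamCycle k G) := by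
  obtain ⟨he, ha, hc, hac, S, hS, hi, hW⟩ := h
  obtain ⟨q, rfl⟩ : ∃ q, k = q + 1 := ⟨k - 1, by omega⟩
  have hq : 1 ≤ q := by omega
  obtain ⟨l, f, f0, fl, fi, fe, fE⟩ := hS.toFun hq G.edge_card
  obtain ⟨g, g0, gq, gi, ge⟩ := LP.enum hq (G.edge_card e he) ha hc hac
  have hcard : G.verts.card = l * q + q := by
    have h1 := Finset.card_union_add_card_inter e S
    rw [hi, hW, G.edge_card e he, Finset.card_pair hac, ← fe,
      Finset.card_image_of_injOn (by simpa using fi)] at h1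
    simp at h1; omega
  have hl : 1 ≤ l := by
    rcases Nat.eq_zero_or_pos l with h | h
    · subst h; simp at fl; rw [f0] at fl; exact absurd fl.symm hac
    · exact h
  let σ : ℕ → ℕ := fun t => if t ≤ l * q then f t else g (t - l * q)
  have s1 : ∀ t ≤ l * q, σ t = f t := by intro t ht; simp [σ, ht]
  have s2 : ∀ t, σ (l * q + t) = g t := by
    intro t
    rcases Nat.eq_zero_or_pos t with h | h
    · subst h; rw [s1 _ (by simp), g0]; simpa using fl
    · simp [σ, h.ne']
  have me : ∀ t ≤ q, g t ∈ e := by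
    intro t ht; rw [← ge]; exact mem_image_of_mem _ (by simp; omega)
  have mS : ∀ t ≤ l * q, f t ∈ S := by
    intro t ht; rw [← fe]; exact mem_image_of_mem _ (by simp; omega)
  have inj : Set.InjOn σ (Set.Iio (l * q + q)) := by
    have key : ∀ s t, s ≤ l * q → 1 ≤ t → t < q → σ s ≠ σ (l * q + t) := by
      intro s t hs ht ht' hst
      rw [s1 s hs, s2] at hst
      have : g t ∈ e ∩ S := mem_inter.2 ⟨me t ht'.le, by rw [← hst]; exact mS s hs⟩
      rw [hi] at this
      simp only [mem_insert, mem_singleton] at this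
      rcases this with h | h
      · rw [← g0] at h
        have := gi (by simp; omega) (by simp) h
        omega
      · rw [← gq] at h
        have := gi (by simp; omega) (by simp) h
        omega
    intro s hs t ht hst
    simp only [Set.mem_Iio] at hs ht
    by_cases hs' : s ≤ l * q <;> by_cases ht' : t ≤ l * q
    · rw [s1 s hs', s1 t ht'] at hst
      exact fi (by simp; omega) (by simp; omega) hst
    · obtain ⟨t, rfl⟩ := Nat.exists_eq_add_of_le (not_le.1 ht').le
      exact absurd hst (key s t hs' (by omega) (by omega))
    · obtain ⟨s, rfl⟩ := Nat.exists_eq_add_of_le (not_le.1 hs').le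
      exact absurd hst.symm (key t s ht' (by omega) (by omega))
    · obtain ⟨s, rfl⟩ := Nat.exists_eq_add_of_le (not_le.1 hs').le
      obtain ⟨t, rfl⟩ := Nat.exists_eq_add_of_le (not_le.1 ht').le
      rw [s2, s2] at hst
      rw [gi (by simp; omega) (by simp; omega) hst]
  refine ⟨⟨σ, by rw [hcard]; exact inj, ?_, ?_⟩⟩
  · apply Finset.eq_of_subset_of_card_le
    · intro x hx
      obtain ⟨t, ht, rfl⟩ := mem_image.1 hx
      simp [hcard] at ht
      rw [← hW]
      by_cases ht' : t ≤ l * q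
      · rw [s1 t ht']; exact mem_union_right _ (mS t ht')
      · obtain ⟨t, rfl⟩ := Nat.exists_eq_add_of_le (not_le.1 ht').le
        rw [s2]; exact mem_union_left _ (me t (by omega))
    · rw [Finset.card_image_of_injOn (by rw [hcard]; simpa using inj)]; simp
  · intro i hi'
    have hn : numE G = l + 1 := by
      simp only [numE, hcard, Nat.add_sub_cancel]
      rw [show l * q + q = (l + 1) * q by ring, Nat.mul_div_cancel _ (by omega)]
    rw [hn] at hi'
    simp only [Nat.add_sub_cancel, hcard]
    by_cases hil : i < l
    · have : (range (q + 1)).image (fun r => σ ((i * q + r) % (l * q + q)))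
          = (range (q + 1)).image (fun r => f (i * q + r)) := by
        apply image_congr
        intro r hr
        simp at hr
        have h1 : i * q + r ≤ l * q := by
          have : (i + 1) * q ≤ l * q := Nat.mul_le_mul_right _ (by omega)
          rw [Nat.add_mul] at this; omega
        simp only
        rw [Nat.mod_eq_of_lt (by omega), s1 _ h1]
      rw [this]; exact fE i hil
    · have hil : i = l := by omega
      subst hil
      have : (range (q + 1)).image (fun r => σ ((i * q + r) % (i * q + q))) = e := by
        rw [← ge]
        apply image_congr
        intro r hr
        simp at hr
        simp only
        by_cases hr' : r = q
        · subst hr'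
          rw [Nat.mod_self, s1 0 (by omega), f0, gq]
        · rw [Nat.mod_eq_of_lt (by omega), s2]
      rw [this]; exact he

section HamToCyc
variable {p : ℕ → ℕ} {N q : ℕ} {E : Finset (Finset ℕ)}

theorem lp_window (hq : 1 ≤ q) (hinj : ∀ t t', p t = p t' → t ≤ t' → t' < t + N → t = t')
    (hE : ∀ i, (Finset.Icc (i * q) (i * q + q)).image p ∈ E) :
    ∀ (l i : ℕ), l * q < N → LP E (p (i * q)) (p (i * q + l * q))
      ((Finset.Icc (i * q) (i * q + l * q)).image p) := by
  intro l
  induction l with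
  | zero => intro i _; simpa using LP.nil _
  | succ l ih =>
    intro i hl
    have e1 : (l + 1) * q = q + l * q := by ring
    have e2 : (i + 1) * q = i * q + q := by ring
    have := ih (i + 1) (by omega)
    have h1 : (Finset.Icc (i * q) (i * q + (l + 1) * q)).image p
       = (Finset.Icc (i * q) (i * q + q)).image p ∪
        (Finset.Icc ((i + 1) * q) ((i + 1) * q + l * q)).image p := by
      rw [← Finset.image_union]; congr 1; ext x; simp; omega
    rw [h1, show i * q + (l + 1) * q = (i + 1) * q + l * q by ring]
    refine LP.cons (hE i) (mem_image_of_mem _ (by simp))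
      (mem_image_of_mem _ (by simp; omega)) ?_ this ?_
    · intro h
      have := hinj _ _ h (by omega) (by omega)
      omega
    · ext x
      simp only [mem_inter, mem_image, mem_Icc, mem_singleton]
      constructor
      · rintro ⟨⟨s, hs, rfl⟩, ⟨t, ht, hst⟩⟩
        have := hinj s t hst.symm (by omega) (by omega)
        congr 1; omega
      · rintro rfl
        exact ⟨⟨_, by omega, rfl⟩, ⟨_, by omega, rfl⟩⟩

theorem cyc_window {s : ℕ} (hq : 1 ≤ q) (hs : 2 ≤ s) (hN : N = s * q)
    (hinj : ∀ t t', p t = p t' → t ≤ t' → t' < t + N → t = t')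
    (hper : ∀ t, p (t + N) = p t)
    (hE : ∀ i, (Finset.Icc (i * q) (i * q + q)).image p ∈ E) (i : ℕ) :
    CycAt E ((Finset.Ico (i * q) (i * q + N)).image p)
      ((Finset.Icc (i * q) (i * q + q)).image p) (p (i * q)) (p (i * q + q)) := by
  obtain ⟨l, rfl⟩ : ∃ l, s = l + 1 := ⟨s - 1, by omega⟩
  have e1 : (l + 1) * q = q + l * q := by ring
  have e2 : (i + 1) * q = i * q + q := by ring
  have hl : 1 * q ≤ l * q := Nat.mul_le_mul_right _ (by omega)
  have hlp := lp_window (E := E) hq hinj hE l (i + 1) (by omega)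
  rw [show (i + 1) * q + l * q = i * q + N by omega, hper, e2] at hlp
  refine ⟨hE i, mem_image_of_mem _ (by simp), mem_image_of_mem _ (by simp), ?_,
    _, hlp, ?_, ?_⟩
  · intro h
    have := hinj _ _ h (by omega) (by omega)
    omega
  · ext x
    simp only [mem_inter, mem_image, mem_Icc, mem_insert,
      mem_singleton]
    constructor
    · rintro ⟨⟨s, hs, rfl⟩, ⟨t, ht, hst⟩⟩
      by_cases h : t < s + N
      · have := hinj s t hst.symm (by omega) (by omega)
        right; congr 1; omega
      · left; congr 1; omega
    · rintro (rfl | rfl)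
      · exact ⟨⟨_, by omega, rfl⟩, ⟨_, by omega, hper _⟩⟩
      · exact ⟨⟨_, by omega, rfl⟩, ⟨_, by omega, rfl⟩⟩
  · ext x
    simp only [mem_union, mem_image, mem_Icc, mem_Ico]
    constructor
    · rintro (⟨s, hs, rfl⟩ | ⟨s, hs, rfl⟩)
      · exact ⟨s, by omega, rfl⟩
      · by_cases h : s = i * q + N
        · subst h; exact ⟨i * q, by omega, (hper _).symm⟩
        · exact ⟨s, by omega, rfl⟩
    · rintro ⟨s, hs, rfl⟩
      by_cases h : s ≤ i * q + q
      · left; exact ⟨s, by omega, rfl⟩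
      · right; exact ⟨s, by omega, rfl⟩

end HamToCyc

namespace LooseHamCycle
variable {k : ℕ} {G : HGraph k}

def pos (H : LooseHamCycle k G) (t : ℕ) : ℕ := H.σ (t % G.verts.card)

theorem pos_per (H : LooseHamCycle k G) (t : ℕ) : H.pos (t + G.verts.card) = H.pos t := by
  simp [pos]

theorem pos_inj (H : LooseHamCycle k G) (hN : 0 < G.verts.card) (t t' : ℕ)
    (h : H.pos t = H.pos t') (h1 : t ≤ t') (h2 : t' < t + G.verts.card) : t = t' := by
  have := H.injOn (Nat.mod_lt t hN) (Nat.mod_lt t' hN) h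
  have h3 : (t' - t) % G.verts.card = 0 := Nat.sub_mod_eq_zero_of_mod_eq this.symm
  rw [Nat.mod_eq_of_lt (by omega)] at h3
  omega

theorem cedge_eq (hk : 2 ≤ k) (H : LooseHamCycle k G) (i : ℕ) :
    H.cedge i = (Finset.Icc (i * (k - 1)) (i * (k - 1) + (k - 1))).image H.pos := by
  ext x
  simp only [cedge, mem_image, mem_range, mem_Icc, pos]
  constructor
  · rintro ⟨r, hr, rfl⟩; exact ⟨_, by omega, rfl⟩
  · rintro ⟨t, ht, rfl⟩; exact ⟨t - i * (k - 1), by omega, by congr 2; omega⟩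

theorem pos_edge (hk : 2 ≤ k) (H : LooseHamCycle k G) (hd : (k - 1) ∣ G.verts.card)
    (hN : 0 < G.verts.card) (i : ℕ) :
    (Finset.Icc (i * (k - 1)) (i * (k - 1) + (k - 1))).image H.pos ∈ G.edges := by
  obtain ⟨s, hs⟩ := hd
  have hs' : numE G = s := by
    simp only [numE, hs]; rw [Nat.mul_div_cancel_left _ (by omega)]
  have hs0 : 0 < s := by
    rcases Nat.eq_zero_or_pos s with h | h
    · subst h; omega
    · exact h
  have h1 := H.edges_mem (i % s) (by rw [hs']; exact Nat.mod_lt _ hs0)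
  rw [← cedge_eq hk]
  convert h1 using 1
  unfold cedge
  apply image_congr
  intro r hr
  simp only
  congr 1
  rw [hs]
  have : i * (k - 1) + r = (k - 1) * s * (i / s) + ((i % s) * (k - 1) + r) := by
    conv_lhs => rw [← Nat.div_add_mod i s]
    ring
  rw [this, Nat.mul_add_mod]

theorem cycAt (hk : 2 ≤ k) (H : LooseHamCycle k G) (hd : (k - 1) ∣ G.verts.card)
    (D : Finset ℕ) (hD : (k - 1) * (2 * D.card + 2) ≤ G.verts.card) :
    ∃ e a c, CycAt G.edges G.verts e a c ∧ Disjoint e D := by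
  have hN : 0 < G.verts.card := by
    have : 0 < (k - 1) * (2 * D.card + 2) := Nat.mul_pos (by omega) (by omega)
    omega
  have hinj := H.pos_inj hN
  obtain ⟨s, hs⟩ := id hd
  set q := k - 1 with hq
  have hq1 : 1 ≤ q := by omega
  have hs2 : 2 * D.card + 2 ≤ s := by
    rw [hs] at hD; exact Nat.le_of_mul_le_mul_left hD hq1
  have key : ∃ i ≤ D.card, Disjoint ((Finset.Icc (2 * i * q) (2 * i * q + q)).image H.pos) D := by
    by_contra hcon
    push Not at hcon
    have : ∀ i, ∃ x, i ≤ D.card →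
        (x ∈ D ∧ x ∈ (Finset.Icc (2 * i * q) (2 * i * q + q)).image H.pos) := by
      intro i
      by_cases hi : i ≤ D.card
      · obtain ⟨x, hx, hx'⟩ := Finset.not_disjoint_iff.1 (hcon i hi)
        exact ⟨x, fun _ => ⟨hx', hx⟩⟩
      · exact ⟨0, fun h => absurd h hi⟩
    choose f hf using this
    obtain ⟨x, hx, y, hy, hxy, hfxy⟩ := Finset.exists_ne_map_eq_of_card_lt_of_maps_to
      (s := Finset.range (D.card + 1)) (t := D) (f := f) (by simp)
      (by intro i hi; simp at hi; exact (hf i (by omega)).1)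
    simp only [mem_range] at hx hy
    wlog hlt : x < y generalizing x y
    · exact this y x hxy.symm hfxy.symm hy hx (by omega)
    have h1 := (hf x (by omega)).2
    have h2 := (hf y (by omega)).2
    rw [← hfxy] at h2
    obtain ⟨t, ht, h1⟩ := mem_image.1 h1
    obtain ⟨t', ht', h2⟩ := mem_image.1 h2
    simp only [mem_Icc] at ht ht'
    have h3 : (2 * x + 2) * q ≤ 2 * y * q := Nat.mul_le_mul_right _ (by omega)
    have h4 : (2 * y + 1) * q < s * q := Nat.mul_lt_mul_of_pos_right (by omega) (by omega)
    have h5 : (2 * x + 2) * q = 2 * x * q + 2 * q := by ring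
    have h6 : (2 * y + 1) * q = 2 * y * q + q := by ring
    have h7 : s * q = q * s := by ring
    have := hinj t t' (h1.trans h2.symm) (by omega) (by omega)
    omega
  obtain ⟨i, hi, hdis⟩ := key
  refine ⟨_, H.pos (2 * i * q), H.pos (2 * i * q + q), ?_, hdis⟩
  have := cyc_window (E := G.edges) (p := H.pos) (N := G.verts.card) hq1 (s := s) (by omega)
    (by rw [hs]; ring) hinj H.pos_per (H.pos_edge hk hd hN) (2 * i)
  convert this using 1
  refine H.image_eq.symm.trans ?_
  ext x
  simp only [mem_image, mem_range, mem_Ico]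
  constructor
  · rintro ⟨t, ht, rfl⟩
    have h0 : 2 * i * q ≤ s * q := Nat.mul_le_mul_right _ (by omega)
    have h7 : s * q = q * s := by ring
    by_cases h : 2 * i * q ≤ t
    · exact ⟨t, by omega, by simp [pos, Nat.mod_eq_of_lt ht]⟩
    · exact ⟨t + G.verts.card, by omega, by simp [pos, Nat.mod_eq_of_lt ht]⟩
  · rintro ⟨t, ht, rfl⟩
    exact ⟨t % G.verts.card, Nat.mod_lt _ hN, rfl⟩

/-- Distinct edges of a loose Hamilton cycle meet in at most one vertex. -/
theorem cedges_inter (hk : 2 ≤ k) (H : LooseHamCycle k G) (hd : (k - 1) ∣ G.verts.card)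
    (hN : (k - 1) * 3 ≤ G.verts.card) (e f : Finset ℕ) (he : e ∈ H.cedges) (hf : f ∈ H.cedges)
    (hef : e ≠ f) : (e ∩ f).card ≤ 1 := by
  obtain ⟨i, hi, rfl⟩ := mem_image.1 he
  obtain ⟨i', hi', rfl⟩ := mem_image.1 hf
  obtain ⟨s, hs⟩ := id hd
  set q := k - 1 with hq
  have hq1 : 1 ≤ q := by omega
  have hs2 : 3 ≤ s := by
    rw [hs] at hN; exact Nat.le_of_mul_le_mul_left hN hq1
  have hn : numE G = s := by
    simp only [numE, hs, ← hq]; rw [Nat.mul_div_cancel_left _ (by omega)]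
  have hinj := H.pos_inj (by omega)
  simp only [mem_range, hn] at hi hi'
  wlog hlt : i < i' generalizing i i'
  · have hne : i ≠ i' := by rintro rfl; exact hef rfl
    rw [Finset.inter_comm]
    exact this i' hf i he hef.symm hi' hi (by omega)
  have h3 : (i + 1) * q ≤ i' * q := Nat.mul_le_mul_right _ (by omega)
  have h4 : (i' + 1) * q ≤ s * q := Nat.mul_le_mul_right _ (by omega)
  have h5 : (i + 1) * q = i * q + q := by ring
  have h6 : (i' + 1) * q = i' * q + q := by ring
  have h7 : s * q = q * s := by ring
  have key : ∀ x ∈ H.cedge i ∩ H.cedge i',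
      (i' * q = i * q + q ∧ x = H.pos (i' * q)) ∨
        (i * q = 0 ∧ i' * q + q = G.verts.card ∧ x = H.pos 0) := by
    intro x hx
    rw [mem_inter, cedge_eq hk, cedge_eq hk] at hx
    obtain ⟨t, ht, h1⟩ := mem_image.1 hx.1
    obtain ⟨t', ht', h2⟩ := mem_image.1 hx.2
    simp only [mem_Icc, ← hq] at ht ht'
    by_cases h : t' < t + G.verts.card
    · have := hinj t t' (h1.trans h2.symm) (by omega) h
      left
      exact ⟨by omega, by rw [← h1]; congr 1; omega⟩
    · right
      refine ⟨by omega, by omega, by rw [← h1]; congr 1; omega⟩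
  rw [card_le_one]
  intro x hx y hy
  have hs3 : 3 * q ≤ s * q := Nat.mul_le_mul_right _ hs2
  rcases key x hx with h | h <;> rcases key y hy with h' | h'
  · rw [h.2, h'.2]
  · omega
  · omega
  · rw [h.2.2, h'.2.2]

end LooseHamCycle

/-- Two loose paths meeting exactly in their ends give a cycle. -/
theorem CycAt.of_two {E : Finset (Finset ℕ)} {a b : ℕ} {S T : Finset ℕ} (h : LP E a b S)
    (h' : LP E b a T) (hab : a ≠ b) (hi : S ∩ T = {a, b}) : ∃ e x y, CycAt E (S ∪ T) e x y := by
  cases h with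
  | nil => exact absurd rfl hab
  | @cons _ c _ e S he ha hc hac hS hi' =>
    refine ⟨e, a, c, he, ha, hc, hac, S ∪ T, ?_, ?_, by rw [Finset.union_assoc]⟩
    · refine hS.trans h' ?_
      have h1 := hS.mem_right
      have h2 := h'.mem_left
      have h3 := hS.mem_left
      ext x
      have h4 := Finset.ext_iff.1 hi x
      have h5 := Finset.ext_iff.1 hi' x
      have h6 := Finset.ext_iff.1 hi' a
      have h7 := Finset.ext_iff.1 hi' b
      simp at h4 h5 h6 h7 ⊢
      grind
    · have h1 := hS.mem_right
      have h2 := h'.mem_left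
      have h3 := hS.mem_left
      have h8 := h'.mem_right
      ext x
      have h4 := Finset.ext_iff.1 hi x
      have h5 := Finset.ext_iff.1 hi' x
      have h7 := Finset.ext_iff.1 hi' b
      simp at h4 h5 h7 ⊢
      grind

theorem CycAt.mono {E E' : Finset (Finset ℕ)} {W e : Finset ℕ} {a c : ℕ}
    (h : CycAt E W e a c) (hE : ∀ e ∈ E, e ⊆ W → e ∈ E') : CycAt E' W e a c := by
  obtain ⟨he, ha, hc, hac, S, hS, hi, rfl⟩ := h
  exact ⟨hE e he subset_union_left, ha, hc, hac, S,
    hS.mono fun f hf hs => hE f hf (hs.trans subset_union_right), hi, rfl⟩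

/-- Inserting a cycle into an edge by an exchange of one vertex. -/
theorem CycAt.insert {E : Finset (Finset ℕ)} {W g f : Finset ℕ} {x y x' y' : ℕ}
    (h : CycAt E W g x y) (hx' : x' ∈ f) (hy' : y' ∈ f) (hxy : x' ≠ y')
    (hd : Disjoint f W) (h1 : insert x' (g.erase x) ∈ E) (h2 : insert x (f.erase x') ∈ E) :
    LP E x' y' (f ∪ W) := by
  obtain ⟨he, ha, hc, hac, S, hS, hi, rfl⟩ := h
  have hxS := hS.mem_right
  have hyS := hS.mem_left
  rw [Finset.disjoint_left] at hd
  have hxf : x ∉ f := fun h => hd h (by simp [ha])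
  have e1 : f ∪ (g ∪ S) = (Insert.insert x' (g.erase x)) ∪ (S ∪ Insert.insert x (f.erase x')) := by
    ext z; simp; grind
  have l2 : LP E x y' (Insert.insert x (f.erase x')) :=
    LP.single h2 (by simp) (by simp [hy', hxy.symm]) (by rintro rfl; exact hxf hy')
  have l3 := hS.trans l2 (by
    ext z
    have := @hd z
    simp at this ⊢; grind)
  rw [e1]
  refine LP.cons h1 (by simp) (by simp [hc, hac.symm]) ?_ l3 ?_
  · rintro rfl
    exact hd hx' (by simp [hc])
  · ext z
    have h3 := @hd z
    have h4 := Finset.ext_iff.1 hi z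
    have h5 := @hd x'
    simp at h3 h4 h5 ⊢
    grind

end

open Finset
open scoped Classical
noncomputable section

variable {k : ℕ}

/-- The induced subhypergraph on vertex set `W`. -/
def HGraph.ind (G : HGraph k) (W : Finset ℕ) : HGraph k where
  verts := W
  edges := G.edges.filter fun e => e ⊆ W
  edge_sub := by intro e he; exact (mem_filter.1 he).2
  edge_card := by intro e he; exact G.edge_card e (mem_filter.1 he).1

/-- normalised minimum `j`-degree at least `δ` -/
def HGraph.MD (G : HGraph k) (j : ℕ) (δ : ℝ) : Prop :=
  G.MinDegGe j (δ * (G.verts.card : ℝ) ^ (k - j))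

@[simp] theorem HGraph.ind_verts (G : HGraph k) (W : Finset ℕ) : (G.ind W).verts = W := rfl
@[simp] theorem HGraph.mem_ind (G : HGraph k) (W e : Finset ℕ) :
    e ∈ (G.ind W).edges ↔ e ∈ G.edges ∧ e ⊆ W := by simp [HGraph.ind]

theorem HGraph.card_super_le (G : HGraph k) (A : Finset ℕ) :
    (G.edges.filter fun e => A ⊆ e).card ≤ G.verts.card ^ (k - A.card) := by
  calc _ ≤ (Finset.powersetCard (k - A.card) G.verts).card := by
        apply Finset.card_le_card_of_injOn (fun e => e \ A)
        · intro e he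
          simp only [Finset.coe_filter, Set.mem_ofPred_eq] at he
          simp only [Finset.mem_coe, Finset.mem_powersetCard]
          refine ⟨Finset.sdiff_subset.trans (G.edge_sub e he.1), ?_⟩
          rw [Finset.card_sdiff_of_subset he.2, G.edge_card e he.1]
        · intro e he f hf h
          simp only [Finset.coe_filter, Set.mem_ofPred_eq] at he hf
          simp only at h
          rw [← Finset.sdiff_union_of_subset he.2, h, Finset.sdiff_union_of_subset hf.2]
    _ ≤ _ := by
        rw [Finset.card_powersetCard]; exact Nat.choose_le_pow _ _

theorem HGraph.card_edges_le (G : HGraph k) : G.edges.card ≤ G.verts.card ^ k := by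
  simpa using G.card_super_le ∅

theorem thr_nonneg (j k : ℕ) : 0 ≤ looseHamThreshold j k :=
  Real.sInf_nonneg fun _ h => h.1

theorem black_box (j k : ℕ) (hjk : j < k) (ε : ℝ) (hε : 0 < ε) :
    ∃ n₀ : ℕ, ∀ G : HGraph k, n₀ ≤ G.verts.card → (k - 1) ∣ G.verts.card →
      G.MD j (looseHamThreshold j k + ε) → Nonempty (LooseHamCycle k G) := by
  set S := {δ : ℝ | 0 ≤ δ ∧ ∀ ε : ℝ, 0 < ε → ∃ n₀ : ℕ, ∀ n : ℕ, n₀ ≤ n → (k - 1) ∣ n →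
    ∀ G : HGraph k, G.verts.card = n →
      G.MinDegGe j ((δ + ε) * (n : ℝ) ^ (k - j)) → Nonempty (LooseHamCycle k G)} with hS
  have hne : S.Nonempty := by
    refine ⟨1, by norm_num, ?_⟩
    intro ε hε
    refine ⟨j + 1, ?_⟩
    intro n hn _ G hG hmd
    exfalso
    obtain ⟨T, hT, hTj⟩ := Finset.exists_subset_card_eq (s := G.verts) (n := j) (by omega)
    have h1 := hmd T hT hTj
    have h2 : (G.degOn T : ℝ) ≤ (n : ℝ) ^ (k - j) := by
      have := G.card_super_le T
      rw [hTj, hG] at this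
      exact_mod_cast this
    have h3 : (0 : ℝ) < (n : ℝ) ^ (k - j) := by
      have : (0 : ℝ) < n := by exact_mod_cast (by omega : 0 < n)
      positivity
    nlinarith
  have hlt : sInf S < looseHamThreshold j k + ε / 2 := by
    change looseHamThreshold j k < _; linarith
  obtain ⟨δ, hδ, hδlt⟩ := exists_lt_of_csInf_lt hne hlt
  obtain ⟨n₀, hn₀⟩ := hδ.2 (looseHamThreshold j k + ε - δ) (by linarith)
  refine ⟨n₀, fun G h1 h2 h3 => hn₀ _ h1 h2 G rfl ?_⟩
  rw [show δ + (looseHamThreshold j k + ε - δ) = looseHamThreshold j k + ε by ring]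
  exact h3

theorem HGraph.MD.mono {G : HGraph k} {j : ℕ} {a b : ℝ} (h : G.MD j a) (hab : b ≤ a) :
    G.MD j b := fun T hT hj => le_trans (by gcongr) (h T hT hj)

theorem HGraph.MD.delete {G : HGraph k} {j : ℕ} (hjk : j < k) {δ ε : ℝ} (hδ : 0 ≤ δ) (hε : 0 < ε)
    (h : G.MD j (δ + ε)) {W : Finset ℕ} (hW : W ⊆ G.verts)
    (hs : ((G.verts \ W).card : ℝ) ≤ ε / 2 * G.verts.card) : (G.ind W).MD j (δ + ε / 2) := by
  intro T hT hTj
  have h1 := h T (hT.trans hW) hTj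
  set N := G.verts.card with hN
  have h2 : G.degOn T ≤ (G.ind W).degOn T + (G.verts \ W).card * N ^ (k - j - 1) := by
    unfold HGraph.degOn
    have hsub : (G.edges.filter fun e => T ⊆ e) ⊆ ((G.ind W).edges.filter fun e => T ⊆ e) ∪
        (G.verts \ W).biUnion fun v => G.edges.filter fun e => insert v T ⊆ e := by
      intro e he
      rw [mem_filter] at he
      by_cases heW : e ⊆ W
      · exact mem_union_left _ (by simp [he, heW])
      · obtain ⟨v, hv, hvW⟩ := Finset.not_subset.1 heW
        refine mem_union_right _ (mem_biUnion.2 ⟨v, ?_, ?_⟩)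
        · simp [hvW, G.edge_sub e he.1 hv]
        · simp [he, Finset.insert_subset_iff, hv]
    refine (card_le_card hsub).trans ((card_union_le _ _).trans ?_)
    gcongr
    refine Finset.card_biUnion_le_card_mul _ _ _ ?_
    intro v hv
    refine (G.card_super_le _).trans ?_
    rw [Finset.card_insert_of_notMem, hTj, ← hN, Nat.sub_sub]
    intro hvT
    simp at hv
    exact hv.2 (hT hvT)
  have h2' : (G.degOn T : ℝ) ≤ (G.ind W).degOn T + (G.verts \ W).card * (N : ℝ) ^ (k - j - 1) := by
    exact_mod_cast h2
  have h3 : ((G.verts \ W).card : ℝ) * (N : ℝ) ^ (k - j - 1) ≤ ε / 2 * (N : ℝ) ^ (k - j) := by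
    calc _ ≤ (ε / 2 * N) * (N : ℝ) ^ (k - j - 1) := by gcongr
      _ = _ := by
        conv_rhs => rw [show k - j = (k - j - 1) + 1 by omega, pow_succ]
        ring
  have h4 : (W.card : ℝ) ^ (k - j) ≤ (N : ℝ) ^ (k - j) := by
    gcongr
    exact_mod_cast card_le_card hW
  simp only [HGraph.ind_verts]
  have h5 : (δ + ε / 2) * (W.card : ℝ) ^ (k - j) ≤ (δ + ε / 2) * (N : ℝ) ^ (k - j) := by gcongr
  nlinarith

theorem HGraph.ind_ind (G : HGraph k) {W U : Finset ℕ} (h : U ⊆ W) : (G.ind W).ind U = G.ind U := by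
  unfold HGraph.ind
  simp only [HGraph.mk.injEq, true_and]
  ext e
  simp only [mem_filter]
  constructor
  · rintro ⟨⟨h1, _⟩, h2⟩; exact ⟨h1, h2⟩
  · rintro ⟨h1, h2⟩; exact ⟨⟨h1, h2.trans h⟩, h2⟩

end

open Finset
open scoped Classical
noncomputable section

theorem exp_chord {B x : ℝ} (hx : |x| ≤ B) :
    Real.exp x ≤ Real.cosh B + x * (Real.sinh B / B) := by
  rcases eq_or_lt_of_le ((abs_nonneg x).trans hx) with h0 | h0
  · have : x = 0 := by rw [← h0] at hx; exact abs_nonpos_iff.1 hx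
    subst this; rw [← h0]; simp
  · obtain ⟨h1, h2⟩ := abs_le.1 hx
    have hc := convexOn_exp.2 (Set.mem_univ B) (Set.mem_univ (-B))
      (show 0 ≤ (B + x) / (2 * B) from div_nonneg (by linarith) (by linarith))
      (show 0 ≤ (B - x) / (2 * B) from div_nonneg (by linarith) (by linarith))
      (by field_simp; ring)
    simp only [smul_eq_mul] at hc
    rw [show (B + x) / (2 * B) * B + (B - x) / (2 * B) * -B = x by field_simp; ring] at hc
    refine hc.trans (le_of_eq ?_)
    rw [Real.cosh_eq, Real.sinh_eq]
    field_simp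
    ring

theorem hoeffding_sum {α : Type*} [Fintype α] (X : α → ℝ) (B : ℝ) (hX : ∀ a, |X a| ≤ B)
    (h0 : ∑ a, X a = 0) : ∑ a, Real.exp (X a) ≤ Fintype.card α * Real.exp (B ^ 2 / 2) := by
  calc ∑ a, Real.exp (X a) ≤ ∑ a, (Real.cosh B + X a * (Real.sinh B / B)) :=
        sum_le_sum fun a _ => exp_chord (hX a)
    _ = Fintype.card α * Real.cosh B := by
        rw [Finset.sum_add_distrib, ← Finset.sum_mul, h0]; simp
    _ ≤ _ := by gcongr; exact Real.cosh_le_exp_half_sq B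

/-- mean over a finite type -/
def avg {β : Type*} [Fintype β] (F : β → ℝ) : ℝ := (∑ y, F y) / Fintype.card β

theorem avg_sub_le {β : Type*} [Fintype β] [Nonempty β] (F G : β → ℝ) (c : ℝ)
    (h : ∀ y, |F y - G y| ≤ c) : |avg F - avg G| ≤ c := by
  have hpos : (0 : ℝ) < Fintype.card β := by exact_mod_cast Fintype.card_pos
  unfold avg
  rw [← sub_div, ← Finset.sum_sub_distrib, abs_div, abs_of_pos hpos, div_le_iff₀ hpos]
  calc _ ≤ ∑ y, |F y - G y| := Finset.abs_sum_le_sum_abs _ _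
    _ ≤ ∑ _y : β, c := sum_le_sum fun y _ => h y
    _ = _ := by simp; ring

theorem mcd_fin {α : Type*} [Fintype α] [Nonempty α] (c lam : ℝ) : ∀ (m : ℕ)
    (F : (Fin m → α) → ℝ), (∀ Y i a, |F (Function.update Y i a) - F Y| ≤ c) →
    ∑ Y, Real.exp (lam * (avg F - F Y)) ≤
      (Fintype.card α : ℝ) ^ m * Real.exp (m * (lam ^ 2 * c ^ 2 / 2)) := by
  intro m
  induction m with
  | zero =>
    intro F _
    have : ∀ Y, F Y = F default := fun Y => congrArg F (Subsingleton.elim _ _)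
    simp [avg, this]
  | succ m ih =>
    intro F hF
    have hpos : (0 : ℝ) < Fintype.card α := by exact_mod_cast Fintype.card_pos
    let A : α → ℝ := fun a => avg fun Y : Fin m → α => F (Fin.cons a Y)
    have hsum : ∀ g : (Fin (m + 1) → α) → ℝ, ∑ Y, g Y = ∑ a, ∑ Y : Fin m → α, g (Fin.cons a Y) := by
      intro g
      rw [← Fintype.sum_prod_type', ← (Fin.consEquiv fun _ => α).sum_comp]
      rfl
    have hM : ∑ a, A a = Fintype.card α * avg F := by
      simp only [A, avg, ← Finset.sum_div, hsum F]
      simp only [Fintype.card_fun, Fintype.card_fin, pow_succ]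
      push_cast
      field_simp
    have hA : ∀ a b, |A a - A b| ≤ c := by
      intro a b
      refine avg_sub_le _ _ c fun Y => ?_
      have := hF (Fin.cons b Y) 0 a
      rwa [Fin.update_cons_zero] at this
    have hX : ∀ a, |lam * (avg F - A a)| ≤ |lam| * c := by
      intro a
      rw [abs_mul]
      gcongr
      have h1 : avg F = avg A := by
        unfold avg at hM ⊢
        rw [hM]; field_simp
      have h2 : A a = avg fun _ : α => A a := by simp [avg]
      rw [h1, h2]
      exact avg_sub_le _ _ c fun b => hA b a
    have h0 : ∑ a, lam * (avg F - A a) = 0 := by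
      rw [← Finset.mul_sum, Finset.sum_sub_distrib, hM]; simp
    have hH := hoeffding_sum _ _ hX h0
    rw [hsum]
    calc _ = ∑ a, Real.exp (lam * (avg F - A a)) *
          ∑ Y : Fin m → α, Real.exp (lam * (A a - F (Fin.cons a Y))) := by
          refine Finset.sum_congr rfl fun a _ => ?_
          rw [Finset.mul_sum]
          refine Finset.sum_congr rfl fun Y _ => ?_
          rw [← Real.exp_add]; congr 1; ring
      _ ≤ ∑ a, Real.exp (lam * (avg F - A a)) *
          ((Fintype.card α : ℝ) ^ m * Real.exp (m * (lam ^ 2 * c ^ 2 / 2))) := by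
          refine sum_le_sum fun a _ => ?_
          gcongr
          refine ih (fun Y => F (Fin.cons a Y)) ?_
          intro Y i b
          have := hF (Fin.cons a Y) i.succ b
          rwa [← Fin.cons_update] at this
      _ ≤ (Fintype.card α * Real.exp ((|lam| * c) ^ 2 / 2)) *
          ((Fintype.card α : ℝ) ^ m * Real.exp (m * (lam ^ 2 * c ^ 2 / 2))) := by
          rw [← Finset.sum_mul]; gcongr
      _ = _ := by
          rw [mul_pow, sq_abs]
          push_cast
          rw [add_mul, Real.exp_add, pow_succ]; ring_nf

theorem mcd {ι α : Type*} [Fintype ι] [DecidableEq ι] [Fintype α] [Nonempty α] (c t : ℝ) (hc : 0 < c) (ht : 0 ≤ t)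
    (hm : 0 < Fintype.card ι)
    (F : (ι → α) → ℝ) (hF : ∀ Y i a, |F (Function.update Y i a) - F Y| ≤ c) :
    ((univ.filter fun Y => F Y ≤ avg F - t).card : ℝ) ≤
      (Fintype.card α : ℝ) ^ Fintype.card ι *
        Real.exp (- (t ^ 2 / (2 * Fintype.card ι * c ^ 2))) := by
  set m := Fintype.card ι with hmdef
  have hm' : (0 : ℝ) < m := by exact_mod_cast hm
  let lam : ℝ := t / (m * c ^ 2)
  have hlam : 0 ≤ lam := by positivity
  have h1 : ∑ Y, Real.exp (lam * (avg F - F Y)) ≤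
      (Fintype.card α : ℝ) ^ m * Real.exp (m * (lam ^ 2 * c ^ 2 / 2)) := by
    let φ := Fintype.equivFin ι
    let ψ : (Fin m → α) ≃ (ι → α) := φ.symm.arrowCongr (Equiv.refl α)
    have hav : avg (fun Y => F (ψ Y)) = avg F := by
      unfold avg
      rw [ψ.sum_comp, Fintype.card_congr ψ]
    have := mcd_fin c lam m (fun Y => F (ψ Y)) (by
      intro Y i a
      have h2 : ψ (Function.update Y i a) = Function.update (ψ Y) (φ.symm i) a := by
        funext x
        simp only [ψ, Equiv.arrowCongr_apply, Function.comp, Equiv.refl_apply, Equiv.symm_symm,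
          Function.update_apply]
        by_cases h : x = φ.symm i
        · subst h; simp
        · have : φ x ≠ i := by rintro rfl; simp at h
          simp [h, this]
      rw [h2]; exact hF _ _ _)
    rw [hav] at this
    rwa [ψ.sum_comp (fun Y => Real.exp (lam * (avg F - F Y)))] at this
  have h2 : ((univ.filter fun Y => F Y ≤ avg F - t).card : ℝ) * Real.exp (lam * t) ≤
      ∑ Y, Real.exp (lam * (avg F - F Y)) := by
    rw [← nsmul_eq_mul, ← Finset.sum_const]
    calc _ ≤ ∑ Y ∈ univ.filter fun Y => F Y ≤ avg F - t, Real.exp (lam * (avg F - F Y)) := by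
          refine sum_le_sum fun Y hY => ?_
          have := (mem_filter.1 hY).2
          gcongr
          linarith
      _ ≤ _ := Finset.sum_le_univ_sum_of_nonneg fun Y => (Real.exp_pos _).le
  have h3 := h2.trans h1
  rw [← le_div_iff₀ (Real.exp_pos _), mul_div_assoc, ← Real.exp_sub] at h3
  refine h3.trans (le_of_eq ?_)
  congr 2
  simp only [lam]
  field_simp
  ring

theorem push_count {ι κ α : Type*} [Fintype ι] [DecidableEq ι] [Fintype κ] [DecidableEq κ] [Fintype α] (ρ : ι → κ)
    (hρ : Function.Injective ρ) (P : (ι → α) → Prop) [DecidablePred P] :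
    (univ.filter fun X : κ → α => P (X ∘ ρ)).card =
      (univ.filter P).card * Fintype.card α ^ (Fintype.card κ - Fintype.card ι) := by
  let e1 := Equiv.piEquivPiSubtypeProd (fun x : κ => x ∈ Set.range ρ) (fun _ => α)
  let e2 : ({x : κ // x ∈ Set.range ρ} → α) ≃ (ι → α) :=
    (Equiv.ofInjective ρ hρ).symm.arrowCongr (Equiv.refl α)
  let e : (κ → α) ≃ (ι → α) × ({x : κ // x ∉ Set.range ρ} → α) :=
    e1.trans (e2.prodCongr (Equiv.refl _))
  have he : ∀ X, (e X).1 = X ∘ ρ := by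
    intro X; funext i
    simp [e, e1, e2, Equiv.arrowCongr, Equiv.piEquivPiSubtypeProd]
  have h1 : (univ.filter fun X : κ → α => P (X ∘ ρ)).card =
      ((univ.filter P) ×ˢ (univ : Finset ({x : κ // x ∉ Set.range ρ} → α))).card := by
    refine Finset.card_equiv e ?_
    intro X
    simp [he]
  rw [h1, Finset.card_product, Finset.card_univ, Fintype.card_fun]
  congr 2
  rw [Fintype.card_subtype_compl]
  congr 1
  exact (Fintype.card_congr (Equiv.ofInjective ρ hρ)).symm

end

open Finset
open scoped Classical
noncomputable section

variable {k : ℕ}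

abbrev HGraph.Vt (G : HGraph k) : Type := {x : ℕ // x ∈ G.verts}

/-- image of a tuple of vertices -/
def img {G : HGraph k} {ι : Type} [Fintype ι] (Y : ι → G.Vt) : Finset ℕ :=
  univ.image fun i => (Y i : ℕ)

theorem mem_img {G : HGraph k} {ι : Type} [Fintype ι] (Y : ι → G.Vt) (x : ℕ) :
    x ∈ img Y ↔ ∃ i, (Y i : ℕ) = x := by simp [img]

theorem img_sub {G : HGraph k} {ι : Type} [Fintype ι] (Y : ι → G.Vt) : img Y ⊆ G.verts := by
  intro x hx
  obtain ⟨i, rfl⟩ := (mem_img Y x).1 hx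
  exact (Y i).2

theorem img_card {G : HGraph k} {ι : Type} [Fintype ι] (Y : ι → G.Vt)
    (h : Function.Injective Y) : (img Y).card = Fintype.card ι := by
  unfold img
  exact (card_image_of_injective _ (Subtype.val_injective.comp h)).trans Finset.card_univ

def FR (G : HGraph k) {ι : Type} [Fintype ι] [DecidableEq ι] (r : ℕ) (T : Finset ℕ) (A : Finset ι)
    (Y : ι → G.Vt) : ℕ :=
  ((powersetCard r Aᶜ).filter fun R => T ∪ R.image (fun i => (Y i : ℕ)) ∈ G.edges).card

theorem card_diff_le {β : Type*} (S : Finset β) (P Q B : β → Prop)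
    [DecidablePred P] [DecidablePred Q] [DecidablePred B]
    (h : ∀ x ∈ S, ¬ B x → (P x ↔ Q x)) :
    |((S.filter P).card : ℝ) - (S.filter Q).card| ≤ (S.filter B).card := by
  have key : ∀ (P Q : β → Prop) [DecidablePred P] [DecidablePred Q], (∀ x ∈ S, ¬ B x → (P x ↔ Q x)) →
      (S.filter P).card ≤ (S.filter Q).card + (S.filter B).card := by
    intro P Q _ _ h
    refine (card_le_card ?_).trans (card_union_le _ _)
    intro x hx
    simp only [mem_filter, mem_union] at hx ⊢
    have := h x hx.1
    tauto
  have h1 := key P Q h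
  have h2 := key Q P fun x hx hB => (h x hx hB).symm
  rw [abs_le]
  constructor
  · have : ((S.filter Q).card : ℝ) ≤ (S.filter P).card + (S.filter B).card := by exact_mod_cast h2
    linarith
  · have : ((S.filter P).card : ℝ) ≤ (S.filter Q).card + (S.filter B).card := by exact_mod_cast h1
    linarith

theorem FR_lip (G : HGraph k) {ι : Type} [Fintype ι] [DecidableEq ι] (r : ℕ) (T : Finset ℕ) (A : Finset ι)
    (Y : ι → G.Vt) (i : ι) (a : G.Vt) :
    |(FR G r T A (Function.update Y i a) : ℝ) - FR G r T A Y| ≤ (Fintype.card ι : ℝ) ^ (r - 1) := by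
  unfold FR
  refine (card_diff_le _ _ _ (fun R => i ∈ R) ?_).trans ?_
  · intro R _ hi
    have : R.image (fun x => ((Function.update Y i a) x : ℕ)) = R.image fun x => (Y x : ℕ) := by
      apply image_congr
      intro x hx
      have : x ≠ i := by rintro rfl; exact hi hx
      simp [Function.update_of_ne this]
    rw [this]
  · have : ((powersetCard r Aᶜ).filter fun R => i ∈ R).card ≤
        (powersetCard (r - 1) (univ : Finset ι)).card := by
      apply Finset.card_le_card_of_injOn (fun R => R.erase i)
      · intro R hR
        simp only [Finset.coe_filter, Set.mem_ofPred_eq, Finset.mem_powersetCard] at hR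
        simp only [Finset.mem_coe, Finset.mem_powersetCard]
        exact ⟨Finset.subset_univ _, by rw [Finset.card_erase_of_mem hR.2, hR.1.2]⟩
      · intro R hR R' hR' h
        simp only [Finset.coe_filter, Set.mem_ofPred_eq] at hR hR'
        simp only at h
        rw [← Finset.insert_erase hR.2, h, Finset.insert_erase hR'.2]
    rw [Finset.card_powersetCard, Finset.card_univ] at this
    exact_mod_cast this.trans (Nat.choose_le_pow _ _)

theorem count_z (G : HGraph k) {ι : Type} [Fintype ι] [DecidableEq ι] (T : Finset ℕ) 
    (hι : Fintype.card ι = k - T.card) :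
    (Fintype.card ι).factorial * G.degOn T ≤
      (univ.filter fun z : ι → G.Vt => T ∪ img z ∈ G.edges).card := by
  have hm : ∀ z ∈ (univ.filter fun z : ι → G.Vt => T ∪ img z ∈ G.edges), T ∪ img z ∈ G.edges :=
    fun z hz => (mem_filter.1 hz).2
  rw [Finset.card_eq_sum_card_fiberwise (f := fun z : ι → G.Vt => T ∪ img z) hm]
  unfold HGraph.degOn
  rw [mul_comm, ← smul_eq_mul, ← Finset.sum_const]
  refine (sum_le_sum ?_).trans (Finset.sum_le_sum_of_subset (Finset.filter_subset _ _))
  intro e he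
  rw [mem_filter] at he
  have hc : Fintype.card ι = Fintype.card {x // x ∈ e \ T} := by
    rw [Fintype.card_coe, Finset.card_sdiff_of_subset he.2, G.edge_card e he.1, hι]
  let φ : ι ≃ {x // x ∈ e \ T} := Fintype.equivOfCardEq hc
  rw [← Fintype.card_equiv φ, ← Finset.card_univ]
  have hV : ∀ x : {x // x ∈ e \ T}, (x : ℕ) ∈ G.verts := fun x =>
    G.edge_sub e he.1 (mem_sdiff.1 x.2).1
  apply Finset.card_le_card_of_injOn (fun (ψ : ι ≃ {x // x ∈ e \ T}) i => (⟨ψ i, hV _⟩ : G.Vt))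
  · intro ψ _
    have : T ∪ img (fun i => (⟨ψ i, hV _⟩ : G.Vt)) = e := by
      ext x
      simp only [mem_union, mem_img]
      constructor
      · rintro (h | ⟨i, rfl⟩)
        · exact he.2 h
        · exact (mem_sdiff.1 (ψ i).2).1
      · intro hx
        by_cases hxT : x ∈ T
        · exact Or.inl hxT
        · right
          exact ⟨ψ.symm ⟨x, mem_sdiff.2 ⟨hx, hxT⟩⟩, by simp⟩
    simp only [Finset.coe_filter, Set.mem_ofPred_eq, mem_filter, mem_univ, true_and]
    exact ⟨by rw [this]; exact he.1, this⟩
  · intro ψ _ ψ' _ h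
    ext i
    have := congrFun h i
    simpa using this

theorem FR_mean (G : HGraph k) {ι : Type} [Fintype ι] [DecidableEq ι] {r : ℕ} (T : Finset ℕ) (A : Finset ι)
    (hr : r = k - T.card) (hrm : r ≤ Fintype.card ι) (hN : 0 < G.verts.card) :
    (((Fintype.card ι - A.card).descFactorial r : ℕ) : ℝ) * G.degOn T / (G.verts.card : ℝ) ^ r ≤
      avg fun Y : ι → G.Vt => (FR G r T A Y : ℝ) := by
  have hcα : Fintype.card G.Vt = G.verts.card := Fintype.card_coe _
  set m := Fintype.card ι with hm
  set N := G.verts.card with hNd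
  have hN' : (0 : ℝ) < N := by exact_mod_cast hN
  unfold avg
  rw [Fintype.card_fun, hcα]
  have key : (m - A.card).descFactorial r * G.degOn T * N ^ (m - r) ≤
      ∑ Y : ι → G.Vt, FR G r T A Y := by
    unfold FR
    simp only [Finset.card_filter]
    rw [Finset.sum_comm]
    have h1 : ∀ R ∈ powersetCard r Aᶜ, r.factorial * G.degOn T * N ^ (m - r) ≤
        ∑ Y : ι → G.Vt, if T ∪ R.image (fun i => (Y i : ℕ)) ∈ G.edges then 1 else 0 := by
      intro R hR
      rw [Finset.mem_powersetCard] at hR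
      rw [← Finset.card_filter]
      have h2 := push_count (α := G.Vt) (Subtype.val : {x // x ∈ R} → ι) Subtype.val_injective
        (fun z => T ∪ img z ∈ G.edges)
      have hcR : Fintype.card {x // x ∈ R} = r := by rw [Fintype.card_coe, hR.2]
      have h3 := count_z G (ι := {x // x ∈ R}) T (by rw [hcR, hr])
      rw [hcR] at h3
      have h4 : ∀ Y : ι → G.Vt, img (Y ∘ (Subtype.val : {x // x ∈ R} → ι)) =
          R.image (fun i => (Y i : ℕ)) := by
        intro Y; ext x; simp [mem_img]
      simp only [h4] at h2
      rw [h2, hcR, hcα]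
      exact Nat.mul_le_mul_right _ h3
    refine le_trans ?_ (sum_le_sum h1)
    rw [Finset.sum_const, Finset.card_powersetCard, Finset.card_compl, smul_eq_mul,
      Nat.descFactorial_eq_factorial_mul_choose, ← hm]
    apply le_of_eq; ring
  have key' : (((m - A.card).descFactorial r : ℕ) : ℝ) * G.degOn T * (N : ℝ) ^ (m - r) ≤
      ∑ Y : ι → G.Vt, (FR G r T A Y : ℝ) := by exact_mod_cast key
  push_cast
  rw [div_le_div_iff₀ (by positivity) (by positivity)]
  have : (N : ℝ) ^ m = (N : ℝ) ^ (m - r) * (N : ℝ) ^ r := by rw [← pow_add]; congr 1; omega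
  calc _ = (((m - A.card).descFactorial r : ℕ) : ℝ) * G.degOn T * (N : ℝ) ^ (m - r) *
        (N : ℝ) ^ r := by rw [this]; ring
    _ ≤ _ := by gcongr

/-- averaging over a resampled background -/
theorem merge_count {ι α : Type*} [Fintype ι] [DecidableEq ι] [Fintype α] [Nonempty α] (A : Finset ι)
    (bad : (ι → α) → Prop) [DecidablePred bad] (p : ℝ)
    (h : ∀ Y0, ((univ.filter fun Y' => bad (A.piecewise Y0 Y')).card : ℝ) ≤ p) :
    ((univ.filter bad).card : ℝ) ≤ p := by
  let inv : (ι → α) × (ι → α) → (ι → α) × (ι → α) :=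
    fun x => (A.piecewise x.1 x.2, A.piecewise x.2 x.1)
  have hinv : Function.Involutive inv := by
    rintro ⟨x, y⟩
    simp only [inv, Prod.mk.injEq]
    constructor <;> (funext i; by_cases hi : i ∈ A <;> simp [hi])
  let e := hinv.toPerm
  have h1 : (univ.filter bad).card * Fintype.card (ι → α) =
      ∑ Y0 : ι → α, (univ.filter fun Y' => bad (A.piecewise Y0 Y')).card := by
    have h2 : ((univ.filter bad) ×ˢ (univ : Finset (ι → α))).card =
      (univ.filter fun x : (ι → α) × (ι → α) => bad (A.piecewise x.1 x.2)).card := by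
      refine Finset.card_equiv e ?_
      intro x
      have h3 : (e x).1 = A.piecewise x.1 x.2 := rfl
      have h4 : A.piecewise (e x).1 (e x).2 = x.1 := congrArg Prod.fst (hinv x)
      simp [h4]
    rw [Finset.card_product, Finset.card_univ] at h2
    rw [h2]
    simp only [Finset.card_filter]
    rw [Fintype.sum_prod_type]
  have hpos : (0 : ℝ) < Fintype.card (ι → α) := by exact_mod_cast Fintype.card_pos
  have h5 : ((univ.filter bad).card : ℝ) * Fintype.card (ι → α) ≤ p * Fintype.card (ι → α) := by
    calc _ = ∑ Y0 : ι → α, ((univ.filter fun Y' => bad (A.piecewise Y0 Y')).card : ℝ) := by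
          exact_mod_cast h1
      _ ≤ ∑ _Y0 : ι → α, p := sum_le_sum fun Y0 _ => h Y0
      _ = _ := by simp; ring
  exact le_of_mul_le_mul_right h5 hpos

theorem asymp_deg (δ ε : ℝ) (hε : 0 < ε) (k r c : ℕ) :
    ∃ m0 : ℕ, ∀ m ≥ m0, (δ + ε / 2) * ((m : ℝ) + c) ^ r ≤
      (δ + ε) * ((m - k : ℕ) : ℝ) ^ r - ε / 4 * (m : ℝ) ^ r := by
  have t1 : Filter.Tendsto (fun m : ℕ => ((m : ℝ) + c) / m) Filter.atTop (nhds 1) := by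
    have := (tendsto_const_div_atTop_nhds_zero_nat (c : ℝ)).const_add 1
    rw [add_zero] at this
    refine this.congr' ?_
    filter_upwards [Filter.eventually_gt_atTop 0] with m hm
    have : (m : ℝ) ≠ 0 := by exact_mod_cast hm.ne'
    field_simp
  have t2 : Filter.Tendsto (fun m : ℕ => ((m - k : ℕ) : ℝ) / m) Filter.atTop (nhds 1) := by
    have := (tendsto_const_div_atTop_nhds_zero_nat (k : ℝ)).const_sub 1
    rw [sub_zero] at this
    refine this.congr' ?_
    filter_upwards [Filter.eventually_gt_atTop k] with m hm
    have : (m : ℝ) ≠ 0 := by exact_mod_cast (by omega : m ≠ 0)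
    rw [Nat.cast_sub hm.le]
    field_simp
  have t3 : Filter.Tendsto (fun m : ℕ => (δ + ε) * (((m - k : ℕ) : ℝ) / m) ^ r
      - (δ + ε / 2) * (((m : ℝ) + c) / m) ^ r) Filter.atTop
      (nhds ((δ + ε) * 1 ^ r - (δ + ε / 2) * 1 ^ r)) :=
    ((t2.pow r).const_mul _).sub ((t1.pow r).const_mul _)
  have h := t3.eventually_const_le (show ε / 4 < (δ + ε) * 1 ^ r - (δ + ε / 2) * 1 ^ r by
    simp; linarith)
  obtain ⟨m0, hm0⟩ := Filter.eventually_atTop.1 (h.and (Filter.eventually_gt_atTop 0))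
  refine ⟨m0, fun m hm => ?_⟩
  obtain ⟨h1, h2⟩ := hm0 m hm
  have hmp : (0 : ℝ) < (m : ℝ) ^ r := by
    have : (0 : ℝ) < m := by exact_mod_cast h2
    positivity
  rw [div_pow, div_pow] at h1
  have h3 := mul_le_mul_of_nonneg_right h1 hmp.le
  rw [sub_mul, mul_assoc, mul_assoc, div_mul_cancel₀ _ hmp.ne', div_mul_cancel₀ _ hmp.ne'] at h3
  linarith

theorem sample_low (j k : ℕ) (hjk : j < k) (δ ε : ℝ) (hδ : 0 ≤ δ) (hε : 0 < ε) (c : ℕ) :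
    ∃ m0 : ℕ, ∀ (G : HGraph k), G.MD j (δ + ε) → ∀ U ⊆ G.verts, U.card = c →
      ∀ (ι : Type) [Fintype ι] [DecidableEq ι], m0 ≤ Fintype.card ι →
      ((univ.filter fun Y : ι → G.Vt => Function.Injective Y ∧ Disjoint U (img Y) ∧
        ¬ (G.ind (U ∪ img Y)).MD j (δ + ε / 2)).card : ℝ) ≤
      ((c : ℝ) + Fintype.card ι) ^ j * Real.exp (-(ε ^ 2 / 32 * Fintype.card ι)) *
        (G.verts.card : ℝ) ^ Fintype.card ι := by
  obtain ⟨m0, hm0⟩ := asymp_deg δ ε hε k (k - j) c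
  refine ⟨max m0 (k + 1), ?_⟩
  intro G hG U hU hUc ι _ _ hm
  set m := Fintype.card ι with hmd
  have hm1 : m0 ≤ m := le_trans (le_max_left _ _) hm
  have hm2 : k + 1 ≤ m := le_trans (le_max_right _ _) hm
  have hcα : Fintype.card G.Vt = G.verts.card := Fintype.card_coe _
  by_cases hN : G.verts.card = 0
  · have : IsEmpty G.Vt := by rw [← Fintype.card_eq_zero_iff, hcα, hN]
    have hι : Nonempty ι := Fintype.card_pos_iff.1 (by omega)
    have : IsEmpty (ι → G.Vt) := ⟨fun f => this.elim (f hι.some)⟩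
    rw [Finset.univ_eq_empty, Finset.filter_empty, Finset.card_empty]
    simp only [Nat.cast_zero]
    positivity
  have hNpos : 0 < G.verts.card := Nat.pos_of_ne_zero hN
  set N := G.verts.card with hNd
  have hNr : (0 : ℝ) < N := by exact_mod_cast hNpos
  have : Nonempty G.Vt := Fintype.card_pos_iff.1 (by rw [hcα]; exact hNpos)
  set r := k - j with hr
  set θ : ℝ := (δ + ε / 2) * ((m : ℝ) + c) ^ r with hθ
  let A : (Fin j → {x // x ∈ U} ⊕ ι) → Finset ι := fun t => univ.filter fun i => ∃ s, t s = Sum.inr i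
  let Tt : (Fin j → {x // x ∈ U} ⊕ ι) → (ι → G.Vt) → Finset ℕ := fun t Y =>
    univ.image fun s => Sum.elim (fun u : {x // x ∈ U} => (u : ℕ)) (fun i => (Y i : ℕ)) (t s)
  let bad : (Fin j → {x // x ∈ U} ⊕ ι) → (ι → G.Vt) → Prop := fun t Y =>
    (Tt t Y).card = j ∧ (FR G r (Tt t Y) (A t) Y : ℝ) < θ
  have hA : ∀ t, (A t).card ≤ j := by
    intro t
    have h1 : (A t).card ≤ (univ : Finset (Fin j)).card := by
      have hsub : (A t).map ⟨Sum.inr, Sum.inr_injective⟩ ⊆ univ.image t := by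
        intro x hx
        obtain ⟨i, hi, rfl⟩ := mem_map.1 hx
        obtain ⟨s, hs⟩ := (mem_filter.1 hi).2
        exact mem_image.2 ⟨s, mem_univ _, hs⟩
      have := card_le_card hsub
      rw [card_map] at this
      exact this.trans Finset.card_image_le
    simpa using h1
  have hbad : ∀ t, ((univ.filter (bad t)).card : ℝ) ≤
      (N : ℝ) ^ m * Real.exp (-(ε ^ 2 / 32 * m)) := by
    intro t
    refine merge_count (A t) _ _ ?_
    intro Y0
    have hT : ∀ Y', Tt t ((A t).piecewise Y0 Y') = Tt t Y0 := by
      intro Y'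
      simp only [Tt]
      apply image_congr
      intro s _
      simp only
      rcases hs : t s with u | i
      · rfl
      · have : i ∈ A t := mem_filter.2 ⟨mem_univ _, s, hs⟩
        simp [this]
    have hF : ∀ T Y', FR G r T (A t) ((A t).piecewise Y0 Y') = FR G r T (A t) Y' := by
      intro T Y'
      unfold FR
      congr 1
      apply Finset.filter_congr
      intro R hR
      have : R.image (fun i => (((A t).piecewise Y0 Y') i : ℕ)) = R.image (fun i => (Y' i : ℕ)) := by
        apply image_congr
        intro i hi
        have h1 : i ∉ A t := Finset.mem_compl.1 ((Finset.mem_powersetCard.1 hR).1 hi)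
        simp [h1]
      rw [this]
    simp only [bad, hT, hF]
    by_cases hTj : (Tt t Y0).card = j
    · simp only [hTj, true_and]
      set T := Tt t Y0
      have hTV : T ⊆ G.verts := by
        intro x hx
        obtain ⟨s, _, rfl⟩ := mem_image.1 hx
        rcases t s with u | i
        · exact hU u.2
        · exact (Y0 i).2
      have hmean := FR_mean G (ι := ι) (r := r) T (A t) (by rw [hTj]) (by omega) hNpos
      have hdeg := hG T hTV hTj
      have hdf : ((m - k : ℕ) : ℝ) ^ r ≤ (((m - (A t).card).descFactorial r : ℕ) : ℝ) := by
        have h1 := Nat.pow_sub_le_descFactorial (m - (A t).card) r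
        have h2 : (m - k) ^ r ≤ (m - (A t).card + 1 - r) ^ r := by
          have := hA t
          exact Nat.pow_le_pow_left (by omega) _
        exact_mod_cast h2.trans h1
      have hav : (δ + ε) * ((m - k : ℕ) : ℝ) ^ r ≤
          avg fun Y : ι → G.Vt => (FR G r T (A t) Y : ℝ) := by
        refine le_trans ?_ hmean
        rw [le_div_iff₀ (by positivity)]
        calc _ = ((m - k : ℕ) : ℝ) ^ r * ((δ + ε) * (N : ℝ) ^ r) := by ring
          _ ≤ _ := by gcongr
      have hmc := mcd (ι := ι) (α := G.Vt) ((m : ℝ) ^ (r - 1)) (ε / 4 * (m : ℝ) ^ r)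
        (by have : (0 : ℝ) < m := by exact_mod_cast (by omega : 0 < m)
            positivity) (by positivity) (by omega) (fun Y => (FR G r T (A t) Y : ℝ))
        (fun Y i a => FR_lip G r T (A t) Y i a)
      rw [hcα, ← hmd] at hmc
      refine le_trans ?_ (hmc.trans (le_of_eq ?_))
      · have : (univ.filter fun Y : ι → G.Vt => (FR G r T (A t) Y : ℝ) < θ) ⊆
            univ.filter fun Y : ι → G.Vt => (FR G r T (A t) Y : ℝ) ≤
              (avg fun Y : ι → G.Vt => (FR G r T (A t) Y : ℝ)) - ε / 4 * (m : ℝ) ^ r := by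
          intro Y hY
          simp only [mem_filter, mem_univ, true_and] at hY ⊢
          have := hm0 m hm1
          linarith
        exact_mod_cast card_le_card this
      · have hmp : (0 : ℝ) < m := by exact_mod_cast (by omega : 0 < m)
        congr 2
        have e1 : (m : ℝ) ^ r = (m : ℝ) ^ (r - 1) * m := by
          rw [← pow_succ]; congr 1; omega
        rw [e1]
        field_simp
        ring
    · simp only [hTj, false_and, Finset.filter_false, Finset.card_empty, Nat.cast_zero]
      positivity
  have hsub : (univ.filter fun Y : ι → G.Vt => Function.Injective Y ∧ Disjoint U (img Y) ∧
        ¬ (G.ind (U ∪ img Y)).MD j (δ + ε / 2)) ⊆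
      (univ : Finset (Fin j → {x // x ∈ U} ⊕ ι)).biUnion fun t => univ.filter (bad t) := by
    intro Y hY
    simp only [mem_filter, mem_univ, true_and] at hY
    obtain ⟨hinj, hdis, hlow⟩ := hY
    unfold HGraph.MD HGraph.MinDegGe at hlow
    push Not at hlow
    obtain ⟨T, hT, hTj, hlt⟩ := hlow
    simp only [HGraph.ind_verts] at hT hlt
    have hcard : (U ∪ img Y).card = m + c := by
      rw [Finset.card_union_of_disjoint hdis, hUc, img_card Y hinj]; omega
    rw [hcard] at hlt
    have hex : ∀ x : {x // x ∈ T}, ∃ z : {x // x ∈ U} ⊕ ι,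
        Sum.elim (fun u : {x // x ∈ U} => (u : ℕ)) (fun i => (Y i : ℕ)) z = x := by
      intro x
      rcases mem_union.1 (hT x.2) with h | h
      · exact ⟨Sum.inl ⟨x, h⟩, rfl⟩
      · obtain ⟨i, hi⟩ := (mem_img Y x).1 h
        exact ⟨Sum.inr i, hi⟩
    choose z hz using hex
    let φ : Fin j ≃ {x // x ∈ T} := (Fintype.equivFinOfCardEq (by rw [Fintype.card_coe, hTj])).symm
    let t : Fin j → {x // x ∈ U} ⊕ ι := fun s => z (φ s)
    have hTt : Tt t Y = T := by
      ext x
      simp only [Tt, t, hz, mem_image, mem_univ, true_and]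
      constructor
      · rintro ⟨s, rfl⟩; exact (φ s).2
      · intro hx; exact ⟨φ.symm ⟨x, hx⟩, by simp⟩
    refine mem_biUnion.2 ⟨t, mem_univ _, mem_filter.2 ⟨mem_univ _, ?_⟩⟩
    refine ⟨by rw [hTt, hTj], ?_⟩
    rw [hTt]
    have hle : FR G r T (A t) Y ≤ (G.ind (U ∪ img Y)).degOn T := by
      unfold FR HGraph.degOn
      apply Finset.card_le_card_of_injOn (fun R => T ∪ R.image (fun i => (Y i : ℕ)))
      · intro R hR
        simp only [Finset.coe_filter, Set.mem_ofPred_eq] at hR ⊢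
        refine ⟨(HGraph.mem_ind _ _ _).2 ⟨hR.2, Finset.union_subset hT ?_⟩, subset_union_left⟩
        intro x hx
        obtain ⟨i, _, rfl⟩ := mem_image.1 hx
        exact mem_union_right _ ((mem_img Y _).2 ⟨i, rfl⟩)
      · intro R hR R' hR' h
        simp only [Finset.coe_filter, Set.mem_ofPred_eq, Finset.mem_powersetCard] at hR hR'
        simp only at h
        have key : ∀ R : Finset ι, R.card = r → T ∪ R.image (fun i => (Y i : ℕ)) ∈ G.edges →
            Disjoint T (R.image (fun i => (Y i : ℕ))) := by
          intro R hRc hRE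
          have h1 := G.edge_card _ hRE
          have h2 := Finset.card_union_add_card_inter T (R.image (fun i => (Y i : ℕ)))
          have h3 : (R.image (fun i => (Y i : ℕ))).card ≤ R.card := Finset.card_image_le
          rw [Finset.disjoint_iff_inter_eq_empty, ← Finset.card_eq_zero]
          omega
        have k1 := key R hR.1.2 hR.2
        have k2 := key R' hR'.1.2 hR'.2
        have h4 : R.image (fun i => (Y i : ℕ)) = R'.image (fun i => (Y i : ℕ)) := by
          rw [← Finset.union_sdiff_cancel_left k1, h, Finset.union_sdiff_cancel_left k2]
        exact Finset.image_injective (Subtype.val_injective.comp hinj) h4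
    have hle' : (FR G r T (A t) Y : ℝ) ≤ (G.ind (U ∪ img Y)).degOn T := by exact_mod_cast hle
    push_cast at hlt
    linarith
  have h1 := (card_le_card hsub).trans Finset.card_biUnion_le
  have h2 : ((univ.filter fun Y : ι → G.Vt => Function.Injective Y ∧ Disjoint U (img Y) ∧
        ¬ (G.ind (U ∪ img Y)).MD j (δ + ε / 2)).card : ℝ) ≤
      ∑ t : (Fin j → {x // x ∈ U} ⊕ ι), ((univ.filter (bad t)).card : ℝ) := by exact_mod_cast h1
  refine h2.trans ((sum_le_sum fun t _ => hbad t).trans (le_of_eq ?_))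
  rw [Finset.sum_const, Finset.card_univ, Fintype.card_fun, Fintype.card_sum, Fintype.card_coe, hUc,
    Fintype.card_fin, nsmul_eq_mul]
  push_cast
  ring

end

open Finset
open scoped Classical
noncomputable section

variable {k : ℕ}

theorem asymp_exp (a : ℕ) (κ C η : ℝ) (hκ : 0 < κ) (hη : 0 < η) :
    ∃ m0 : ℕ, ∀ m : ℕ, m0 ≤ m → C * (m : ℝ) ^ a * Real.exp (-(κ * m)) ≤ η := by
  have h1 : Filter.Tendsto (fun m : ℕ => κ * (m : ℝ)) Filter.atTop Filter.atTop :=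
    tendsto_natCast_atTop_atTop.const_mul_atTop hκ
  have h2 := ((Real.tendsto_pow_mul_exp_neg_atTop_nhds_zero a).comp h1).const_mul (C / κ ^ a)
  rw [mul_zero] at h2
  obtain ⟨m0, hm0⟩ := Filter.eventually_atTop.1 (h2.eventually_le_const hη)
  refine ⟨m0, fun m hm => ?_⟩
  have h3 := hm0 m hm
  simp only [Function.comp] at h3
  refine le_trans (le_of_eq ?_) h3
  rw [mul_pow]
  field_simp

theorem push_le {ι κ α : Type*} [Fintype ι] [DecidableEq ι] [Fintype κ] [DecidableEq κ] [Fintype α] (ρ : ι → κ)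
    (hρ : Function.Injective ρ) (P : (ι → α) → Prop) [DecidablePred P] (p : ℝ)
    (h : ((univ.filter P).card : ℝ) ≤ p * (Fintype.card α : ℝ) ^ Fintype.card ι) :
    ((univ.filter fun X : κ → α => P (X ∘ ρ)).card : ℝ) ≤
      p * (Fintype.card α : ℝ) ^ Fintype.card κ := by
  rw [push_count ρ hρ P]
  push_cast
  have := Fintype.card_le_of_injective ρ hρ
  calc _ ≤ p * (Fintype.card α : ℝ) ^ Fintype.card ι *
        (Fintype.card α : ℝ) ^ (Fintype.card κ - Fintype.card ι) := by gcongr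
    _ = _ := by rw [mul_assoc, ← pow_add]; congr 2; omega

theorem count_noninj {ι α : Type*} [Fintype ι] [DecidableEq ι] [Fintype α] [Nonempty α] :
    ((univ.filter fun Y : ι → α => ¬ Function.Injective Y).card : ℝ) ≤
      (Fintype.card ι : ℝ) ^ 2 / Fintype.card α * (Fintype.card α : ℝ) ^ Fintype.card ι := by
  have hpos : (0 : ℝ) < Fintype.card α := by exact_mod_cast Fintype.card_pos
  have hsub : (univ.filter fun Y : ι → α => ¬ Function.Injective Y) ⊆
      (univ.filter fun x : ι × ι => x.1 ≠ x.2).biUnion fun x => univ.filter fun Y : ι → α => Y x.1 = Y x.2 := by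
    intro Y hY
    have hY' := (mem_filter.1 hY).2
    simp only [Function.Injective] at hY'
    push Not at hY'
    obtain ⟨a, b, h1, h2⟩ := hY'
    simp only [mem_biUnion, mem_filter, mem_univ, true_and]
    exact ⟨(a, b), h2, h1⟩
  have h1 : ∀ x ∈ (univ.filter fun x : ι × ι => x.1 ≠ x.2),
      ((univ.filter fun Y : ι → α => Y x.1 = Y x.2).card : ℝ) ≤
        1 / Fintype.card α * (Fintype.card α : ℝ) ^ Fintype.card ι := by
    intro x hx
    simp only [mem_filter, mem_univ, true_and] at hx
    have h := push_le (κ := ι) (α := α) (![x.1, x.2]) (by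
      intro a b hab
      fin_cases a <;> fin_cases b <;> simp_all
      ) (fun z => z 0 = z 1) (1 / Fintype.card α) (by
      have : (univ.filter fun z : Fin 2 → α => z 0 = z 1).card ≤ (univ : Finset α).card := by
        apply Finset.card_le_card_of_injOn (fun z => z 0)
        · intro z _; simp
        · intro z hz w hw h
          simp at hz hw h
          funext i
          fin_cases i
          · simpa using h
          · simp [← hz, ← hw, h]
      rw [Finset.card_univ] at this
      have h2 : ((univ.filter fun z : Fin 2 → α => z 0 = z 1).card : ℝ) ≤ Fintype.card α := by
        exact_mod_cast this
      rw [Fintype.card_fin]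
      refine h2.trans (le_of_eq ?_)
      field_simp)
    simpa using h
  have h2 : ((univ.filter fun Y : ι → α => ¬ Function.Injective Y).card : ℝ) ≤
      ∑ x ∈ (univ.filter fun x : ι × ι => x.1 ≠ x.2),
        ((univ.filter fun Y : ι → α => Y x.1 = Y x.2).card : ℝ) := by
    exact_mod_cast (card_le_card hsub).trans Finset.card_biUnion_le
  refine (h2.trans (sum_le_sum h1)).trans ?_
  rw [Finset.sum_const, nsmul_eq_mul]
  have h3 : ((univ.filter fun x : ι × ι => x.1 ≠ x.2).card : ℝ) ≤ (Fintype.card ι : ℝ) ^ 2 := by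
    have := Finset.card_filter_le (univ : Finset (ι × ι)) (fun x => x.1 ≠ x.2)
    rw [Finset.card_univ, Fintype.card_prod, ← sq] at this
    exact_mod_cast this
  calc _ ≤ (Fintype.card ι : ℝ) ^ 2 * (1 / Fintype.card α * (Fintype.card α : ℝ) ^ Fintype.card ι) := by
        gcongr
    _ = _ := by ring

theorem count_hit {G : HGraph k} {ι : Type} [Fintype ι] [DecidableEq ι] (hN : 0 < G.verts.card) (F : Finset ℕ) :
    ((univ.filter fun Y : ι → G.Vt => ¬ Disjoint F (img Y)).card : ℝ) ≤
      (Fintype.card ι : ℝ) * F.card / G.verts.card * (G.verts.card : ℝ) ^ Fintype.card ι := by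
  have hcα : Fintype.card G.Vt = G.verts.card := Fintype.card_coe _
  have hpos : (0 : ℝ) < G.verts.card := by exact_mod_cast hN
  have hsub : (univ.filter fun Y : ι → G.Vt => ¬ Disjoint F (img Y)) ⊆
      (univ : Finset ι).biUnion fun i => univ.filter fun Y : ι → G.Vt => (Y i : ℕ) ∈ F := by
    intro Y hY
    simp only [mem_filter, mem_univ, true_and] at hY
    obtain ⟨x, hx, hx'⟩ := Finset.not_disjoint_iff.1 hY
    obtain ⟨i, rfl⟩ := (mem_img Y x).1 hx'
    simp only [mem_biUnion, mem_filter, mem_univ, true_and]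
    exact ⟨i, hx⟩
  have h1 : ∀ i : ι, ((univ.filter fun Y : ι → G.Vt => (Y i : ℕ) ∈ F).card : ℝ) ≤
      F.card / G.verts.card * (G.verts.card : ℝ) ^ Fintype.card ι := by
    intro i
    have h := push_le (κ := ι) (α := G.Vt) (fun _ : Unit => i) (fun _ _ _ => rfl)
      (fun z => (z () : ℕ) ∈ F) (F.card / G.verts.card) (by
      have : (univ.filter fun z : Unit → G.Vt => (z () : ℕ) ∈ F).card ≤ F.card := by
        apply Finset.card_le_card_of_injOn (fun z => (z () : ℕ))
        · intro z hz; simpa using hz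
        · intro z _ w _ h
          funext i
          exact Subtype.ext h
      have h2 : ((univ.filter fun z : Unit → G.Vt => (z () : ℕ) ∈ F).card : ℝ) ≤ F.card := by
        exact_mod_cast this
      rw [hcα, Fintype.card_unit]
      refine h2.trans (le_of_eq ?_)
      field_simp)
    rw [hcα] at h
    simpa using h
  have h2 : ((univ.filter fun Y : ι → G.Vt => ¬ Disjoint F (img Y)).card : ℝ) ≤
      ∑ i : ι, ((univ.filter fun Y : ι → G.Vt => (Y i : ℕ) ∈ F).card : ℝ) := by
    exact_mod_cast (card_le_card hsub).trans Finset.card_biUnion_le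
  refine (h2.trans (sum_le_sum fun i _ => h1 i)).trans (le_of_eq ?_)
  rw [Finset.sum_const, nsmul_eq_mul, Finset.card_univ]
  ring

/-- choose a size in a residue class -/
theorem exists_size (q c M : ℕ) (hq : 1 ≤ q) : ∃ m, M ≤ m ∧ q ∣ m + c := by
  refine ⟨q * (M + c) - c, ?_, M + c, ?_⟩
  · have : 1 * (M + c) ≤ q * (M + c) := Nat.mul_le_mul_right _ hq
    omega
  · have : 1 * (M + c) ≤ q * (M + c) := Nat.mul_le_mul_right _ hq
    omega

theorem connector (j k : ℕ) (hj : 1 ≤ j) (hjk : j < k) (ε : ℝ) (hε : 0 < ε) :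
    ∃ s N0 : ℕ, 1 ≤ s ∧ ∀ G : HGraph k, N0 ≤ G.verts.card → G.MD j (looseHamThreshold j k + ε) →
      ∀ F : Finset ℕ, 4 * s * F.card ≤ G.verts.card → ∀ u ∈ G.verts, ∀ v ∈ G.verts, u ≠ v →
      u ∉ F → v ∉ F → ∃ S ⊆ G.verts, Disjoint S F ∧ S.card ≤ s ∧ LP G.edges u v S := by
  set δ := looseHamThreshold j k with hδ
  obtain ⟨m0, hm0⟩ := sample_low j k hjk δ ε (thr_nonneg j k) hε 2
  obtain ⟨n0, hn0⟩ := black_box j k hjk (ε / 2) (by linarith)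
  obtain ⟨m1, hm1⟩ := asymp_exp j (ε ^ 2 / 32) (3 ^ j) (1 / 4) (by positivity) (by norm_num)
  obtain ⟨m, hm, hmd⟩ := exists_size (k - 1) 2 (m0 + n0 + m1 + (k - 1) * 6 + 1) (by omega)
  refine ⟨m + 2, 8 * (m ^ 2 + 2 * m) + 1, by omega, ?_⟩
  intro G hN hG F hF u hu v hv huv huF hvF
  set N := G.verts.card with hNd
  have hNpos : 0 < N := by omega
  have hNr : (0 : ℝ) < N := by exact_mod_cast hNpos
  have hcα : Fintype.card G.Vt = G.verts.card := Fintype.card_coe _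
  have : Nonempty G.Vt := ⟨⟨u, hu⟩⟩
  let U : Finset ℕ := {u, v}
  have hUc : U.card = 2 := Finset.card_pair huv
  have hUV : U ⊆ G.verts := by
    intro x hx; simp [U] at hx; rcases hx with rfl | rfl <;> assumption
  have c1 := hm0 G hG U hUV hUc (Fin m) (by rw [Fintype.card_fin]; omega)
  have c2 := count_noninj (ι := Fin m) (α := G.Vt)
  have c3 := count_hit (G := G) (ι := Fin m) hNpos (F ∪ U)
  rw [hcα] at c2
  simp only [Fintype.card_fin, ← hNd] at c1 c2 c3
  have hex : ∃ Y : Fin m → G.Vt, Function.Injective Y ∧ Disjoint (F ∪ U) (img Y) ∧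
      (G.ind (U ∪ img Y)).MD j (δ + ε / 2) := by
    by_contra hcon
    push Not at hcon
    have hsub : (univ : Finset (Fin m → G.Vt)) ⊆
      (univ.filter fun Y : Fin m → G.Vt => Function.Injective Y ∧ Disjoint U (img Y) ∧
        ¬ (G.ind (U ∪ img Y)).MD j (δ + ε / 2)) ∪
      ((univ.filter fun Y : Fin m → G.Vt => ¬ Function.Injective Y) ∪
      (univ.filter fun Y : Fin m → G.Vt => ¬ Disjoint (F ∪ U) (img Y))) := by
      intro Y _
      simp only [mem_union, mem_filter, mem_univ, true_and]
      have := hcon Y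
      by_cases h1 : Function.Injective Y
      · by_cases h2 : Disjoint (F ∪ U) (img Y)
        · left
          exact ⟨h1, (Finset.disjoint_union_left.1 h2).2, this h1 h2⟩
        · tauto
      · tauto
    have h1 := card_le_card hsub
    have h2 := h1.trans ((card_union_le _ _).trans (Nat.add_le_add_left (card_union_le _ _) _))
    rw [Finset.card_univ, Fintype.card_fun, hcα, Fintype.card_fin, ← hNd] at h2
    have h3 : (N : ℝ) ^ m ≤
       ((univ.filter fun Y : Fin m → G.Vt => Function.Injective Y ∧ Disjoint U (img Y) ∧
        ¬ (G.ind (U ∪ img Y)).MD j (δ + ε / 2)).card : ℝ) +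
      (((univ.filter fun Y : Fin m → G.Vt => ¬ Function.Injective Y).card : ℝ) +
      ((univ.filter fun Y : Fin m → G.Vt => ¬ Disjoint (F ∪ U) (img Y)).card : ℝ)) := by
      exact_mod_cast h2
    have hmr : (1 : ℝ) ≤ m := by exact_mod_cast (by omega : 1 ≤ m)
    have c1' : (((2 : ℕ) : ℝ) + m) ^ j * Real.exp (-(ε ^ 2 / 32 * m)) ≤ 1 / 4 := by
      refine le_trans ?_ (hm1 m (by omega))
      rw [← mul_pow]
      push_cast
      gcongr
      linarith
    have hFU : ((F ∪ U).card : ℝ) ≤ F.card + 2 := by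
      have := card_union_le F U
      rw [hUc] at this
      exact_mod_cast this
    have hF' : 4 * ((m : ℝ) + 2) * F.card ≤ N := by exact_mod_cast hF
    have hN' : 8 * ((m : ℝ) ^ 2 + 2 * m) + 1 ≤ N := by exact_mod_cast hN
    have c4 : (m : ℝ) ^ 2 / N + (m : ℝ) * (F ∪ U).card / N ≤ 1 / 2 := by
      rw [← add_div, div_le_iff₀ hNr]
      have : (m : ℝ) * (F ∪ U).card ≤ m * (F.card + 2) := by gcongr
      have h0 : (0 : ℝ) ≤ F.card := by positivity
      nlinarith
    have hNm : (0 : ℝ) < (N : ℝ) ^ m := by positivity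
    have c5 := mul_le_mul_of_nonneg_right c1' hNm.le
    have c6 := mul_le_mul_of_nonneg_right c4 hNm.le
    rw [add_mul] at c6
    have c1'' := c1.trans c5
    have c2x : ((univ.filter fun Y : Fin m → G.Vt => ¬ Function.Injective Y).card : ℝ) ≤
        (m : ℝ) ^ 2 / N * (N : ℝ) ^ m := by convert c2
    have c1x : ((univ.filter fun Y : Fin m → G.Vt => Function.Injective Y ∧ Disjoint U (img Y) ∧
        ¬ (G.ind (U ∪ img Y)).MD j (δ + ε / 2)).card : ℝ) ≤ 1 / 4 * (N : ℝ) ^ m := by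
      convert c1''
    linarith
  obtain ⟨Y, hinj, hdis, hmd'⟩ := hex
  have hdU := (Finset.disjoint_union_left.1 hdis).2
  have hdF := (Finset.disjoint_union_left.1 hdis).1
  have hcard : (U ∪ img Y).card = m + 2 := by
    rw [Finset.card_union_of_disjoint hdU, hUc, img_card Y hinj, Fintype.card_fin]; omega
  obtain ⟨H⟩ := hn0 (G.ind (U ∪ img Y)) (by simp only [HGraph.ind_verts, hcard]; omega)
    (by simp only [HGraph.ind_verts, hcard]; exact hmd) hmd'
  obtain ⟨e, a, c, hcyc, hed⟩ := H.cycAt (by omega)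
    (by simp only [HGraph.ind_verts, hcard]; exact hmd) U
    (by simp only [HGraph.ind_verts, hcard, hUc]; omega)
  obtain ⟨he, ha, hc, hac, S, hS, hi, hW⟩ := hcyc
  simp only [HGraph.ind_verts] at hW
  have huS : ∀ x ∈ U, x ∈ S := by
    intro x hx
    have h1 : x ∈ e ∪ S := by rw [hW]; exact mem_union_left _ hx
    rcases mem_union.1 h1 with h | h
    · exact absurd hx (Finset.disjoint_left.1 hed h)
    · exact h
  obtain ⟨S', hS', hP⟩ := hS.sub u (huS u (by simp [U])) v (huS v (by simp [U]))
  have hS'W : S' ⊆ U ∪ img Y := hS'.trans (by rw [← hW]; exact subset_union_right)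
  refine ⟨S', hS'W.trans (Finset.union_subset hUV (img_sub Y)), ?_, ?_, ?_⟩
  · refine Finset.disjoint_of_subset_left hS'W (Finset.disjoint_union_left.2 ⟨?_, hdF.symm⟩)
    rw [Finset.disjoint_left]
    intro x hx
    simp [U] at hx
    rcases hx with rfl | rfl <;> assumption
  · exact (card_le_card hS'W).trans hcard.le
  · exact hP.mono fun f hf _ => ((HGraph.mem_ind _ _ _).1 hf).1

end

open Finset
open scoped Classical
noncomputable section

variable {k : ℕ}

theorem c4_ineq {α β : Type*} (A : Finset α) (B : Finset β) (f : α → β → ℝ) :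
    (∑ a ∈ A, ∑ b ∈ B, f a b) ^ 4 ≤ (A.card : ℝ) ^ 2 * (B.card : ℝ) ^ 2 *
      ∑ a ∈ A, ∑ b ∈ B, ∑ a' ∈ A, ∑ b' ∈ B, f a b * f a b' * f a' b * f a' b' := by
  have h1 : (∑ a ∈ A, ∑ b ∈ B, f a b) ^ 2 ≤ A.card * ∑ a ∈ A, (∑ b ∈ B, f a b) ^ 2 :=
    sq_sum_le_card_mul_sum_sq
  have h2 : ∑ a ∈ A, (∑ b ∈ B, f a b) ^ 2 = ∑ p ∈ B ×ˢ B, ∑ a ∈ A, f a p.1 * f a p.2 := by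
    rw [Finset.sum_comm]
    refine Finset.sum_congr rfl fun a _ => ?_
    rw [sq, Finset.sum_mul_sum, Finset.sum_product]
  have h3 : (∑ p ∈ B ×ˢ B, ∑ a ∈ A, f a p.1 * f a p.2) ^ 2 ≤
      (B ×ˢ B).card * ∑ p ∈ B ×ˢ B, (∑ a ∈ A, f a p.1 * f a p.2) ^ 2 := sq_sum_le_card_mul_sum_sq
  have h4 : ∑ p ∈ B ×ˢ B, (∑ a ∈ A, f a p.1 * f a p.2) ^ 2 =
      ∑ a ∈ A, ∑ b ∈ B, ∑ a' ∈ A, ∑ b' ∈ B, f a b * f a b' * f a' b * f a' b' := by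
    rw [Finset.sum_product]
    have : ∀ b ∈ B, ∀ b' ∈ B, (∑ a ∈ A, f a b * f a b') ^ 2 =
        ∑ a ∈ A, ∑ a' ∈ A, f a b * f a b' * f a' b * f a' b' := by
      intro b _ b' _
      rw [sq, Finset.sum_mul_sum]
      refine Finset.sum_congr rfl fun a _ => Finset.sum_congr rfl fun a' _ => by ring
    rw [Finset.sum_comm (s := A) (t := B)]
    refine Finset.sum_congr rfl fun b hb => ?_
    rw [Finset.sum_congr rfl (this b hb), Finset.sum_comm]
    refine Finset.sum_congr rfl fun a _ => ?_
    rw [Finset.sum_comm]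
  rw [h2] at h1
  have h5 := pow_le_pow_left₀ (sq_nonneg _) h1 2
  rw [← pow_mul] at h5
  refine h5.trans ?_
  rw [mul_pow]
  rw [h4, Finset.card_product] at h3
  push_cast at h3
  calc _ ≤ (A.card : ℝ) ^ 2 * ((B.card : ℝ) * B.card *
      ∑ a ∈ A, ∑ b ∈ B, ∑ a' ∈ A, ∑ b' ∈ B, f a b * f a b' * f a' b * f a' b') := by gcongr
    _ = _ := by ring

/-- rooted edges -/
def HGraph.rooted (G : HGraph k) : Finset (ℕ × Finset ℕ) :=
  (G.verts ×ˢ G.edges).filter fun p => p.1 ∈ p.2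

theorem HGraph.mem_rooted (G : HGraph k) (x : ℕ) (g : Finset ℕ) :
    (x, g) ∈ G.rooted ↔ g ∈ G.edges ∧ x ∈ g := by
  simp only [HGraph.rooted, mem_filter, mem_product]
  constructor
  · rintro ⟨⟨_, h⟩, h'⟩; exact ⟨h, h'⟩
  · rintro ⟨h, h'⟩; exact ⟨⟨G.edge_sub g h h', h⟩, h'⟩

def HGraph.partners (G : HGraph k) (p : ℕ × Finset ℕ) : Finset (ℕ × Finset ℕ) :=
  G.rooted.filter fun q => insert q.1 (p.2.erase p.1) ∈ G.edges ∧ insert p.1 (q.2.erase q.1) ∈ G.edges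

def HGraph.atyp (G : HGraph k) (η : ℝ) : Finset (ℕ × Finset ℕ) :=
  G.rooted.filter fun p => ((G.partners p).card : ℝ) < η * (G.verts.card : ℝ) ^ k

theorem atyp_count (G : HGraph k) (hk : 1 ≤ k) (θ : ℝ) (hθ : 0 ≤ θ) :
    ((G.atyp (θ ^ 3)).card : ℝ) ≤ θ * (G.verts.card : ℝ) ^ k := by
  set N := G.verts.card with hN
  set F := G.atyp (θ ^ 3) with hF
  set B := powersetCard (k - 1) G.verts with hB
  have hFr : ∀ p ∈ F, p.2 ∈ G.edges ∧ p.1 ∈ p.2 := fun p hp =>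
    (G.mem_rooted p.1 p.2).1 (mem_filter.1 hp).1
  let f : ℕ → Finset ℕ → ℝ := fun a b => if (a ∉ b ∧ (a, insert a b) ∈ F) then 1 else 0
  have hf0 : ∀ a b, 0 ≤ f a b := fun a b => by simp only [f]; split_ifs <;> norm_num
  have hBN : (B.card : ℝ) ≤ (N : ℝ) ^ (k - 1) := by
    rw [hB, Finset.card_powersetCard]
    exact_mod_cast Nat.choose_le_pow _ _
  let emb : ℕ × Finset ℕ → ℕ × Finset ℕ := fun p => (p.1, p.2.erase p.1)
  have hemb : ∀ p ∈ G.rooted, ∀ q ∈ G.rooted, emb p = emb q → p = q := by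
    rintro ⟨x, g⟩ hp ⟨y, h⟩ hq hpq
    simp only [emb, Prod.mk.injEq] at hpq
    obtain ⟨rfl, h2⟩ := hpq
    have e1 := ((G.mem_rooted _ _).1 hp).2
    have e2 := ((G.mem_rooted _ _).1 hq).2
    rw [← Finset.insert_erase e1, h2, Finset.insert_erase e2]
  have hembB : ∀ p ∈ G.rooted, emb p ∈ G.verts ×ˢ B := by
    rintro ⟨x, g⟩ hp
    obtain ⟨h1, h2⟩ := (G.mem_rooted _ _).1 hp
    simp only [emb, mem_product, hB, Finset.mem_powersetCard]
    refine ⟨G.edge_sub g h1 h2, (Finset.erase_subset _ _).trans (G.edge_sub g h1), ?_⟩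
    rw [Finset.card_erase_of_mem h2, G.edge_card g h1]
  have hsumF : ∑ a ∈ G.verts, ∑ b ∈ B, f a b = F.card := by
    rw [← Finset.sum_product']
    simp only [f, Finset.sum_boole]
    norm_cast
    symm
    refine Finset.card_bij (fun p _ => emb p) ?_ ?_ ?_
    · intro p hp
      have hr := (mem_filter.1 hp).1
      refine mem_filter.2 ⟨hembB p hr, Finset.notMem_erase _ _, ?_⟩
      simp only [emb]
      rw [Finset.insert_erase (hFr p hp).2]
      exact hp
    · intro p hp q hq
      exact hemb p (mem_filter.1 hp).1 q (mem_filter.1 hq).1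
    · rintro ⟨a, b⟩ hab
      obtain ⟨_, h1, h2⟩ := mem_filter.1 hab
      refine ⟨_, h2, ?_⟩
      simp only [emb]
      rw [Finset.erase_insert h1]
  have hinner : ∀ a ∈ G.verts, ∀ b ∈ B, ∑ a' ∈ G.verts, ∑ b' ∈ B, f a b * f a b' * f a' b * f a' b' ≤
      f a b * (θ ^ 3 * (N : ℝ) ^ k) := by
    intro a ha b hb
    by_cases h : a ∉ b ∧ (a, insert a b) ∈ F
    · have hfab : f a b = 1 := by simp only [f, if_pos h]
      have hat := (mem_filter.1 h.2).2
      simp only [hfab, one_mul]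
      refine le_trans ?_ hat.le
      rw [← Finset.sum_product']
      have hle : ∀ p ∈ G.verts ×ˢ B, f a p.2 * f p.1 b * f p.1 p.2 ≤
          if (p.1 ∉ p.2 ∧ (p.1, insert p.1 p.2) ∈ G.partners (a, insert a b)) then (1 : ℝ) else 0 := by
        rintro ⟨a', b'⟩ _
        by_cases h1 : a ∉ b' ∧ (a, insert a b') ∈ F
        · by_cases h2 : a' ∉ b ∧ (a', insert a' b) ∈ F
          · by_cases h3 : a' ∉ b' ∧ (a', insert a' b') ∈ F
            · rw [if_pos]
              · simp only [f, if_pos h1, if_pos h2, if_pos h3]; norm_num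
              · refine ⟨h3.1, mem_filter.2 ⟨(mem_filter.1 h3.2).1, ?_, ?_⟩⟩
                · simp only [Finset.erase_insert h.1]; exact (hFr _ h2.2).1
                · simp only [Finset.erase_insert h3.1]; exact (hFr _ h1.2).1
            · simp only [f, if_neg h3, mul_zero]; split_ifs <;> norm_num
          · simp only [f, if_neg h2, mul_zero, zero_mul]; split_ifs <;> norm_num
        · simp only [f, if_neg h1, zero_mul]; split_ifs <;> norm_num
      refine (sum_le_sum hle).trans ?_
      rw [Finset.sum_boole]
      norm_cast
      refine Finset.card_le_card_of_injOn (fun p => (p.1, insert p.1 p.2)) ?_ ?_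
      · intro p hp
        exact (mem_filter.1 hp).2.2
      · rintro ⟨x, c⟩ hp ⟨y, d⟩ hq hpq
        have h1 := (mem_filter.1 hp).2.1
        have h2 := (mem_filter.1 hq).2.1
        simp only [Prod.mk.injEq] at hpq h1 h2
        obtain ⟨rfl, h3⟩ := hpq
        rw [← Finset.erase_insert h1, h3, Finset.erase_insert h2]
    · have hfab : f a b = 0 := by simp only [f, if_neg h]
      simp [hfab]
  have key := c4_ineq G.verts B f
  have hC : ∑ a ∈ G.verts, ∑ b ∈ B, ∑ a' ∈ G.verts, ∑ b' ∈ B, f a b * f a b' * f a' b * f a' b' ≤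
      F.card * (θ ^ 3 * (N : ℝ) ^ k) := by
    rw [← hsumF, Finset.sum_mul]
    refine sum_le_sum fun a ha => ?_
    rw [Finset.sum_mul]
    exact sum_le_sum fun b hb => hinner a ha b hb
  rw [hsumF] at key
  have h4 : (F.card : ℝ) ^ 4 ≤ (N : ℝ) ^ 2 * ((N : ℝ) ^ (k - 1)) ^ 2 * (F.card * (θ ^ 3 * (N : ℝ) ^ k)) := by
    refine key.trans ?_
    gcongr
  have hNk : (N : ℝ) ^ 2 * ((N : ℝ) ^ (k - 1)) ^ 2 = ((N : ℝ) ^ k) ^ 2 := by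
    rw [← mul_pow, ← pow_succ']; congr 3; omega
  rw [hNk] at h4
  by_contra hcon
  push Not at hcon
  have hT : 0 ≤ θ * (N : ℝ) ^ k := by positivity
  have hFpos : (0 : ℝ) < F.card := lt_of_le_of_lt hT hcon
  have h5 : (θ * (N : ℝ) ^ k) ^ 3 < (F.card : ℝ) ^ 3 := pow_lt_pow_left₀ hcon hT (by norm_num)
  nlinarith

theorem count_contain {G : HGraph k} {ι : Type} [Fintype ι] [DecidableEq ι] 
    (B : Finset (Finset ℕ)) (hB : B ⊆ G.edges) (θ : ℝ) 
    (hBc : (B.card : ℝ) ≤ θ * (G.verts.card : ℝ) ^ k) :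
    ((univ.filter fun Y : ι → G.Vt => ∃ g ∈ B, g ⊆ img Y).card : ℝ) ≤
      (Fintype.card ι : ℝ) ^ k * ((k : ℝ) ^ k * θ * (G.verts.card : ℝ) ^ Fintype.card ι) := by
  have hcα : Fintype.card G.Vt = G.verts.card := Fintype.card_coe _
  have hz : ((univ.filter fun z : Fin k → G.Vt => img z ∈ B).card : ℝ) ≤
      ((k : ℝ) ^ k * θ) * (Fintype.card G.Vt : ℝ) ^ Fintype.card (Fin k) := by
    have h1 : (univ.filter fun z : Fin k → G.Vt => img z ∈ B).card ≤ B.card * k ^ k := by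
      have hm : ∀ z ∈ (univ.filter fun z : Fin k → G.Vt => img z ∈ B), img z ∈ B :=
        fun z hz => (mem_filter.1 hz).2
      rw [Finset.card_eq_sum_card_fiberwise (f := fun z : Fin k → G.Vt => img z) hm]
      refine (Finset.sum_le_card_nsmul _ _ (k ^ k) ?_).trans (by rw [smul_eq_mul])
      intro g hg
      have hgc := G.edge_card g (hB hg)
      calc _ ≤ (Fintype.piFinset fun _ : Fin k => g).card := by
            refine Finset.card_le_card_of_injOn (fun z i => (z i : ℕ)) ?_ ?_
            · intro z hz'
              have := (mem_filter.1 hz').2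
              refine Fintype.mem_piFinset.2 fun i => ?_
              rw [← this]
              exact (mem_img z _).2 ⟨i, rfl⟩
            · intro z _ w _ h
              funext i
              exact Subtype.ext (congrFun h i)
        _ = k ^ k := by rw [Fintype.card_piFinset_const, hgc]
    rw [Fintype.card_fin, hcα]
    calc _ ≤ ((B.card * k ^ k : ℕ) : ℝ) := by exact_mod_cast h1
      _ ≤ (θ * (G.verts.card : ℝ) ^ k) * (k : ℝ) ^ k := by push_cast; gcongr
      _ = _ := by ring
  have hsub : (univ.filter fun Y : ι → G.Vt => ∃ g ∈ B, g ⊆ img Y) ⊆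
      (univ.filter fun ρ : Fin k → ι => Function.Injective ρ).biUnion
        fun ρ => univ.filter fun Y : ι → G.Vt => img (Y ∘ ρ) ∈ B := by
    intro Y hY
    obtain ⟨g, hg, hgY⟩ := (mem_filter.1 hY).2
    have hgc := G.edge_card g (hB hg)
    have : ∀ x : g, ∃ i, (Y i : ℕ) = x := fun x => (mem_img Y x).1 (hgY x.2)
    choose i hi using this
    let e := g.equivFinOfCardEq hgc
    refine mem_biUnion.2 ⟨fun r => i (e.symm r), ?_, ?_⟩
    · refine mem_filter.2 ⟨mem_univ _, ?_⟩
      intro r s hrs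
      have h1 := hi (e.symm r)
      have hrs' : i (e.symm r) = i (e.symm s) := hrs
      rw [hrs', hi] at h1
      exact e.symm.injective (Subtype.ext h1.symm)
    · refine mem_filter.2 ⟨mem_univ _, ?_⟩
      have : img (Y ∘ fun r => i (e.symm r)) = g := by
        ext x
        rw [mem_img]
        constructor
        · rintro ⟨r, rfl⟩
          simp only [Function.comp, hi]
          exact (e.symm r).2
        · intro hx
          exact ⟨e ⟨x, hx⟩, by simp [hi]⟩
      rw [this]; exact hg
  have h2 : ((univ.filter fun Y : ι → G.Vt => ∃ g ∈ B, g ⊆ img Y).card : ℝ) ≤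
      ∑ ρ ∈ (univ.filter fun ρ : Fin k → ι => Function.Injective ρ),
        ((univ.filter fun Y : ι → G.Vt => img (Y ∘ ρ) ∈ B).card : ℝ) := by
    exact_mod_cast (card_le_card hsub).trans Finset.card_biUnion_le
  refine h2.trans ?_
  have h3 : ∀ ρ ∈ (univ.filter fun ρ : Fin k → ι => Function.Injective ρ),
      ((univ.filter fun Y : ι → G.Vt => img (Y ∘ ρ) ∈ B).card : ℝ) ≤
       (k : ℝ) ^ k * θ * (G.verts.card : ℝ) ^ Fintype.card ι := by
    intro ρ hρ
    have := push_le ρ (mem_filter.1 hρ).2 (fun z : Fin k → G.Vt => img z ∈ B) _ hz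
    rwa [hcα] at this
  refine (Finset.sum_le_card_nsmul _ _ _ h3).trans ?_
  rw [nsmul_eq_mul]
  have h4 : ((univ.filter fun ρ : Fin k → ι => Function.Injective ρ).card : ℝ) ≤ (Fintype.card ι : ℝ) ^ k := by
    have := Finset.card_filter_le (univ : Finset (Fin k → ι)) (fun ρ => Function.Injective ρ)
    rw [Finset.card_univ, Fintype.card_fun, Fintype.card_fin] at this
    exact_mod_cast this
  have h0 : 0 ≤ θ * (G.verts.card : ℝ) ^ k := le_trans (by positivity) hBc
  by_cases hι : (G.verts.card : ℝ) ^ k = 0 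
  · by_cases hk : k = 0
    · subst hk
      simp at hι
    · have hN0 : (G.verts.card : ℝ) = 0 := by simpa [hk] using hι
      by_cases hc : Fintype.card ι = 0
      · rw [hc, Nat.cast_zero, zero_pow hk, zero_mul]
        rw [hc, Nat.cast_zero, zero_pow hk] at h4
        have : ((univ.filter fun ρ : Fin k → ι => Function.Injective ρ).card : ℝ) = 0 :=
          le_antisymm h4 (by positivity)
        rw [this, zero_mul]
      · rw [hN0, zero_pow hc]; simp
  · have hp : 0 < (G.verts.card : ℝ) ^ k := lt_of_le_of_ne (by positivity) (Ne.symm hι)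
    have hθ : 0 ≤ θ := by
      by_contra h
      push Not at h
      nlinarith
    gcongr

end

open Finset
open scoped Classical
noncomputable section

variable {k : ℕ}

theorem slots (G : HGraph k) (hk : 2 ≤ k) (s K : ℕ)
    (hconn : ∀ F : Finset ℕ, F.card ≤ K → ∀ u ∈ G.verts, ∀ v ∈ G.verts, u ≠ v →
      u ∉ F → v ∉ F → ∃ S ⊆ G.verts, Disjoint S F ∧ S.card ≤ s ∧ LP G.edges u v S)
    (F : Finset ℕ) (u : ℕ) (hu : u ∈ G.verts) (huF : u ∉ F) (P : Finset (ℕ × Finset ℕ))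
    (hpart : ∀ p ∈ P, ∀ F' : Finset ℕ, F'.card ≤ K → ∃ q ∈ G.partners p, Disjoint q.2 F')
    (hK : F.card + 1 + P.card * (s + k) + k ≤ K) :
    ∃ (Z : Finset ℕ) (w : ℕ) (f : ℕ × Finset ℕ → Finset ℕ) (x' y' : ℕ × Finset ℕ → ℕ),
      w ∈ Z ∧ Z ⊆ G.verts ∧ Disjoint Z F ∧ Z.card ≤ 1 + P.card * (s + k) ∧
      (∀ p ∈ P, (x' p, f p) ∈ G.partners p ∧ y' p ∈ f p ∧ y' p ≠ x' p ∧ f p ⊆ Z) ∧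
      ∀ W : ℕ × Finset ℕ → Finset ℕ, (∀ p ∈ P, LP G.edges (x' p) (y' p) (f p ∪ W p) ∧ Disjoint (W p) Z) →
        (∀ p ∈ P, ∀ q ∈ P, p ≠ q → Disjoint (W p) (W q)) → LP G.edges u w (Z ∪ P.biUnion W) := by
  induction P using Finset.induction_on with
  | empty =>
    refine ⟨{u}, u, fun _ => ∅, fun _ => 0, fun _ => 0, by simp, by simpa using hu,
      by simpa using huF, by simp, by simp, ?_⟩
    intro W _ _
    simpa using LP.nil u
  | insert p P hp ih =>
    rw [Finset.card_insert_of_notMem hp] at hK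
    obtain ⟨Z, w, f, x', y', hwZ, hZV, hZF, hZc, hslot, hpath⟩ :=
      ih (fun q hq => hpart q (mem_insert_of_mem hq)) (by
        rw [add_mul] at hK; omega)
    have hcard : (F ∪ Z).card + k ≤ K := by
      have := card_union_le F Z
      rw [add_mul] at hK
      omega
    obtain ⟨⟨a, g⟩, hq, hgd⟩ := hpart p (mem_insert_self _ _) (F ∪ Z) (by omega)
    have hgr := (G.mem_rooted a g).1 (mem_filter.1 hq).1
    simp only at hgd
    have hgc := G.edge_card g hgr.1
    have hgF := (Finset.disjoint_union_right.1 hgd).1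
    have hgZ := (Finset.disjoint_union_right.1 hgd).2
    obtain ⟨b, hb, hba⟩ : ∃ b ∈ g, b ≠ a := by
      have : 0 < (g.erase a).card := by rw [Finset.card_erase_of_mem hgr.2]; omega
      obtain ⟨b, hb⟩ := card_pos.1 this
      exact ⟨b, Finset.mem_of_mem_erase hb, Finset.ne_of_mem_erase hb⟩
    have hwg : w ∉ g := fun h => Finset.disjoint_left.1 hgZ h hwZ
    have hwa : w ≠ a := fun h => hwg (h ▸ hgr.2)
    obtain ⟨S, hSV, hSd, hSc, hSP⟩ := hconn (F ∪ Z.erase w ∪ g.erase a) (by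
        have h1 := card_union_le (F ∪ Z.erase w) (g.erase a)
        have h2 : (F ∪ Z.erase w).card ≤ (F ∪ Z).card :=
          card_le_card (Finset.union_subset_union_right (Finset.erase_subset _ _))
        have h3 := card_le_card (Finset.erase_subset a g)
        omega) w (hZV hwZ) a (G.edge_sub g hgr.1 hgr.2) hwa
        (by
          simp only [mem_union, Finset.mem_erase]
          have := Finset.disjoint_left.1 hZF hwZ
          tauto)
        (by
          simp only [mem_union, Finset.mem_erase]
          have := Finset.disjoint_left.1 hgF hgr.2
          have := Finset.disjoint_left.1 hgZ hgr.2
          tauto)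
    have hSF : Disjoint S F := by
      refine Finset.disjoint_of_subset_right ?_ hSd
      intro x hx; simp [hx]
    have hSZ : ∀ x ∈ S, x ∈ Z → x = w := by
      intro x hx hxZ
      by_contra hne
      exact Finset.disjoint_left.1 hSd hx (by simp [hne, hxZ])
    have hSg : ∀ x ∈ S, x ∈ g → x = a := by
      intro x hx hxZ
      by_contra hne
      exact Finset.disjoint_left.1 hSd hx (by simp [hne, hxZ])
    have hne : ∀ q ∈ P, q ≠ p := fun q hq h => hp (h ▸ hq)
    refine ⟨Z ∪ S ∪ g, b, Function.update f p g, Function.update x' p a, Function.update y' p b,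
      by simp [hb], ?_, ?_, ?_, ?_, ?_⟩
    · exact Finset.union_subset (Finset.union_subset hZV hSV) (G.edge_sub g hgr.1)
    · exact Finset.disjoint_union_left.2 ⟨Finset.disjoint_union_left.2 ⟨hZF, hSF⟩, hgF⟩
    · have h1 := card_union_le (Z ∪ S) g
      have h2 := card_union_le Z S
      rw [Finset.card_insert_of_notMem hp, add_mul]
      omega
    · intro q hq
      rcases mem_insert.1 hq with rfl | hq
      · simp only [Function.update_self]
        exact ⟨by assumption, hb, hba, subset_union_right⟩
      · rw [Function.update_of_ne (hne q hq), Function.update_of_ne (hne q hq),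
          Function.update_of_ne (hne q hq)]
        obtain ⟨h1, h2, h3, h4⟩ := hslot q hq
        refine ⟨h1, h2, h3, h4.trans ?_⟩
        intro x hx; simp [hx]
    · intro W hW hWd
      have h1 : LP G.edges u w (Z ∪ P.biUnion W) := by
        refine hpath W ?_ ?_
        · intro q hq
          have := hW q (mem_insert_of_mem hq)
          rw [Function.update_of_ne (hne q hq), Function.update_of_ne (hne q hq),
            Function.update_of_ne (hne q hq)] at this
          refine ⟨this.1, Finset.disjoint_of_subset_right ?_ this.2⟩
          intro x hx; simp [hx]
        · intro q hq r hr
          exact hWd q (mem_insert_of_mem hq) r (mem_insert_of_mem hr)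
      have h2 := hW p (mem_insert_self _ _)
      simp only [Function.update_self] at h2
      obtain ⟨h2, h2d⟩ := h2
      have hWZ : ∀ q ∈ insert p P, ∀ x ∈ W q, x ∉ Z ∧ x ∉ S ∧ x ∉ g := by
        intro q hq x hx
        have := Finset.disjoint_left.1 (hW q hq).2 hx
        simp only [mem_union] at this
        tauto
      have h3 : (Z ∪ P.biUnion W) ∩ S = {w} := by
        ext x
        simp only [mem_inter, mem_union, mem_biUnion, mem_singleton]
        constructor
        · rintro ⟨h | ⟨q, hq, hx⟩, hS⟩
          · exact hSZ x hS h
          · exact absurd hS (hWZ q (mem_insert_of_mem hq) x hx).2.1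
        · rintro rfl
          exact ⟨Or.inl hwZ, hSP.mem_left⟩
      have h4 := h1.trans hSP h3
      have h5 : (Z ∪ P.biUnion W ∪ S) ∩ (g ∪ W p) = {a} := by
        ext x
        simp only [mem_inter, mem_union, mem_biUnion, mem_singleton]
        constructor
        · rintro ⟨(h | ⟨q, hq, hx⟩) | hS, hg | hWp⟩
          · exact absurd h (Finset.disjoint_left.1 hgZ hg)
          · exact absurd h (hWZ p (mem_insert_self _ _) x hWp).1
          · exact absurd hg (hWZ q (mem_insert_of_mem hq) x hx).2.2
          · exact absurd hWp (Finset.disjoint_left.1 (hWd q (mem_insert_of_mem hq) p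
              (mem_insert_self _ _) (hne q hq)) hx)
          · exact hSg x hS hg
          · exact absurd hS (hWZ p (mem_insert_self _ _) x hWp).2.1
        · rintro rfl
          exact ⟨Or.inr hSP.mem_right, Or.inl hgr.2⟩
      have h6 := h4.trans h2 h5
      convert h6 using 1
      ext x
      simp only [mem_union, mem_biUnion, mem_insert]
      constructor
      · rintro (((h | h) | h) | ⟨q, rfl | hq, hx⟩)
        · tauto
        · tauto
        · tauto
        · tauto
        · left; left; right; exact ⟨q, hq, hx⟩
      · rintro (((h | ⟨q, hq, h⟩) | h) | (h | h))
        · tauto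
        · right; exact ⟨q, Or.inr hq, h⟩
        · tauto
        · tauto
        · right; exact ⟨p, Or.inl rfl, h⟩

end

open Finset
open scoped Classical
noncomputable section

theorem CycAt.lift {k : ℕ} {G : HGraph k} {U W e : Finset ℕ} {a c : ℕ}
    (h : CycAt (G.ind U).edges W e a c) : CycAt G.edges W e a c ∧ e ⊆ U := by
  obtain ⟨he, ha, hc, hac, S, hS, hi, hW⟩ := h
  have he' := (G.mem_ind U e).1 he
  refine ⟨⟨he'.1, ha, hc, hac, S, hS.mono ?_, hi, hW⟩, he'.2⟩
  intro f hf _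
  exact ((G.mem_ind U f).1 hf).1

set_option maxHeartbeats 1000000 in
theorem reconf (j k : ℕ) (hj : 1 ≤ j) (hjk : j < k) (ε : ℝ) (hε : 0 < ε) :
    ∃ M0 : ℕ, ∀ G : HGraph k, ∀ X : Finset ℕ, M0 ≤ X.card → (k - 1) ∣ X.card →
      ∀ (V' e : Finset ℕ) (a c : ℕ), Disjoint X V' → CycAt G.edges V' e a c →
      (G.ind (X ∪ e)).MD j (looseHamThreshold j k + ε) →
      ∃ (W2 g2 W3 g3 : Finset ℕ) (x2 y2 x3 y3 : ℕ), CycAt G.edges W2 g2 x2 y2 ∧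
        CycAt G.edges W3 g3 x3 y3 ∧ Disjoint W2 W3 ∧ W2 ∪ W3 = X ∪ V' ∧ g2 ⊆ X ∧ g3 ⊆ X := by
  obtain ⟨s, N0, hs, hconn⟩ := connector j k hj hjk ε hε
  obtain ⟨n0, hn0⟩ := black_box j k hjk (ε / 2) (by linarith)
  have hk : 2 ≤ k := by omega
  refine ⟨N0 + n0 + 4 * s * (2 * k + s) + (k - 1) * (2 * k + 2) + 2 * s + 2 * k +
    ⌈(2 * s + 2 * k : ℝ) / (ε / 2)⌉₊, ?_⟩
  intro G X hX hdX V' e a c hXV hcyc hmd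
  set m := X.card with hm
  obtain ⟨he, ha, hc, hac, S, hS, hi, hV'⟩ := hcyc
  have heV' : e ⊆ V' := by rw [← hV']; exact subset_union_left
  have hSV' : S ⊆ V' := by rw [← hV']; exact subset_union_right
  have hXe : Disjoint X e := Finset.disjoint_of_subset_right heV' hXV
  have hec := G.edge_card e he
  set H := G.ind (X ∪ e) with hH
  have hHv : H.verts = X ∪ e := rfl
  have hHc : H.verts.card = m + k := by
    rw [hHv, Finset.card_union_of_disjoint hXe, hec]
  have hmr : (2 * s + 2 * k : ℝ) ≤ ε / 2 * (m + k) := by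
    have h1 := Nat.le_ceil ((2 * s + 2 * k : ℝ) / (ε / 2))
    have h2 : ((⌈(2 * s + 2 * k : ℝ) / (ε / 2)⌉₊ : ℕ) : ℝ) ≤ m := Nat.cast_le.2 (by omega)
    have h3 := h1.trans h2
    rw [div_le_iff₀ (by positivity)] at h3
    nlinarith [(Nat.cast_nonneg k : (0:ℝ) ≤ k)]
  -- g2
  have hXmd : (H.ind X).MD j (looseHamThreshold j k + ε / 2) := by
    refine HGraph.MD.delete hjk (thr_nonneg j k) hε hmd (by rw [hHv]; exact subset_union_left) ?_
    have : H.verts \ X = e := by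
      rw [hHv, Finset.union_sdiff_left]; exact Finset.sdiff_eq_self_of_disjoint hXe.symm
    rw [this, hec, hHc]
    push_cast
    have : (0 : ℝ) ≤ s := by positivity
    linarith
  obtain ⟨H2⟩ := hn0 (H.ind X) (by simp only [HGraph.ind_verts]; omega) hdX hXmd
  obtain ⟨g2, x2, y2, hc2, -⟩ := H2.cycAt hk hdX ∅ (by
    simp only [HGraph.ind_verts, Finset.card_empty]
    have : (k - 1) * (2 * 0 + 2) ≤ (k - 1) * (2 * k + 2) := Nat.mul_le_mul_left _ (by omega)
    omega)
  obtain ⟨hc2, hg2X⟩ := hc2.lift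
  obtain ⟨hc2, -⟩ := hc2.lift
  obtain ⟨hg2, hx2, hy2, hxy2, -⟩ := hc2
  have hg2c := G.edge_card g2 hg2
  have hX' : ∀ x ∈ X, x ∉ e := fun x hx h => Finset.disjoint_left.1 hXe hx h
  have heE : ∀ x ∈ e, x ∉ g2 := fun x hx h => hX' x (hg2X h) hx
  -- R1
  obtain ⟨R1, hR1V, hR1d, hR1c, hR1⟩ := hconn H (by rw [hHc]; omega) hmd (g2.erase y2 ∪ e.erase c) (by
      have h1 := card_union_le (g2.erase y2) (e.erase c)
      have h2 := card_le_card (Finset.erase_subset y2 g2)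
      have h3 := card_le_card (Finset.erase_subset c e)
      rw [hHc]
      have : 4 * s * (g2.erase y2 ∪ e.erase c).card ≤ 4 * s * (2 * k + s) :=
        Nat.mul_le_mul_left _ (by omega)
      omega) y2 (by rw [hHv]; exact mem_union_left _ (hg2X hy2))
      c (by rw [hHv]; exact mem_union_right _ hc)
      (by rintro rfl; exact heE _ hc hy2)
      (by
        simp only [mem_union, Finset.mem_erase]
        have := hX' y2 (hg2X hy2)
        tauto)
      (by
        simp only [mem_union, Finset.mem_erase]
        have := heE c hc
        tauto)
  have hR1g : ∀ x ∈ R1, x ∈ g2 → x = y2 := by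
    intro x hx hxg
    by_contra hne
    exact Finset.disjoint_left.1 hR1d hx (by simp [hne, hxg])
  have hR1e : ∀ x ∈ R1, x ∈ e → x = c := by
    intro x hx hxg
    by_contra hne
    exact Finset.disjoint_left.1 hR1d hx (by simp [hne, hxg])
  obtain ⟨R2, hR2V, hR2d, hR2c, hR2⟩ := hconn H (by rw [hHc]; omega) hmd
      (g2.erase x2 ∪ e.erase a ∪ R1) (by
      have h0 := card_union_le (g2.erase x2 ∪ e.erase a) R1
      have h1 := card_union_le (g2.erase x2) (e.erase a)
      have h2 := card_le_card (Finset.erase_subset x2 g2)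
      have h3 := card_le_card (Finset.erase_subset a e)
      rw [hHc]
      have : 4 * s * (g2.erase x2 ∪ e.erase a ∪ R1).card ≤ 4 * s * (2 * k + s) :=
        Nat.mul_le_mul_left _ (by omega)
      omega) a (by rw [hHv]; exact mem_union_right _ ha)
      x2 (by rw [hHv]; exact mem_union_left _ (hg2X hx2))
      (by rintro rfl; exact heE _ ha hx2)
      (by
        simp only [mem_union, Finset.mem_erase]
        have h1 := heE a ha
        have h2 : a ∉ R1 := fun h => hac (hR1e a h ha)
        tauto)
      (by
        simp only [mem_union, Finset.mem_erase]
        have h1 := hX' x2 (hg2X hx2)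
        have h2 : x2 ∉ R1 := fun h => hxy2 (hR1g x2 h hx2)
        tauto)
  have hR2g : ∀ x ∈ R2, x ∈ g2 → x = x2 := by
    intro x hx hxg
    by_contra hne
    exact Finset.disjoint_left.1 hR2d hx (by simp [hne, hxg])
  have hR2e : ∀ x ∈ R2, x ∈ e → x = a := by
    intro x hx hxg
    by_contra hne
    exact Finset.disjoint_left.1 hR2d hx (by simp [hne, hxg])
  have hR21 : ∀ x ∈ R2, x ∉ R1 := by
    intro x hx hxg
    exact Finset.disjoint_left.1 hR2d hx (by simp [hxg])
  have hSe : ∀ x, x ∈ e → (x ∈ S ↔ x = a ∨ x = c) := by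
    intro x hx
    have : x ∈ e ∩ S ↔ x ∈ ({a, c} : Finset ℕ) := by rw [hi]
    simpa [hx] using this
  have hSX : ∀ x ∈ S, x ∉ X := fun x hx h => Finset.disjoint_left.1 hXV h (hSV' hx)
  have hRV : ∀ x, x ∈ R1 ∨ x ∈ R2 → x ∈ X ∨ x ∈ e := by
    intro x hx
    have : x ∈ H.verts := hx.elim (fun h => hR1V h) (fun h => hR2V h)
    rw [hHv] at this
    exact mem_union.1 this
  have hHG : ∀ f ∈ H.edges, f ∈ G.edges := fun f hf => ((G.mem_ind _ f).1 hf).1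
  have hR1' : LP G.edges y2 c R1 := hR1.mono fun f hf _ => hHG f hf
  have hR2' : LP G.edges a x2 R2 := hR2.mono fun f hf _ => hHG f hf
  have hcS := hS.mem_left
  have haS := hS.mem_right
  have hcR1 := hR1.mem_right
  have haR2 := hR2.mem_left
  have hy2R1 := hR1.mem_left
  have hx2R2 := hR2.mem_right
  have i1 : R1 ∩ S = {c} := by
    ext x
    simp only [mem_inter, mem_singleton]
    constructor
    · rintro ⟨h1, h2⟩
      rcases hRV x (Or.inl h1) with h | h
      · exact absurd h (hSX x h2)
      · exact hR1e x h1 h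
    · rintro rfl; exact ⟨hcR1, hcS⟩
  have i2 : (R1 ∪ S) ∩ R2 = {a} := by
    ext x
    simp only [mem_inter, mem_singleton, mem_union]
    constructor
    · rintro ⟨h1 | h1, h2⟩
      · exact absurd h1 (hR21 x h2)
      · rcases hRV x (Or.inr h2) with h | h
        · exact absurd h (hSX x h1)
        · exact hR2e x h2 h
    · rintro rfl; exact ⟨Or.inr haS, haR2⟩
  have hT := (hR1'.trans hS i1).trans hR2' i2
  have c2 : CycAt G.edges (g2 ∪ (R1 ∪ S ∪ R2)) g2 x2 y2 := by
    refine ⟨hg2, hx2, hy2, hxy2, _, hT, ?_, rfl⟩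
    ext x
    simp only [mem_inter, mem_union, mem_insert, mem_singleton]
    constructor
    · rintro ⟨h1, (h2 | h2) | h2⟩
      · exact Or.inr (hR1g x h2 h1)
      · exact absurd (hg2X h1) (hSX x h2)
      · exact Or.inl (hR2g x h2 h1)
    · rintro (rfl | rfl)
      · exact ⟨hx2, Or.inr hx2R2⟩
      · exact ⟨hy2, Or.inl (Or.inl hy2R1)⟩
  set W3 := (X ∪ e) \ (R1 ∪ R2 ∪ g2) with hW3
  have hrem : H.verts \ W3 = R1 ∪ R2 ∪ g2 := by
    rw [hHv, hW3, Finset.sdiff_sdiff_self_left]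
    refine Finset.inter_eq_right.2 ?_
    refine Finset.union_subset (Finset.union_subset hR1V hR2V) (hg2X.trans subset_union_left)
  obtain ⟨l1, hl1⟩ := hR1'.card_eq hk G.edge_card
  obtain ⟨l2, hl2⟩ := hR2'.card_eq hk G.edge_card
  have hremc : (R1 ∪ R2 ∪ g2).card = l1 * (k - 1) + l2 * (k - 1) + k := by
    have h1 : Disjoint R1 R2 := Finset.disjoint_left.2 fun x h1 h2 => hR21 x h2 h1
    have h2 : (R1 ∪ R2) ∩ g2 = {x2, y2} := by
      ext x
      simp only [mem_inter, mem_union, mem_insert, mem_singleton]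
      constructor
      · rintro ⟨h | h, h'⟩
        · exact Or.inr (hR1g x h h')
        · exact Or.inl (hR2g x h h')
      · rintro (rfl | rfl)
        · exact ⟨Or.inr hx2R2, hx2⟩
        · exact ⟨Or.inl hy2R1, hy2⟩
    have h3 := Finset.card_union_add_card_inter (R1 ∪ R2) g2
    rw [h2, Finset.card_pair hxy2, Finset.card_union_of_disjoint h1, hl1, hl2, hg2c] at h3
    omega
  have hW3V : W3 ⊆ H.verts := Finset.sdiff_subset
  have hW3c : W3.card + (l1 * (k - 1) + l2 * (k - 1)) = m := by
    have := Finset.card_sdiff_add_card_eq_card hW3V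
    rw [hrem, hremc, hHc] at this
    omega
  have hW3d : (k - 1) ∣ W3.card := by
    have h1 : (k - 1) ∣ l1 * (k - 1) + l2 * (k - 1) := ⟨l1 + l2, by ring⟩
    rw [← hW3c] at hdX
    exact (Nat.dvd_add_left h1).1 hdX
  have hW3md : (H.ind W3).MD j (looseHamThreshold j k + ε / 2) := by
    refine HGraph.MD.delete hjk (thr_nonneg j k) hε hmd hW3V ?_
    rw [hrem, hremc, hHc]
    push_cast
    have h1 : ((l1 * (k - 1) + 1 : ℕ) : ℝ) ≤ s := by rw [← hl1]; exact_mod_cast hR1c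
    have h2 : ((l2 * (k - 1) + 1 : ℕ) : ℝ) ≤ s := by rw [← hl2]; exact_mod_cast hR2c
    push_cast at h1 h2
    have : (0 : ℝ) ≤ k := by positivity
    linarith
  obtain ⟨H3⟩ := hn0 (H.ind W3) (by simp only [HGraph.ind_verts]; omega) hW3d hW3md
  obtain ⟨g3, x3, y3, hc3, hg3e⟩ := H3.cycAt hk hW3d e (by
    simp only [HGraph.ind_verts, hec]
    omega)
  obtain ⟨hc3, hg3X⟩ := hc3.lift
  obtain ⟨hc3, -⟩ := hc3.lift
  refine ⟨_, g2, W3, g3, x2, y2, x3, y3, c2, hc3, ?_, ?_, hg2X, ?_⟩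
  · rw [Finset.disjoint_left]
    intro x hx hx3
    rw [hW3, mem_sdiff] at hx3
    simp only [mem_union] at hx hx3
    obtain ⟨h3, h4⟩ := hx3
    rcases hx with h | (h | h) | h
    · exact h4 (Or.inr h)
    · exact h4 (Or.inl (Or.inl h))
    · rcases h3 with h3 | h3
      · exact hSX x h h3
      · rcases (hSe x h3).1 h with rfl | rfl
        · exact h4 (Or.inl (Or.inr haR2))
        · exact h4 (Or.inl (Or.inl hcR1))
    · exact h4 (Or.inl (Or.inr h))
  · ext x
    rw [← hV']
    simp only [hW3, mem_union, mem_sdiff]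
    constructor
    · rintro ((h | (h | h) | h) | ⟨h | h, _⟩)
      · exact Or.inl (hg2X h)
      · exact (hRV x (Or.inl h)).imp id Or.inl
      · exact Or.inr (Or.inr h)
      · exact (hRV x (Or.inr h)).imp id Or.inl
      · exact Or.inl h
      · exact Or.inr (Or.inl h)
    · intro h
      by_cases h0 : (x ∈ R1 ∨ x ∈ R2) ∨ x ∈ g2
      · rcases h0 with (h0 | h0) | h0
        · exact Or.inl (Or.inr (Or.inl (Or.inl h0)))
        · exact Or.inl (Or.inr (Or.inr h0))
        · exact Or.inl (Or.inl h0)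
      · rcases h with h | h | h
        · exact Or.inr ⟨Or.inl h, h0⟩
        · exact Or.inr ⟨Or.inr h, h0⟩
        · exact Or.inl (Or.inr (Or.inl (Or.inr h)))
  · intro x hx
    have h1 := hg3X hx
    rw [hW3, mem_sdiff, mem_union] at h1
    rcases h1.1 with h | h
    · exact h
    · exact absurd h (Finset.disjoint_left.1 hg3e hx)

end

open Finset
open scoped Classical
noncomputable section

set_option maxHeartbeats 1000000 in
theorem hcn_det (j k : ℕ) (hj : 1 ≤ j) (hjk : j < k) (ε : ℝ) (hε : 0 < ε) :
    ∃ M0 : ℕ, ∀ (G : HGraph k) (X : Finset ℕ) (s K u v : ℕ), M0 ≤ X.card → (k - 1) ∣ X.card →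
      X ⊆ G.verts → u ∈ G.verts → v ∈ G.verts → u ∉ X → v ∉ X → u ≠ v →
      (∀ F : Finset ℕ, F.card ≤ K → ∀ u ∈ G.verts, ∀ v ∈ G.verts, u ≠ v →
        u ∉ F → v ∉ F → ∃ S ⊆ G.verts, Disjoint S F ∧ S.card ≤ s ∧ LP G.edges u v S) →
      (∀ p ∈ (G.ind X).rooted, ∀ F' : Finset ℕ, F'.card ≤ K → ∃ q ∈ G.partners p, Disjoint q.2 F') →
      X.card + 2 + (G.ind X).rooted.card * (s + k) + k ≤ K →
      (k - 1) ∣ G.verts.card - 1 →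
      (∀ V' ⊆ G.verts, (G.verts \ V').card ≤ 2 * K + s → (k - 1) ∣ V'.card →
        2 * (k - 1) ≤ V'.card ∧ Nonempty (LooseHamCycle k (G.ind V'))) →
      (∀ e ∈ G.edges, Disjoint e X → (G.ind (X ∪ e)).MD j (looseHamThreshold j k + ε)) →
      LP G.edges u v G.verts := by
  obtain ⟨M0, hM0⟩ := reconf j k hj hjk ε hε
  have hk : 2 ≤ k := by omega
  refine ⟨M0, ?_⟩
  intro G X s K u v hX hXd hXV hu hv huX hvX huv hconn hpart hK hNd hrest hhost
  set P := (G.ind X).rooted with hP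
  have hFc : (insert v X).card ≤ X.card + 1 := Finset.card_insert_le _ _
  obtain ⟨Z, w, f, x', y', hwZ, hZV, hZF, hZc, hslot, hpath⟩ := slots G hk s K hconn (insert v X) u hu
    (by simp [huX, huv]) P hpart (by omega)
  have hwv : w ≠ v := by
    rintro rfl
    exact Finset.disjoint_left.1 hZF hwZ (mem_insert_self _ _)
  have hvZ : v ∉ Z := fun h => Finset.disjoint_left.1 hZF h (mem_insert_self _ _)
  have hZX : ∀ x ∈ Z, x ∉ X := fun x h h' => Finset.disjoint_left.1 hZF h (mem_insert_of_mem h')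
  obtain ⟨S, hSV, hSd, hSc, hSP⟩ := hconn (X ∪ Z.erase w) (by
      have h1 := card_union_le X (Z.erase w)
      have h2 := card_le_card (Finset.erase_subset w Z)
      omega) w (hZV hwZ) v hv hwv (by simp [hZX w hwZ]) (by simp [hvX, hvZ])
  have hSX : ∀ x ∈ S, x ∉ X := fun x hx h => Finset.disjoint_left.1 hSd hx (by simp [h])
  have hSZ : ∀ x ∈ S, x ∈ Z → x = w := by
    intro x hx hxZ
    by_contra hne
    exact Finset.disjoint_left.1 hSd hx (by simp [hne, hxZ])
  have hfull : ∀ W : ℕ × Finset ℕ → Finset ℕ,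
      (∀ p ∈ P, LP G.edges (x' p) (y' p) (f p ∪ W p) ∧ Disjoint (W p) (Z ∪ S)) →
      (∀ p ∈ P, ∀ q ∈ P, p ≠ q → Disjoint (W p) (W q)) →
      LP G.edges u v (Z ∪ P.biUnion W ∪ S) := by
    intro W h1 h2
    refine (hpath W (fun p hp => ⟨(h1 p hp).1, Finset.disjoint_of_subset_right
      subset_union_left (h1 p hp).2⟩) h2).trans hSP ?_
    ext x
    simp only [mem_inter, mem_union, mem_biUnion, mem_singleton]
    constructor
    · rintro ⟨h | ⟨q, hq, hx⟩, hS⟩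
      · exact hSZ x hS h
      · exact absurd (mem_union_right _ hS) (Finset.disjoint_left.1 (h1 q hq).2 hx)
    · rintro rfl
      exact ⟨Or.inl hwZ, hSP.mem_left⟩
  have hsl : ∀ p ∈ P, f p ∈ G.edges ∧ x' p ∈ f p := fun p hp =>
    (G.mem_rooted _ _).1 (mem_filter.1 (hslot p hp).1).1
  have hplain : ∀ p ∈ P, LP G.edges (x' p) (y' p) (f p ∪ ∅) := by
    intro p hp
    rw [Finset.union_empty]
    exact LP.single (hsl p hp).1 (hsl p hp).2 (hslot p hp).2.1 (hslot p hp).2.2.1.symm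
  have hZ1 := hfull (fun _ => ∅) (fun p hp => ⟨hplain p hp, by simp⟩) (by simp)
  have hbe : P.biUnion (fun _ => (∅ : Finset ℕ)) = ∅ := by
    ext x; simp
  rw [hbe, Finset.union_empty] at hZ1
  obtain ⟨l, hl⟩ := hZ1.card_eq hk G.edge_card
  have hZ1V : Z ∪ S ⊆ G.verts := Finset.union_subset hZV hSV
  have hdisj : Disjoint X (Z ∪ S) := by
    rw [Finset.disjoint_left]
    intro x hx hx'
    rcases mem_union.1 hx' with h | h
    · exact hZX x h hx
    · exact hSX x h hx
  set V' := G.verts \ (X ∪ (Z ∪ S)) with hV'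
  have hsubV : X ∪ (Z ∪ S) ⊆ G.verts := Finset.union_subset hXV hZ1V
  have hcc : (X ∪ (Z ∪ S)).card = X.card + (l * (k - 1) + 1) := by
    rw [Finset.card_union_of_disjoint hdisj, hl]
  have hV'c : V'.card + (X.card + (l * (k - 1) + 1)) = G.verts.card := by
    rw [← hcc]; exact Finset.card_sdiff_add_card_eq_card hsubV
  have hV'd : (k - 1) ∣ V'.card := by
    have h1 : G.verts.card - 1 = V'.card + (X.card + l * (k - 1)) := by omega
    rw [h1] at hNd
    exact (Nat.dvd_add_left (Dvd.dvd.add hXd ⟨l, by ring⟩)).1 hNd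
  have hremV : G.verts \ V' = X ∪ (Z ∪ S) := by
    rw [hV', Finset.sdiff_sdiff_self_left]; exact Finset.inter_eq_right.2 hsubV
  obtain ⟨hV'2, ⟨H'⟩⟩ := hrest V' Finset.sdiff_subset (by
    rw [hremV]
    have h1 := card_union_le X (Z ∪ S)
    have h2 := card_union_le Z S
    omega) hV'd
  obtain ⟨e, a, c, hcyc, -⟩ := H'.cycAt hk hV'd ∅ (by
    simp only [HGraph.ind_verts, Finset.card_empty]
    omega)
  simp only [HGraph.ind_verts] at hcyc
  obtain ⟨hcyc, heV'⟩ := hcyc.lift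
  have hXV' : Disjoint X V' := by
    rw [Finset.disjoint_left]
    intro x hx hx'
    exact (mem_sdiff.1 hx').2 (mem_union_left _ hx)
  obtain ⟨W2, g2, W3, g3, x2, y2, x3, y3, hc2, hc3, hW23, hWu, hg2X, hg3X⟩ := hM0 G X hX hXd V' e a c
    hXV' hcyc (hhost e hcyc.1 (Finset.disjoint_of_subset_left heV' hXV'.symm))
  have hWZ : ∀ x ∈ X ∪ V', x ∉ Z ∪ S := by
    intro x hx hx'
    rcases mem_union.1 hx with h | h
    · exact Finset.disjoint_left.1 hdisj h hx'
    · exact (mem_sdiff.1 h).2 (mem_union_right _ hx')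
  have hW2s : W2 ⊆ X ∪ V' := by rw [← hWu]; exact subset_union_left
  have hW3s : W3 ⊆ X ∪ V' := by rw [← hWu]; exact subset_union_right
  have hp2 : (x2, g2) ∈ P := (HGraph.mem_rooted _ _ _).2 ⟨(G.mem_ind X g2).2 ⟨hc2.1, hg2X⟩, hc2.2.1⟩
  have hp3 : (x3, g3) ∈ P := (HGraph.mem_rooted _ _ _).2 ⟨(G.mem_ind X g3).2 ⟨hc3.1, hg3X⟩, hc3.2.1⟩
  have hg2W : g2 ⊆ W2 := by
    obtain ⟨_, _, _, _, T, _, _, hT⟩ := hc2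
    rw [← hT]; exact subset_union_left
  have hg3W : g3 ⊆ W3 := by
    obtain ⟨_, _, _, _, T, _, _, hT⟩ := hc3
    rw [← hT]; exact subset_union_left
  have hne : (x3, g3) ≠ (x2, g2) := by
    intro h
    simp only [Prod.mk.injEq] at h
    exact Finset.disjoint_left.1 hW23 (hg2W hc2.2.1) (hg3W (by rw [← h.1]; exact hc3.2.1))
  let W : ℕ × Finset ℕ → Finset ℕ := fun p => if p = (x2, g2) then W2 else if p = (x3, g3) then W3 else ∅
  have hWa : W (x2, g2) = W2 := if_pos rfl
  have hWb : W (x3, g3) = W3 := by simp only [W, if_neg hne, if_true]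
  have hWc : ∀ p, p ≠ (x2, g2) → p ≠ (x3, g3) → W p = ∅ := fun p h1 h2 => by
    simp only [W, if_neg h1, if_neg h2]
  have hins : ∀ (x y : ℕ) (g Wg : Finset ℕ), (x, g) ∈ P → CycAt G.edges Wg g x y → Wg ⊆ X ∪ V' →
      LP G.edges (x' (x, g)) (y' (x, g)) (f (x, g) ∪ Wg) := by
    intro x y g Wg hp hc hs
    obtain ⟨h1, h2, h3, h4⟩ := hslot _ hp
    have hpp := (mem_filter.1 h1).2
    refine CycAt.insert hc (hsl _ hp).2 h2 h3.symm ?_ hpp.1 hpp.2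
    rw [Finset.disjoint_left]
    intro z hz hz'
    exact hWZ z (hs hz') (mem_union_left _ (h4 hz))
  have hfin := hfull W ?_ ?_
  · convert hfin using 1
    have hbu : P.biUnion W = W2 ∪ W3 := by
      ext x
      simp only [mem_biUnion, mem_union]
      constructor
      · rintro ⟨p, hp, hx⟩
        by_cases h1 : p = (x2, g2)
        · subst h1; rw [hWa] at hx; exact Or.inl hx
        · by_cases h2 : p = (x3, g3)
          · subst h2; rw [hWb] at hx; exact Or.inr hx
          · rw [hWc p h1 h2] at hx; simp at hx
      · rintro (h | h)
        · exact ⟨_, hp2, by rw [hWa]; exact h⟩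
        · exact ⟨_, hp3, by rw [hWb]; exact h⟩
    rw [hbu, hWu, hV']
    ext x
    simp only [mem_union, mem_sdiff]
    constructor
    · intro h
      by_cases h1 : x ∈ X
      · tauto
      · tauto
    · rintro ((h | h | h) | h)
      · exact hZV h
      · exact hXV h
      · exact h.1
      · exact hSV h
  · intro p hp
    by_cases h1 : p = (x2, g2)
    · subst h1
      rw [hWa]
      refine ⟨hins x2 y2 g2 W2 hp hc2 hW2s, Finset.disjoint_left.2 fun x hx => hWZ x (hW2s hx)⟩
    · by_cases h2 : p = (x3, g3)
      · subst h2
        rw [hWb]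
        refine ⟨hins x3 y3 g3 W3 hp hc3 hW3s, Finset.disjoint_left.2 fun x hx => hWZ x (hW3s hx)⟩
      · rw [hWc p h1 h2]
        exact ⟨hplain p hp, by simp⟩
  · intro p hp q hq hpq
    by_cases h1 : p = (x2, g2)
    · subst h1
      rw [hWa]
      by_cases h2 : q = (x3, g3)
      · subst h2; rw [hWb]; exact hW23
      · rw [hWc q (Ne.symm hpq) h2]; simp
    · by_cases h2 : p = (x3, g3)
      · subst h2
        rw [hWb]
        by_cases h3 : q = (x2, g2)
        · subst h3; rw [hWa]; exact hW23.symm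
        · rw [hWc q h3 (Ne.symm hpq)]; simp
      · rw [hWc p h1 h2]; simp

end

open Finset
open scoped Classical
noncomputable section

set_option maxHeartbeats 1000000 in
theorem exists_X (j k : ℕ) (hj : 1 ≤ j) (hjk : j < k) (ε : ℝ) (hε : 0 < ε) (A : ℕ) (hA : 3 ≤ A) :
    ∃ t0 : ℕ, ∀ t : ℕ, t0 ≤ t → ∀ G : HGraph k, t ^ A ≤ G.verts.card → G.verts.card < (t + 1) ^ A →
      G.MD j (looseHamThreshold j k + ε) → ∀ u v : ℕ, u ≠ v →
      ∃ X ⊆ G.verts, X.card = (k - 1) * t ∧ u ∉ X ∧ v ∉ X ∧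
        (∀ p ∈ (G.ind X).rooted, p ∉ G.atyp (((1 / (t : ℝ)) ^ (k + 1)) ^ 3)) ∧
        ∀ e ∈ G.edges, Disjoint e X → (G.ind (X ∪ e)).MD j (looseHamThreshold j k + ε / 2) := by
  set δ := looseHamThreshold j k with hδ
  obtain ⟨m0, hm0⟩ := sample_low j k hjk δ ε (thr_nonneg j k) hε k
  obtain ⟨m1, hm1⟩ := asymp_exp (A * k + j) (ε ^ 2 / 32) (2 ^ (A * k) * (2 * k) ^ j) (1 / 8)
    (by positivity) (by norm_num)
  refine ⟨m0 + m1 + 8 * k ^ 2 + 16 * k + 8 * k ^ (2 * k) + 1, ?_⟩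
  intro t ht G hN1 hN2 hG u v huv
  set N := G.verts.card with hNd
  set m := (k - 1) * t with hm
  set θ := (1 / (t : ℝ)) ^ (k + 1) with hθ
  have ht1 : 1 ≤ t := by omega
  have htr : (1 : ℝ) ≤ t := by exact_mod_cast ht1
  have ht0 : (0 : ℝ) < t := by linarith
  have hmt : t ≤ m := by rw [hm]; exact Nat.le_mul_of_pos_left _ (by omega)
  have hmk : m ≤ k * t := Nat.mul_le_mul_right _ (by omega)
  have hmkr : (m : ℝ) ≤ k * t := by exact_mod_cast hmk
  have hmtr : (t : ℝ) ≤ m := by exact_mod_cast hmt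
  have hNt3 : (t : ℝ) ^ 3 ≤ N := by
    have : t ^ 3 ≤ N := (Nat.pow_le_pow_right ht1 hA).trans hN1
    exact_mod_cast this
  have hNr : (0 : ℝ) < N := lt_of_lt_of_le (by positivity) hNt3
  have hNpos : 0 < N := by exact_mod_cast hNr
  have hcα : Fintype.card G.Vt = N := Fintype.card_coe _
  obtain ⟨v0, hv0⟩ : G.verts.Nonempty := card_pos.1 hNpos
  have : Nonempty G.Vt := ⟨⟨v0, hv0⟩⟩
  have hNm : (0 : ℝ) < (N : ℝ) ^ m := by positivity
  have hkr : (1 : ℝ) ≤ k := by exact_mod_cast (by omega : 1 ≤ k)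
  have ha1 : 8 * (k : ℝ) ^ 2 ≤ t := by exact_mod_cast (by omega : 8 * k ^ 2 ≤ t)
  have ha2 : 16 * (k : ℝ) ≤ t := by exact_mod_cast (by omega : 16 * k ≤ t)
  have ha3 : 8 * (k : ℝ) ^ (2 * k) ≤ t := by exact_mod_cast (by omega : 8 * k ^ (2 * k) ≤ t)
  -- (i)
  have c1 : ((univ.filter fun Y : Fin m → G.Vt => ¬ Function.Injective Y).card : ℝ) ≤ 1 / 8 * (N : ℝ) ^ m := by
    have h := count_noninj (ι := Fin m) (α := G.Vt)
    rw [hcα, Fintype.card_fin] at h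
    have h' : ((univ.filter fun Y : Fin m → G.Vt => ¬ Function.Injective Y).card : ℝ) ≤
        (m : ℝ) ^ 2 / N * (N : ℝ) ^ m := by convert h
    refine h'.trans (mul_le_mul_of_nonneg_right ?_ hNm.le)
    rw [div_le_iff₀ hNr]
    have h1 : (m : ℝ) ^ 2 ≤ (k * t) ^ 2 := by gcongr
    have h2 : 8 * ((k : ℝ) ^ 2 * t ^ 2) ≤ t ^ 3 := by
      have := mul_le_mul_of_nonneg_right ha1 (by positivity : (0:ℝ) ≤ t ^ 2)
      calc _ = 8 * (k : ℝ) ^ 2 * t ^ 2 := by ring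
        _ ≤ _ := this
        _ = _ := by ring
    rw [mul_pow] at h1
    linarith
  have c2 : ((univ.filter fun Y : Fin m → G.Vt => ¬ Disjoint ({u, v} : Finset ℕ) (img Y)).card : ℝ) ≤
      1 / 8 * (N : ℝ) ^ m := by
    have h := count_hit (G := G) (ι := Fin m) hNpos {u, v}
    rw [Fintype.card_fin, Finset.card_pair huv, ← hNd] at h
    refine le_trans (by convert h) (mul_le_mul_of_nonneg_right ?_ hNm.le)
    rw [div_le_iff₀ hNr]
    have h2 : 16 * (k : ℝ) * t ≤ t * t := mul_le_mul_of_nonneg_right ha2 ht0.le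
    have h3 : (t : ℝ) * t ≤ t ^ 3 := by nlinarith [mul_pos ht0 ht0]
    push_cast
    linarith
  set B := (G.atyp (θ ^ 3)).image Prod.snd with hB
  have hBE : B ⊆ G.edges := by
    intro g hg
    obtain ⟨⟨x, g'⟩, hp, rfl⟩ := mem_image.1 hg
    exact ((G.mem_rooted _ _).1 (mem_filter.1 hp).1).1
  have hBc : (B.card : ℝ) ≤ θ * (G.verts.card : ℝ) ^ k := by
    refine le_trans ?_ (atyp_count G (by omega) θ (by positivity))
    exact_mod_cast Finset.card_image_le
  have c3 : ((univ.filter fun Y : Fin m → G.Vt => ∃ g ∈ B, g ⊆ img Y).card : ℝ) ≤ 1 / 8 * (N : ℝ) ^ m := by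
    have h := count_contain (ι := Fin m) B hBE θ hBc
    rw [Fintype.card_fin, ← hNd, ← mul_assoc, ← mul_assoc] at h
    refine le_trans (by convert h) (mul_le_mul_of_nonneg_right ?_ hNm.le)
    calc (m : ℝ) ^ k * (k : ℝ) ^ k * θ ≤ (k * t) ^ k * (k : ℝ) ^ k * θ := by gcongr
      _ = (k : ℝ) ^ (2 * k) * (1 / t) := by
          have e1 : θ = 1 / ((t : ℝ) ^ k * t) := by rw [hθ, div_pow, one_pow, pow_succ]
          have e2 : (k : ℝ) ^ (2 * k) = (k : ℝ) ^ k * (k : ℝ) ^ k := by rw [two_mul, pow_add]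
          have e3 : (t : ℝ) ^ k ≠ 0 := by positivity
          rw [e1, e2, mul_pow]
          field_simp
      _ ≤ 1 / 8 := by
          rw [mul_one_div, div_le_iff₀ ht0]; linarith
  have c4 : ((univ.filter fun Y : Fin m → G.Vt => ∃ e ∈ G.edges, Function.Injective Y ∧ Disjoint e (img Y) ∧
      ¬ (G.ind (e ∪ img Y)).MD j (δ + ε / 2)).card : ℝ) ≤ 1 / 8 * (N : ℝ) ^ m := by
    have hsub : (univ.filter fun Y : Fin m → G.Vt => ∃ e ∈ G.edges, Function.Injective Y ∧ Disjoint e (img Y) ∧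
        ¬ (G.ind (e ∪ img Y)).MD j (δ + ε / 2)) ⊆ G.edges.biUnion fun e =>
        (univ.filter fun Y : Fin m → G.Vt => Function.Injective Y ∧ Disjoint e (img Y) ∧
        ¬ (G.ind (e ∪ img Y)).MD j (δ + ε / 2)) := by
      intro Y hY
      obtain ⟨e, he, h⟩ := (mem_filter.1 hY).2
      exact mem_biUnion.2 ⟨e, he, mem_filter.2 ⟨mem_univ _, h⟩⟩
    have h1 : ((univ.filter fun Y : Fin m → G.Vt => ∃ e ∈ G.edges, Function.Injective Y ∧ Disjoint e (img Y) ∧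
        ¬ (G.ind (e ∪ img Y)).MD j (δ + ε / 2)).card : ℝ) ≤ ∑ e ∈ G.edges,
        ((univ.filter fun Y : Fin m → G.Vt => Function.Injective Y ∧ Disjoint e (img Y) ∧
        ¬ (G.ind (e ∪ img Y)).MD j (δ + ε / 2)).card : ℝ) := by
      exact_mod_cast (card_le_card hsub).trans Finset.card_biUnion_le
    have h2 : ∀ e ∈ G.edges,
        ((univ.filter fun Y : Fin m → G.Vt => Function.Injective Y ∧ Disjoint e (img Y) ∧
        ¬ (G.ind (e ∪ img Y)).MD j (δ + ε / 2)).card : ℝ) ≤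
        ((k : ℝ) + m) ^ j * Real.exp (-(ε ^ 2 / 32 * m)) * (N : ℝ) ^ m := by
      intro e he
      have := hm0 G hG e (G.edge_sub e he) (G.edge_card e he) (Fin m) (by rw [Fintype.card_fin]; omega)
      rw [Fintype.card_fin] at this
      convert this
    refine (h1.trans (Finset.sum_le_card_nsmul _ _ _ h2)).trans ?_
    rw [nsmul_eq_mul, ← mul_assoc]
    refine mul_le_mul_of_nonneg_right ?_ hNm.le
    have hE : (G.edges.card : ℝ) ≤ (2 * (t : ℝ)) ^ (A * k) := by
      have h3 : G.edges.card ≤ (2 * t) ^ (A * k) := by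
        refine G.card_edges_le.trans ?_
        rw [pow_mul]
        refine Nat.pow_le_pow_left ?_ k
        exact hN2.le.trans (Nat.pow_le_pow_left (by omega) A)
      exact_mod_cast h3
    have hkm : (k : ℝ) + m ≤ 2 * k * t := by nlinarith
    calc (G.edges.card : ℝ) * (((k : ℝ) + m) ^ j * Real.exp (-(ε ^ 2 / 32 * m)))
        ≤ (2 * (t : ℝ)) ^ (A * k) * ((2 * k * t) ^ j * Real.exp (-(ε ^ 2 / 32 * t))) := by gcongr
      _ = 2 ^ (A * k) * (2 * k) ^ j * (t : ℝ) ^ (A * k + j) * Real.exp (-(ε ^ 2 / 32 * t)) := by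
          rw [mul_pow, mul_pow (2 * (k : ℝ)), pow_add]; ring
      _ ≤ 1 / 8 := hm1 t (by omega)
  have hex : ∃ Y : Fin m → G.Vt, Function.Injective Y ∧ Disjoint ({u, v} : Finset ℕ) (img Y) ∧
      (¬ ∃ g ∈ B, g ⊆ img Y) ∧ ∀ e ∈ G.edges, Disjoint e (img Y) → (G.ind (e ∪ img Y)).MD j (δ + ε / 2) := by
    by_contra hcon
    have hsub : (univ : Finset (Fin m → G.Vt)) ⊆
      ((univ.filter fun Y : Fin m → G.Vt => ¬ Function.Injective Y) ∪
        (univ.filter fun Y : Fin m → G.Vt => ¬ Disjoint ({u, v} : Finset ℕ) (img Y))) ∪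
      ((univ.filter fun Y : Fin m → G.Vt => ∃ g ∈ B, g ⊆ img Y) ∪
        (univ.filter fun Y : Fin m → G.Vt => ∃ e ∈ G.edges, Function.Injective Y ∧ Disjoint e (img Y) ∧
          ¬ (G.ind (e ∪ img Y)).MD j (δ + ε / 2))) := by
      intro Y _
      simp only [mem_union, mem_filter, mem_univ, true_and]
      by_contra h
      push Not at h
      refine hcon ⟨Y, h.1.1, h.1.2, ?_, ?_⟩
      · rintro ⟨g, hg, hg'⟩
        exact h.2.1 g hg hg'
      · intro e he hd
        exact h.2.2 e he h.1.1 hd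
    have h1 := (card_le_card hsub).trans ((card_union_le _ _).trans
      (Nat.add_le_add (card_union_le _ _) (card_union_le _ _)))
    rw [Finset.card_univ, Fintype.card_fun, hcα, Fintype.card_fin] at h1
    have h2 : (N : ℝ) ^ m ≤
      (((univ.filter fun Y : Fin m → G.Vt => ¬ Function.Injective Y).card : ℝ) +
        ((univ.filter fun Y : Fin m → G.Vt => ¬ Disjoint ({u, v} : Finset ℕ) (img Y)).card : ℝ)) +
      (((univ.filter fun Y : Fin m → G.Vt => ∃ g ∈ B, g ⊆ img Y).card : ℝ) +
        ((univ.filter fun Y : Fin m → G.Vt => ∃ e ∈ G.edges, Function.Injective Y ∧ Disjoint e (img Y) ∧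
          ¬ (G.ind (e ∪ img Y)).MD j (δ + ε / 2)).card : ℝ)) := by exact_mod_cast h1
    linarith
  obtain ⟨Y, hinj, hdis, hB', hmd⟩ := hex
  refine ⟨img Y, img_sub Y, ?_, ?_, ?_, ?_, ?_⟩
  · rw [img_card Y hinj, Fintype.card_fin]
  · exact Finset.disjoint_left.1 hdis (by simp)
  · exact Finset.disjoint_left.1 hdis (by simp)
  · rintro ⟨x, g⟩ hp hat
    have h1 := (HGraph.mem_rooted _ _ _).1 hp
    have h2 := (G.mem_ind _ _).1 h1.1
    exact hB' ⟨g, mem_image.2 ⟨_, hat, rfl⟩, h2.2⟩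
  · intro e he hd
    rw [Finset.union_comm]
    exact hmd e he hd

theorem partners_avoid {k : ℕ} (G : HGraph k) (p : ℕ × Finset ℕ) (K : ℕ)
    (h : K * (k * G.verts.card ^ (k - 1)) < (G.partners p).card) (F' : Finset ℕ) (hF : F'.card ≤ K) :
    ∃ q ∈ G.partners p, Disjoint q.2 F' := by
  by_contra hcon
  push Not at hcon
  have hsub : G.partners p ⊆ F'.biUnion fun v => G.rooted.filter fun q => v ∈ q.2 := by
    intro q hq
    obtain ⟨v, h1, h2⟩ := Finset.not_disjoint_iff.1 (hcon q hq)
    exact mem_biUnion.2 ⟨v, h2, mem_filter.2 ⟨(mem_filter.1 hq).1, h1⟩⟩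
  have h1 : ∀ v ∈ F', (G.rooted.filter fun q => v ∈ q.2).card ≤ k * G.verts.card ^ (k - 1) := by
    intro v _
    refine (Finset.card_le_mul_card_image (f := Prod.snd) _ k ?_).trans (Nat.mul_le_mul_left _ ?_)
    · intro g hg
      obtain ⟨⟨x, g'⟩, hq, rfl⟩ := mem_image.1 hg
      have hg' := ((G.mem_rooted x g').1 (mem_filter.1 hq).1).1
      refine le_trans (Finset.card_le_card_of_injOn (t := g') Prod.fst ?_ ?_) (G.edge_card g' hg').le
      · rintro ⟨y, g''⟩ hy
        obtain ⟨h3, h4⟩ := mem_filter.1 hy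
        simp only at h4
        have := ((G.mem_rooted y g'').1 (mem_filter.1 h3).1).2
        simp only [Finset.mem_coe]
        rwa [← h4]
      · rintro ⟨y, g1⟩ hy ⟨z, g2⟩ hz hyz
        have e1 := (mem_filter.1 hy).2
        have e2 := (mem_filter.1 hz).2
        simp only at e1 e2 hyz
        rw [e1, e2, hyz]
    · refine le_trans (card_le_card ?_) (by simpa using G.card_super_le {v})
      intro g hg
      obtain ⟨⟨x, g'⟩, hq, rfl⟩ := mem_image.1 hg
      obtain ⟨h3, h4⟩ := mem_filter.1 hq
      refine mem_filter.2 ⟨((G.mem_rooted x g').1 h3).1, by simpa using h4⟩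
  have h2 := (card_le_card hsub).trans (Finset.card_biUnion_le.trans
    (Finset.sum_le_card_nsmul _ _ _ h1))
  rw [smul_eq_mul] at h2
  have := h2.trans (Nat.mul_le_mul_right _ hF)
  omega

set_option maxHeartbeats 1000000 in
theorem hcn (j k : ℕ) (hj : 1 ≤ j) (hjk : j < k) (ε : ℝ) (hε : 0 < ε) :
    ∃ N1 : ℕ, ∀ G : HGraph k, N1 ≤ G.verts.card → (k - 1) ∣ G.verts.card - 1 →
      G.MD j (looseHamThreshold j k + ε) → ∀ u ∈ G.verts, ∀ v ∈ G.verts, u ≠ v →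
      LP G.edges u v G.verts := by
  have hk : 2 ≤ k := by omega
  obtain ⟨M0, hM0⟩ := hcn_det j k hj hjk (ε / 2) (by linarith)
  obtain ⟨s, N0, hs, hconn⟩ := connector j k hj hjk ε hε
  obtain ⟨n0, hn0⟩ := black_box j k hjk (ε / 2) (by linarith)
  obtain ⟨t0, ht0⟩ := exists_X j k hj hjk ε hε (4 * k + 5) (by omega)
  set C := 2 * k + 2 + k ^ (k + 1) * (s + k) with hC
  set t1 := M0 + N0 + t0 + 4 * s * C + C * k + (2 * C + s + n0 + 2 * k) + 
    ⌈(2 * C + s : ℝ) / (ε / 2)⌉₊ + 1 with ht1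
  refine ⟨t1 ^ (4 * k + 5), ?_⟩
  intro G hN hNd hG u hu v hv huv
  set N := G.verts.card with hNdef
  have hexist : ∃ t : ℕ, N < (t + 1) ^ (4 * k + 5) := by
    refine ⟨N, ?_⟩
    calc N < N + 1 := Nat.lt_succ_self _
      _ = (N + 1) ^ 1 := (pow_one _).symm
      _ ≤ _ := Nat.pow_le_pow_right (by omega) (by omega)
  obtain ⟨t, htN, htmin⟩ : ∃ t : ℕ, N < (t + 1) ^ (4 * k + 5) ∧ t ^ (4 * k + 5) ≤ N := by
    refine ⟨Nat.find hexist, Nat.find_spec hexist, ?_⟩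
    rcases Nat.eq_zero_or_pos (Nat.find hexist) with h | h
    · rw [h, zero_pow (by omega)]; omega
    · have := Nat.find_min hexist (m := Nat.find hexist - 1) (by omega)
      rw [Nat.sub_add_cancel h] at this
      omega
  have htt : t1 ≤ t := by
    have := lt_of_le_of_lt hN htN
    have := lt_of_pow_lt_pow_left₀ _ (by omega) this
    omega
  have htpos : 1 ≤ t := by omega
  have hp0 : 1 ≤ t ^ (k + 1) := Nat.one_le_pow _ _ htpos
  have hpow : t ^ (k + 1) * t ≤ N := by
    rw [← pow_succ]
    exact (Nat.pow_le_pow_right htpos (by omega)).trans htmin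
  have hbig : ∀ c : ℕ, c ≤ t → c * t ^ (k + 1) ≤ N := by
    intro c hc
    calc c * t ^ (k + 1) ≤ t * t ^ (k + 1) := Nat.mul_le_mul_right _ hc
      _ = t ^ (k + 1) * t := mul_comm _ _
      _ ≤ N := hpow
  have htN' : t ≤ N := by
    calc t = 1 * t := (one_mul t).symm
      _ ≤ t ^ (k + 1) * t := Nat.mul_le_mul_right _ hp0
      _ ≤ N := hpow
  obtain ⟨X, hXV, hXc, huX, hvX, hXat, hXmd⟩ := ht0 t (by omega) G htmin htN hG u v huv
  set K := C * t ^ (k + 1) with hK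
  have hXc' : X.card ≤ k * t := by rw [hXc]; exact Nat.mul_le_mul_right _ (by omega)
  refine hM0 G X s K u v ?_ ⟨t, hXc⟩ hXV hu hv huX hvX huv ?_ ?_ ?_ hNd ?_ hXmd
  · rw [hXc]
    have : 1 * t ≤ (k - 1) * t := Nat.mul_le_mul_right _ (by omega)
    omega
  · intro F hF
    refine hconn G (by omega) hG F ?_
    calc 4 * s * F.card ≤ 4 * s * K := Nat.mul_le_mul_left _ hF
      _ = (4 * s * C) * t ^ (k + 1) := by rw [hK]; ring
      _ ≤ N := hbig _ (by omega)
  · rintro ⟨x, g⟩ hp F' hF'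
    refine partners_avoid G (x, g) K ?_ F' hF'
    have h1 := (HGraph.mem_rooted _ _ _).1 hp
    have h2 := (G.mem_ind _ _).1 h1.1
    have hr : (x, g) ∈ G.rooted := (G.mem_rooted _ _).2 ⟨h2.1, h1.2⟩
    have h3 : (((1 / (t : ℝ)) ^ (k + 1)) ^ 3) * (N : ℝ) ^ k ≤ ((G.partners (x, g)).card : ℝ) := by
      by_contra hcon
      push Not at hcon
      exact hXat _ hp (mem_filter.2 ⟨hr, hcon⟩)
    have h4 : K * k * t ^ (3 * k + 3) < N := by
      have e1 : K * k * t ^ (3 * k + 3) = (C * k) * t ^ (4 * k + 4) := by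
        rw [hK, show 4 * k + 4 = (k + 1) + (3 * k + 3) by ring, pow_add]; ring
      rw [e1]
      calc C * k * t ^ (4 * k + 4) < t * t ^ (4 * k + 4) :=
            Nat.mul_lt_mul_of_pos_right (by omega) (by positivity)
        _ = t ^ (4 * k + 5) := by rw [← pow_succ']
        _ ≤ N := htmin
    have htr : (0 : ℝ) < t := by exact_mod_cast htpos
    have hNr : (0 : ℝ) < N := by exact_mod_cast (by omega : 0 < N)
    have h5 : ((K * (k * N ^ (k - 1)) : ℕ) : ℝ) < (((1 / (t : ℝ)) ^ (k + 1)) ^ 3) * (N : ℝ) ^ k := by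
      have h4r : (K : ℝ) * k * (t : ℝ) ^ (3 * k + 3) < N := by exact_mod_cast h4
      have e2 : (((1 / (t : ℝ)) ^ (k + 1)) ^ 3) = 1 / (t : ℝ) ^ (3 * k + 3) := by
        rw [← pow_mul, one_div_pow]; congr 2; ring
      have e3 : (N : ℝ) ^ k = N ^ (k - 1) * N := by rw [← pow_succ]; congr 1; omega
      rw [e2, e3, one_div, inv_mul_eq_div, lt_div_iff₀ (by positivity)]
      push_cast
      calc (K : ℝ) * (k * N ^ (k - 1)) * t ^ (3 * k + 3) = N ^ (k - 1) * (K * k * t ^ (3 * k + 3)) := by ring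
        _ < _ := by gcongr
    exact_mod_cast h5.trans_le h3
  · have hP : (G.ind X).rooted.card ≤ k ^ (k + 1) * t ^ (k + 1) := by
      calc (G.ind X).rooted.card ≤ ((G.ind X).verts ×ˢ (G.ind X).edges).card := Finset.card_filter_le _ _
        _ ≤ X.card * X.card ^ k := by
          rw [Finset.card_product]
          exact Nat.mul_le_mul_left _ (G.ind X).card_edges_le
        _ = X.card ^ (k + 1) := by rw [pow_succ']
        _ ≤ (k * t) ^ (k + 1) := Nat.pow_le_pow_left hXc' _
        _ = _ := mul_pow _ _ _
    have h1 : t ≤ t ^ (k + 1) := Nat.le_self_pow (by omega) t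
    have h2 : (G.ind X).rooted.card * (s + k) ≤ k ^ (k + 1) * (s + k) * t ^ (k + 1) := by
      calc _ ≤ k ^ (k + 1) * t ^ (k + 1) * (s + k) := Nat.mul_le_mul_right _ hP
        _ = _ := by ring
    have h3 : k * t ≤ k * t ^ (k + 1) := Nat.mul_le_mul_left _ h1
    have h4 : (2 + k) * 1 ≤ (2 + k) * t ^ (k + 1) := Nat.mul_le_mul_left _ hp0
    have h5 : K = k * t ^ (k + 1) + (2 + k) * t ^ (k + 1) + k ^ (k + 1) * (s + k) * t ^ (k + 1) := by
      rw [hK, hC]; ring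
    rw [h5]
    omega
  · intro V' hV' hc hd
    have hVc := Finset.card_sdiff_add_card_eq_card hV'
    have h1 : (2 * C + s + n0 + 2 * k) * t ^ (k + 1) ≤ N := hbig _ (by omega)
    have h2 : (s + n0 + 2 * k) * 1 ≤ (s + n0 + 2 * k) * t ^ (k + 1) := Nat.mul_le_mul_left _ hp0
    have h3 : (2 * C + s + n0 + 2 * k) * t ^ (k + 1) = 2 * K + (s + n0 + 2 * k) * t ^ (k + 1) := by
      rw [hK]; ring
    refine ⟨by omega, ?_⟩
    refine hn0 (G.ind V') (by simp only [HGraph.ind_verts]; omega) hd ?_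
    refine HGraph.MD.delete hjk (thr_nonneg j k) hε hG hV' ?_
    have h4 : (((G.verts \ V').card : ℕ) : ℝ) ≤ (2 * C + s) * (t : ℝ) ^ (k + 1) := by
      have : (G.verts \ V').card ≤ (2 * C + s) * t ^ (k + 1) := by
        have : s * 1 ≤ s * t ^ (k + 1) := Nat.mul_le_mul_left _ hp0
        have e : (2 * C + s) * t ^ (k + 1) = 2 * K + s * t ^ (k + 1) := by rw [hK]; ring
        omega
      exact_mod_cast this
    have h5 : (2 * C + s : ℝ) ≤ ε / 2 * t := by
      have h1 := Nat.le_ceil ((2 * C + s : ℝ) / (ε / 2))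
      have h2 : ((⌈(2 * C + s : ℝ) / (ε / 2)⌉₊ : ℕ) : ℝ) ≤ t := Nat.cast_le.2 (by omega)
      have h3 := h1.trans h2
      rw [div_le_iff₀ (by positivity)] at h3
      linarith
    have h6 : (t : ℝ) ^ (k + 1) * t ≤ N := by exact_mod_cast hpow
    calc _ ≤ (2 * C + s : ℝ) * (t : ℝ) ^ (k + 1) := h4
      _ ≤ ε / 2 * t * (t : ℝ) ^ (k + 1) := by gcongr
      _ = ε / 2 * ((t : ℝ) ^ (k + 1) * t) := by ring
      _ ≤ ε / 2 * N := by gcongr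

end

open Finset
open scoped Classical
noncomputable section

theorem exists_tau {β α : Type*} (R : Finset β) (f c : β → α) (hf : Set.InjOn f R) (hc : Set.InjOn c R) :
    ∃ τ : Equiv.Perm α, (∀ p ∈ R, τ (f p) = c p) ∧ ∀ x, x ∉ R.image f → x ∉ R.image c → τ x = x := by
  induction R using Finset.induction_on with
  | empty => exact ⟨1, by simp, by simp⟩
  | insert p R hp ih =>
    obtain ⟨τ, h1, h2⟩ := ih (hf.mono (by simp)) (hc.mono (by simp))
    have hfp : ∀ q ∈ R, f q ≠ f p := fun q hq h => hp (by
      rw [← hf (by simp [hq]) (by simp) h]; exact hq)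
    have hcp : ∀ q ∈ R, c q ≠ c p := fun q hq h => hp (by
      rw [← hc (by simp [hq]) (by simp) h]; exact hq)
    refine ⟨Equiv.swap (τ (f p)) (c p) * τ, ?_, ?_⟩
    · intro q hq
      rw [Equiv.Perm.mul_apply]
      rcases mem_insert.1 hq with rfl | hq
      · exact Equiv.swap_apply_left _ _
      · rw [Equiv.swap_apply_of_ne_of_ne, h1 q hq]
        · exact fun h => hfp q hq (τ.injective h)
        · rw [h1 q hq]; exact hcp q hq
    · intro x hx1 hx2
      simp only [Finset.image_insert, mem_insert, not_or] at hx1 hx2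
      have := h2 x hx1.2 hx2.2
      rw [Equiv.Perm.mul_apply, Equiv.swap_apply_of_ne_of_ne, this]
      · exact fun h => hx1.1 (τ.injective h)
      · rw [this]; exact hx2.1

theorem sum_union_le' {I : Type*} (w : I → ℝ) (hw : ∀ i, 0 ≤ w i) (A B : Finset I) :
    ∑ j ∈ A ∪ B, w j ≤ ∑ j ∈ A, w j + ∑ j ∈ B, w j := by
  rw [← Finset.sum_union_inter]
  have : 0 ≤ ∑ j ∈ A ∩ B, w j := Finset.sum_nonneg fun j _ => hw j
  linarith

theorem sum_biUnion_le' {I κ : Type*} (w : I → ℝ) (hw : ∀ i, 0 ≤ w i) (T : Finset κ) (g : κ → Finset I)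
    (s : ℕ) (θ : ℝ) (hθ : 0 ≤ θ) (hT : T.card ≤ s) (hg : ∀ t ∈ T, ∑ j ∈ g t, w j ≤ θ) :
    ∑ j ∈ T.biUnion g, w j ≤ s * θ := by
  have h1 : ∑ j ∈ T.biUnion g, w j ≤ ∑ t ∈ T, ∑ j ∈ g t, w j := by
    clear hT hg
    induction T using Finset.induction_on with
    | empty => simp
    | insert a T ha ih =>
      rw [Finset.biUnion_insert, Finset.sum_insert ha]
      exact (sum_union_le' w hw _ _).trans (by linarith)
  refine (h1.trans (Finset.sum_le_card_nsmul _ _ _ hg)).trans ?_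
  rw [nsmul_eq_mul]
  exact mul_le_mul_of_nonneg_right (Nat.cast_le.2 hT) hθ

section LLL
variable {β α I : Type*} [Fintype β] [Fintype α] (R : I → Finset β) (f : I → β → α)

def Sat (i : I) (π : β ≃ α) : Prop := ∀ p ∈ R i, π p = f i p

def Wt (Φ : Finset I) : Finset (β ≃ α) := univ.filter fun π => ∀ i ∈ Φ, ¬ Sat R f i π

def WtS (i : I) (Φ : Finset I) : Finset (β ≃ α) := univ.filter fun π => Sat R f i π ∧ ∀ i ∈ Φ, ¬ Sat R f i π

def Conf (i j : I) : Prop := ¬ Disjoint (R i) (R j) ∨ ¬ Disjoint ((R i).image (f i)) ((R j).image (f j))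

theorem key_count (hf : ∀ i, Set.InjOn (f i) (R i)) (i : I) (Φ : Finset I) (hΦ : ∀ j ∈ Φ, ¬ Conf R f i j) :
    (WtS R f i Φ).card * (Fintype.card α).descFactorial (R i).card ≤ (Wt R f Φ).card := by
  have hemb : Fintype.card ({x // x ∈ R i} ↪ α) = (Fintype.card α).descFactorial (R i).card := by
    rw [Fintype.card_embedding_eq, Fintype.card_coe]
  let ext : ({x // x ∈ R i} ↪ α) → β → α := fun c p => if h : p ∈ R i then c ⟨p, h⟩ else f i p
  have hext : ∀ c, ∀ p (h : p ∈ R i), ext c p = c ⟨p, h⟩ := fun c p h => dif_pos h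
  have hinj : ∀ c, Set.InjOn (ext c) (R i) := by
    intro c p hp q hq h
    have hp' : p ∈ R i := hp
    have hq' : q ∈ R i := hq
    rw [hext c p hp', hext c q hq'] at h
    simpa using c.injective h
  choose τ h1 h2 using fun c => exists_tau (R i) (f i) (ext c) (hf i) (hinj c)
  rw [← hemb, ← Finset.card_univ, ← Finset.card_product]
  refine Finset.card_le_card_of_injOn (fun z => z.1.trans (τ z.2)) ?_ ?_
  · rintro ⟨π, c⟩ hz
    have hz1 := (mem_filter.1 (mem_product.1 hz).1).2
    refine mem_filter.2 ⟨mem_univ _, ?_⟩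
    intro j hj hs
    refine hz1.2 j hj ?_
    have hc := hΦ j hj
    simp only [Conf, not_or, not_not] at hc
    intro p hp
    have hsp : τ c (π p) = f j p := hs p hp
    have hpi : p ∉ R i := fun h => Finset.disjoint_left.1 hc.1 h hp
    have hx1 : f j p ∉ (R i).image (f i) := fun h =>
      Finset.disjoint_left.1 hc.2 h (mem_image_of_mem _ hp)
    have hx2 : f j p ∉ (R i).image (ext c) := by
      intro h
      obtain ⟨q, hq, hqe⟩ := mem_image.1 h
      rw [← h1 c q hq, ← hsp] at hqe
      have := (τ c).injective hqe
      rw [← hz1.1 q hq] at this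
      exact hpi (π.injective this ▸ hq)
    have := h2 c _ hx1 hx2
    exact (τ c).injective (hsp.trans this.symm)
  · rintro ⟨π, c⟩ hz ⟨π', c'⟩ hz' he
    have hz1 := (mem_filter.1 (mem_product.1 hz).1).2
    have hz2 := (mem_filter.1 (mem_product.1 hz').1).2
    have he' : ∀ p, τ c (π p) = τ c' (π' p) := fun p => DFunLike.congr_fun he p
    have hcc : c = c' := by
      ext ⟨p, hp⟩
      have := he' p
      rw [hz1.1 p hp, hz2.1 p hp, h1 c p hp, h1 c' p hp, hext c p hp, hext c' p hp] at this
      exact this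
    subst hcc
    have : π = π' := by
      ext p
      exact (τ c).injective (he' p)
    rw [this]

def wgt (i : I) : ℝ := 1 / ((Fintype.card α).descFactorial (R i).card : ℝ)

theorem lll_step (hf : ∀ i, Set.InjOn (f i) (R i)) (hR : ∀ i, (R i).card ≤ Fintype.card α)
    (hw : ∀ i, ∀ Φ : Finset I, (∀ j ∈ Φ, Conf R f i j) → ∑ j ∈ Φ, wgt (α := α) R j ≤ 1 / 4) :
    ∀ m : ℕ, ∀ Φ : Finset I, Φ.card ≤ m → ∀ i,
      ((WtS R f i Φ).card : ℝ) ≤ 2 * wgt (α := α) R i * ((Wt R f Φ).card : ℝ) := by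
  have hpos : ∀ i, (0 : ℝ) < ((Fintype.card α).descFactorial (R i).card : ℝ) := fun i => by
    exact_mod_cast Nat.descFactorial_pos.2 (hR i)
  have hwp : ∀ i, 0 < wgt (α := α) R i := fun i => one_div_pos.2 (hpos i)
  have key : ∀ i, ∀ Φ : Finset I, (∀ j ∈ Φ, ¬ Conf R f i j) →
      ((WtS R f i Φ).card : ℝ) ≤ wgt (α := α) R i * ((Wt R f Φ).card : ℝ) := by
    intro i Φ h
    have := key_count R f hf i Φ h
    have h' : ((WtS R f i Φ).card : ℝ) * ((Fintype.card α).descFactorial (R i).card : ℝ) ≤ (Wt R f Φ).card := by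
      exact_mod_cast this
    rw [wgt, one_div, inv_mul_eq_div, le_div_iff₀ (hpos i)]
    exact h'
  intro m
  induction m with
  | zero =>
    intro Φ hΦ i
    have : Φ = ∅ := Finset.card_eq_zero.1 (by omega)
    subst this
    refine (key i ∅ (by simp)).trans ?_
    nlinarith [hwp i, mul_nonneg (hwp i).le (Nat.cast_nonneg (α := ℝ) (Wt R f (∅ : Finset I)).card)]
  | succ m ih =>
    intro Φ hΦ i
    set Φ1 := Φ.filter (fun j => Conf R f i j) with hΦ1
    set Φ2 := Φ.filter (fun j => ¬ Conf R f i j) with hΦ2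
    have hW0 : (0 : ℝ) ≤ (Wt R f Φ2).card := Nat.cast_nonneg _
    have hk := key i Φ2 (fun j hj => (mem_filter.1 hj).2)
    have hle : ((WtS R f i Φ).card : ℝ) ≤ (WtS R f i Φ2).card := by
      refine Nat.cast_le.2 (card_le_card ?_)
      intro π hπ
      have := (mem_filter.1 hπ).2
      exact mem_filter.2 ⟨mem_univ _, this.1, fun j hj => this.2 j (mem_filter.1 hj).1⟩
    have hhalf : ((Wt R f Φ2).card : ℝ) ≤ 2 * (Wt R f Φ).card := by
      by_cases hemp : Φ1 = ∅
      · have : Φ2 = Φ := by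
          rw [hΦ2]; apply Finset.filter_true_of_mem
          intro j hj hc
          have : j ∈ Φ1 := mem_filter.2 ⟨hj, hc⟩
          rw [hemp] at this; simp at this
        rw [this]
        have : (0 : ℝ) ≤ (Wt R f Φ).card := Nat.cast_nonneg _
        linarith
      · have hc2 : Φ2.card ≤ m := by
          have h1 : Φ1.card + Φ2.card = Φ.card := Finset.card_filter_add_card_filter_not _
          have h2 : 0 < Φ1.card := card_pos.2 (Finset.nonempty_iff_ne_empty.2 hemp)
          omega
        have hsub : Wt R f Φ2 ⊆ Wt R f Φ ∪ Φ1.biUnion (fun j => WtS R f j Φ2) := by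
          intro π hπ
          have hπ2 := (mem_filter.1 hπ).2
          by_cases h : ∃ j ∈ Φ1, Sat R f j π
          · obtain ⟨j, hj, hs⟩ := h
            exact mem_union_right _ (mem_biUnion.2 ⟨j, hj,
              mem_filter.2 ⟨mem_univ _, hs, hπ2⟩⟩)
          · push Not at h
            refine mem_union_left _ (mem_filter.2 ⟨mem_univ _, ?_⟩)
            intro j hj
            by_cases hc : Conf R f i j
            · exact h j (mem_filter.2 ⟨hj, hc⟩)
            · exact hπ2 j (mem_filter.2 ⟨hj, hc⟩)
        have h3 : ((Wt R f Φ2).card : ℝ) ≤ (Wt R f Φ).card + ∑ j ∈ Φ1, ((WtS R f j Φ2).card : ℝ) := by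
          exact_mod_cast (card_le_card hsub).trans ((card_union_le _ _).trans
            (Nat.add_le_add_left Finset.card_biUnion_le _))
        have h4 : ∑ j ∈ Φ1, ((WtS R f j Φ2).card : ℝ) ≤ ∑ j ∈ Φ1, wgt (α := α) R j * (2 * (Wt R f Φ2).card) := by
          refine sum_le_sum fun j _ => (ih Φ2 hc2 j).trans (le_of_eq (by ring))
        rw [← Finset.sum_mul] at h4
        have h5 := mul_le_mul_of_nonneg_right (hw i Φ1 (fun j hj => (mem_filter.1 hj).2))
          (by linarith : (0:ℝ) ≤ 2 * (Wt R f Φ2).card)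
        linarith
    calc ((WtS R f i Φ).card : ℝ) ≤ wgt (α := α) R i * ((Wt R f Φ2).card : ℝ) := hle.trans hk
      _ ≤ wgt (α := α) R i * (2 * (Wt R f Φ).card) := mul_le_mul_of_nonneg_left hhalf (hwp i).le
      _ = _ := by ring

theorem lll (hcard : Fintype.card β = Fintype.card α)
    (hf : ∀ i, Set.InjOn (f i) (R i)) (s : ℕ) (θ : ℝ) (hθ : 2 * s * θ ≤ 1 / 4)
    (hne : ∀ i, (R i).Nonempty) (hs : ∀ i, (R i).card ≤ s) (F : Finset I)
    (hF : ∀ i, i ∈ F)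
    (hrow : ∀ p : β, ∑ j ∈ F.filter (fun j => p ∈ R j), wgt (α := α) R j ≤ θ)
    (hcol : ∀ x : α, ∑ j ∈ F.filter (fun j => x ∈ (R j).image (f j)), wgt (α := α) R j ≤ θ) :
    ∃ π : β ≃ α, ∀ i, ¬ Sat R f i π := by
  have hR : ∀ i, (R i).card ≤ Fintype.card α := fun i => hcard ▸ Finset.card_le_univ _
  have hwp : ∀ i, 0 ≤ wgt (α := α) R i := fun i => by unfold wgt; positivity
  have hw : ∀ i, ∀ Φ : Finset I, (∀ j ∈ Φ, Conf R f i j) → ∑ j ∈ Φ, wgt (α := α) R j ≤ 1 / 4 := by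
    intro i Φ hΦ
    have hθ0 : 0 ≤ θ := by
      obtain ⟨p, _⟩ := hne i
      exact (Finset.sum_nonneg fun j _ => hwp j).trans (hrow p)
    have hsub : Φ ⊆ ((R i).biUnion fun p => F.filter (fun j => p ∈ R j)) ∪
        (((R i).image (f i)).biUnion fun x => F.filter (fun j => x ∈ (R j).image (f j))) := by
      intro j hj
      rcases hΦ j hj with h | h
      · obtain ⟨p, h1, h2⟩ := Finset.not_disjoint_iff.1 h
        exact mem_union_left _ (mem_biUnion.2 ⟨p, h1, mem_filter.2 ⟨hF j, h2⟩⟩)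
      · obtain ⟨p, h1, h2⟩ := Finset.not_disjoint_iff.1 h
        exact mem_union_right _ (mem_biUnion.2 ⟨p, h1, mem_filter.2 ⟨hF j, h2⟩⟩)
    calc ∑ j ∈ Φ, wgt (α := α) R j ≤ _ := Finset.sum_le_sum_of_subset_of_nonneg hsub (fun j _ _ => hwp j)
      _ ≤ _ := sum_union_le' _ hwp _ _
      _ ≤ s * θ + s * θ := by
          refine add_le_add ?_ ?_
          · exact sum_biUnion_le' _ hwp _ _ s θ hθ0 (hs i) (fun p _ => hrow p)
          · exact sum_biUnion_le' _ hwp _ _ s θ hθ0 (Finset.card_image_le.trans (hs i)) (fun x _ => hcol x)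
      _ ≤ 1 / 4 := by linarith
  have step := lll_step R f hf hR hw
  have hall : ∀ Φ : Finset I, 0 < (Wt R f Φ).card := by
    intro Φ
    induction Φ using Finset.induction_on with
    | empty =>
      refine card_pos.2 ⟨Fintype.equivOfCardEq hcard, ?_⟩
      simp [Wt]
    | insert i Φ hi ih =>
      have h1 := step Φ.card Φ le_rfl i
      have hi4 : wgt (α := α) R i ≤ 1 / 4 := by
        have := hw i {i} (by
          intro j hj
          rw [mem_singleton.1 hj]
          left
          rw [disjoint_self]
          exact (hne i).ne_empty)
        simpa using this
      have hsub : Wt R f Φ ⊆ Wt R f (insert i Φ) ∪ WtS R f i Φ := by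
        intro π hπ
        have hπ2 := (mem_filter.1 hπ).2
        by_cases h : Sat R f i π
        · exact mem_union_right _ (mem_filter.2 ⟨mem_univ _, h, hπ2⟩)
        · refine mem_union_left _ (mem_filter.2 ⟨mem_univ _, ?_⟩)
          intro j hj
          rcases mem_insert.1 hj with rfl | hj
          · exact h
          · exact hπ2 j hj
      have h3 : ((Wt R f Φ).card : ℝ) ≤ (Wt R f (insert i Φ)).card + (WtS R f i Φ).card := by
        exact_mod_cast (card_le_card hsub).trans (card_union_le _ _)
      have ih' : (0 : ℝ) < (Wt R f Φ).card := by exact_mod_cast ih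
      have : (0 : ℝ) < (Wt R f (insert i Φ)).card := by nlinarith
      exact_mod_cast this
  obtain ⟨π, hπ⟩ := card_pos.1 (hall F)
  exact ⟨π, fun i => (mem_filter.1 hπ).2 i (hF i)⟩
end LLL
end

open Finset
open scoped Classical
noncomputable section

theorem descFac_ge (n t : ℕ) (h : 2 * t ^ 2 ≤ n) (hn : 0 < n) :
    (n : ℝ) ^ t / 2 ≤ (n.descFactorial t : ℝ) := by
  have h1 : ((n + 1 - t : ℕ) : ℝ) ^ t ≤ (n.descFactorial t : ℝ) := by
    exact_mod_cast Nat.pow_sub_le_descFactorial n t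
  have htn : t ≤ n := by nlinarith
  have hnr : (0 : ℝ) < n := by exact_mod_cast hn
  have h2 : (n : ℝ) * (1 + (-(t / n) : ℝ)) ≤ ((n + 1 - t : ℕ) : ℝ) := by
    rw [Nat.cast_sub (by omega)]
    push_cast
    rw [mul_add, mul_neg, mul_div_cancel₀ _ hnr.ne']
    linarith
  have h4 : (t : ℝ) / n ≤ 1 := by
    rw [div_le_one hnr]; exact_mod_cast htn
  have h3 : 1 + (t : ℝ) * (-(t / n) : ℝ) ≤ (1 + (-(t / n) : ℝ)) ^ t :=
    one_add_mul_le_pow (by linarith) t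
  have h5 : (t : ℝ) * (t / n) ≤ 1 / 2 := by
    rw [← mul_div_assoc, div_le_iff₀ hnr]
    have : (2 : ℝ) * t ^ 2 ≤ n := by exact_mod_cast h
    nlinarith
  have h6 : ((n : ℝ) * (1 + (-(t / n) : ℝ))) ^ t ≤ ((n + 1 - t : ℕ) : ℝ) ^ t :=
    pow_le_pow_left₀ (mul_nonneg hnr.le (by linarith)) h2 t
  rw [mul_pow] at h6
  have h7 : (n : ℝ) ^ t * (1 / 2) ≤ (n : ℝ) ^ t * (1 + (-(t / n) : ℝ)) ^ t :=
    mul_le_mul_of_nonneg_left (by linarith) (by positivity)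
  linarith

theorem lll2 {β α Θ : Type} [Fintype β] [Fintype α] [Fintype Θ] [Nonempty α]
    (hcard : Fintype.card β = Fintype.card α) (R : Θ → Finset β)
    (Bad : ∀ θ, Finset ({x // x ∈ R θ} → α)) (hinj : ∀ θ, ∀ Y ∈ Bad θ, Function.Injective Y)
    (s : ℕ) (hne : ∀ θ, (R θ).Nonempty) (hs : ∀ θ, (R θ).card ≤ s)
    (hn : 2 * s ^ 2 ≤ Fintype.card α) (η : Θ → ℝ) (hη : ∀ θ, 0 ≤ η θ)
    (hb : ∀ θ r x, ∀ S ⊆ Bad θ, (∀ Y ∈ S, Y r = x) → (S.card : ℝ) ≤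
      η θ * (Fintype.card α : ℝ) ^ ((R θ).card - 1))
    (Δ : ℝ) (hΔ : 4 * s * Δ ≤ 1 / 4)
    (hd : ∀ p : β, ∑ θ, (if p ∈ R θ then η θ else 0) ≤ Δ) :
    ∃ π : β ≃ α, ∀ θ, (fun r : {x // x ∈ R θ} => π r) ∉ Bad θ := by
  let I := Σ θ, {Y // Y ∈ Bad θ}
  let R' : I → Finset β := fun i => R i.1
  let f : I → β → α := fun i p => if h : p ∈ R i.1 then i.2.1 ⟨p, h⟩ else Classical.arbitrary α
  have hfe : ∀ i : I, ∀ p (h : p ∈ R i.1), f i p = i.2.1 ⟨p, h⟩ := fun i p h => dif_pos h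
  set n := Fintype.card α with hnd
  have hn0 : 0 < n := Fintype.card_pos
  have hnr : (0 : ℝ) < n := by exact_mod_cast hn0
  have hw : ∀ θ, 1 / (n.descFactorial (R θ).card : ℝ) ≤ 2 / (n : ℝ) ^ (R θ).card := by
    intro θ
    have h1 := descFac_ge n (R θ).card
      (le_trans (Nat.mul_le_mul_left _ (Nat.pow_le_pow_left (hs θ) 2)) hn) hn0
    have h2 : (0 : ℝ) < (n : ℝ) ^ (R θ).card := by positivity
    rw [div_le_div_iff₀ (by linarith) h2]
    linarith
  have hw0 : ∀ θ, 0 ≤ 1 / (n.descFactorial (R θ).card : ℝ) := fun θ => by positivity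
  have hpw : ∀ θ, (n : ℝ) ^ ((R θ).card - 1) * n = (n : ℝ) ^ (R θ).card := by
    intro θ
    rw [← pow_succ]
    congr 1
    have := card_pos.2 (hne θ)
    omega
  have hone : ∀ θ r x, (((Bad θ).filter fun Y => Y r = x).card : ℝ) *
      (1 / (n.descFactorial (R θ).card : ℝ)) ≤ 2 * η θ / n := by
    intro θ r x
    have hp : (0 : ℝ) < (n : ℝ) ^ ((R θ).card - 1) := by positivity
    calc _ ≤ (η θ * (n : ℝ) ^ ((R θ).card - 1)) * (2 / (n : ℝ) ^ (R θ).card) :=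
          mul_le_mul (hb θ r x _ (Finset.filter_subset _ _) fun Y hY => (mem_filter.1 hY).2) (hw θ) (hw0 θ) (mul_nonneg (hη θ) hp.le)
      _ = _ := by
          rw [← hpw θ]
          field_simp
  have hall : ∀ θ, ((Bad θ).card : ℝ) * (1 / (n.descFactorial (R θ).card : ℝ)) ≤ 2 * η θ := by
    intro θ
    obtain ⟨p, hp⟩ := hne θ
    have h1 : (Bad θ).card = ∑ x : α, ((Bad θ).filter fun Y => Y ⟨p, hp⟩ = x).card :=
      Finset.card_eq_sum_card_fiberwise (fun Y _ => Finset.mem_coe.2 (mem_univ _))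
    rw [h1]
    push_cast
    rw [Finset.sum_mul]
    refine (Finset.sum_le_card_nsmul _ _ _ (fun x _ => hone θ ⟨p, hp⟩ x)).trans ?_
    rw [Finset.card_univ, ← hnd, nsmul_eq_mul, mul_div_cancel₀ _ hnr.ne']
  have hwg : ∀ i : I, wgt (α := α) R' i = 1 / (n.descFactorial (R i.1).card : ℝ) := fun i => rfl
  obtain ⟨π, hπ⟩ := lll (α := α) R' f hcard (by
      intro i p hp q hq h
      have hp' : p ∈ R i.1 := hp
      have hq' : q ∈ R i.1 := hq
      rw [hfe i p hp', hfe i q hq'] at h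
      simpa using hinj i.1 _ i.2.2 h) s (2 * Δ) (by linarith) (fun i => hne i.1) (fun i => hs i.1)
      univ (fun i => mem_univ _) (by
        intro p
        rw [sum_filter, Fintype.sum_sigma]
        refine le_trans ?_ (mul_le_mul_of_nonneg_left (hd p) (by norm_num : (0:ℝ) ≤ 2))
        rw [Finset.mul_sum]
        refine sum_le_sum fun θ _ => ?_
        by_cases h : p ∈ R θ
        · have : ∀ Y : {Y // Y ∈ Bad θ}, (if p ∈ R' ⟨θ, Y⟩ then wgt (α := α) R' ⟨θ, Y⟩ else 0) =
              1 / (n.descFactorial (R θ).card : ℝ) := fun Y => by rw [hwg]; exact if_pos h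
          rw [Finset.sum_congr rfl (fun Y _ => this Y), Finset.sum_const, if_pos h, nsmul_eq_mul,
            Finset.card_univ, Fintype.card_coe]
          exact hall θ
        · have : ∀ Y : {Y // Y ∈ Bad θ}, (if p ∈ R' ⟨θ, Y⟩ then wgt (α := α) R' ⟨θ, Y⟩ else 0) =
              0 := fun Y => if_neg h
          rw [Finset.sum_congr rfl (fun Y _ => this Y), if_neg h]
          simp) (by
        intro x
        rw [sum_filter, Fintype.sum_sigma]
        have hθ : ∀ θ, ∑ Y : {Y // Y ∈ Bad θ}, (if x ∈ (R' ⟨θ, Y⟩).image (f ⟨θ, Y⟩) then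
            wgt (α := α) R' ⟨θ, Y⟩ else 0) ≤ ∑ p : β, if p ∈ R θ then 2 * η θ / n else 0 := by
          intro θ
          set w := 1 / (n.descFactorial (R θ).card : ℝ) with hwd
          have h1 : ∀ Y : {Y // Y ∈ Bad θ}, (if x ∈ (R' ⟨θ, Y⟩).image (f ⟨θ, Y⟩) then
              wgt (α := α) R' ⟨θ, Y⟩ else 0) ≤ ∑ r : {r // r ∈ R θ}, if Y.1 r = x then w else 0 := by
            intro Y
            split_ifs with h
            · obtain ⟨p, hp, hpx⟩ := mem_image.1 h
              have hp' : p ∈ R θ := hp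
              have hpx' : Y.1 ⟨p, hp'⟩ = x := by rw [← hpx]; exact (hfe ⟨θ, Y⟩ p hp').symm
              rw [hwg]
              refine le_trans (le_of_eq ?_) (Finset.single_le_sum (f := fun r : {r // r ∈ R θ} =>
                if Y.1 r = x then w else 0) (fun r _ => ?_) (mem_univ ⟨p, hp'⟩))
              · rw [if_pos hpx']
              · split_ifs
                exacts [hw0 θ, le_rfl]
            · exact Finset.sum_nonneg fun r _ => by split_ifs; exacts [hw0 θ, le_rfl]
          refine (sum_le_sum fun Y _ => h1 Y).trans ?_
          rw [Finset.sum_comm]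
          have h2 : ∀ r : {r // r ∈ R θ}, ∑ Y : {Y // Y ∈ Bad θ}, (if Y.1 r = x then w else 0) ≤
              2 * η θ / n := by
            intro r
            refine le_trans (le_of_eq ?_) (hone θ r x)
            rw [Finset.sum_coe_sort (Bad θ) (fun Y => if Y r = x then w else 0), ← sum_filter,
              Finset.sum_const, nsmul_eq_mul]
          refine (sum_le_sum fun r _ => h2 r).trans (le_of_eq ?_)
          rw [Finset.sum_const, Finset.card_univ, Fintype.card_coe, ← sum_filter,
            Finset.sum_const, Finset.filter_univ_mem]
        refine (sum_le_sum fun θ _ => hθ θ).trans ?_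
        rw [Finset.sum_comm]
        have h3 : ∀ p : β, ∑ θ, (if p ∈ R θ then 2 * η θ / n else 0) ≤ 2 / n * Δ := by
          intro p
          refine le_trans (le_of_eq ?_) (mul_le_mul_of_nonneg_left (hd p) (by positivity))
          rw [Finset.mul_sum]
          refine Finset.sum_congr rfl fun θ _ => ?_
          split_ifs
          · ring
          · ring
        refine (Finset.sum_le_card_nsmul _ _ _ fun p _ => h3 p).trans (le_of_eq ?_)
        rw [Finset.card_univ, hcard, nsmul_eq_mul]
        field_simp)
  refine ⟨π, fun θ hθ => hπ ⟨θ, _, hθ⟩ ?_⟩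
  intro p hp
  rw [hfe _ p hp]
end

open Finset
open scoped Classical
noncomputable section

def NB (n L q i : ℕ) : Finset ℕ :=
  if i + 1 < q then Icc (i * L) ((i + 1) * L) else insert 0 (Ico ((q - 1) * L) n)

theorem concat (E : Finset (Finset ℕ)) (f : ℕ → ℕ) (n L q : ℕ) (hf : Set.InjOn f (Set.Iio n)) (hL : 1 ≤ L)
    (hq : 2 ≤ q) (hqL : q * L ≤ n)
    (h : ∀ i < q, LP E (f (i * L)) (f (if i + 1 < q then (i + 1) * L else 0)) ((NB n L q i).image f)) :
    ∃ e a c, CycAt E ((range n).image f) e a c := by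
  obtain ⟨q, rfl⟩ : ∃ q', q = q' + 2 := ⟨q - 2, by omega⟩
  have hqL' : (q + 1) * L < n := by nlinarith
  have hpre : ∀ m, m ≤ q → LP E (f 0) (f ((m + 1) * L)) ((Icc 0 ((m + 1) * L)).image f) := by
    intro m hm
    induction m with
    | zero =>
      have := h 0 (by omega)
      simpa [NB] using this
    | succ m ih =>
      have h1 := ih (by omega)
      have h2 := h (m + 1) (by omega)
      rw [if_pos (by omega), NB, if_pos (by omega)] at h2
      have hb : (m + 1 + 1) * L ≤ (q + 1) * L := Nat.mul_le_mul_right _ (by omega)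
      have hmL : (m + 1 + 1) * L = (m + 1) * L + L := by ring
      have h3 := h1.trans h2 (by
        ext y
        simp only [mem_inter, mem_image, mem_Icc, mem_singleton]
        constructor
        · rintro ⟨⟨a, ha, rfl⟩, b, hb', hab⟩
          have : b = a := hf (by simp only [Set.mem_Iio]; omega) (by simp only [Set.mem_Iio]; omega) hab
          have : a = (m + 1) * L := by omega
          rw [this]
        · rintro rfl
          exact ⟨⟨_, ⟨by omega, le_rfl⟩, rfl⟩, _, ⟨le_rfl, by omega⟩, rfl⟩)
      rw [← Finset.image_union] at h3
      convert h3 using 2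
      ext y
      simp only [mem_union, mem_Icc]
      omega
  have h1 := hpre q le_rfl
  have h2 := h (q + 1) (by omega)
  rw [if_neg (by omega), NB, if_neg (by omega)] at h2
  simp only [Nat.add_succ_sub_one] at h2
  have hpos : 0 < (q + 1) * L := by positivity
  obtain ⟨e, x, y, hc⟩ := CycAt.of_two h1 h2 (fun hh => by
    have := hf (by simp only [Set.mem_Iio]; omega) (by simp only [Set.mem_Iio]; omega) hh
    omega) (by
      ext y
      simp only [mem_inter, mem_image, mem_Icc, mem_insert,
        mem_singleton, mem_Ico]
      constructor
      · rintro ⟨⟨a, ha, rfl⟩, b, hb', hab⟩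
        have : b = a := hf (by simp only [Set.mem_Iio]; omega) (by simp only [Set.mem_Iio]; omega) hab
        have : a = 0 ∨ a = (q + 1) * L := by omega
        rcases this with rfl | rfl
        · exact Or.inl rfl
        · exact Or.inr rfl
      · rintro (rfl | rfl)
        · exact ⟨⟨0, by omega, rfl⟩, 0, Or.inl rfl, rfl⟩
        · exact ⟨⟨_, ⟨by omega, le_rfl⟩, rfl⟩, _, Or.inr ⟨le_rfl, by omega⟩, rfl⟩)
  rw [← Finset.image_union] at hc
  refine ⟨e, x, y, ?_⟩
  convert hc using 2
  ext y
  simp only [mem_union, mem_Icc, mem_insert, mem_Ico, mem_range]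
  omega

theorem NB_sub (n L q i : ℕ) (hL : 1 ≤ L) (hq : 2 ≤ q) (hqL : q * L ≤ n) : ∀ p ∈ NB n L q i, p < n := by
  intro p hp
  have : 1 ≤ q * L := Nat.mul_pos (by omega) hL
  unfold NB at hp
  split_ifs at hp with h
  · have h1 := (mem_Icc.1 hp).2
    have h2 : (i + 2) * L ≤ q * L := Nat.mul_le_mul_right _ (by omega)
    have h3 : (i + 2) * L = (i + 1) * L + L := by ring
    omega
  · simp only [mem_insert, mem_Ico] at hp
    omega

theorem NB_card (n L q i : ℕ) (hL : 1 ≤ L) (hq : 2 ≤ q) (hqL : q * L ≤ n) (hqL2 : n < (q + 1) * L) :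
    L + 1 ≤ (NB n L q i).card ∧ (NB n L q i).card ≤ 2 * L + 1 ∧
      ∀ d, d ∣ L → d ∣ n → d ∣ (NB n L q i).card - 1 := by
  unfold NB
  have e1 : (q + 1) * L = q * L + L := by ring
  have e2 : q * L = (q - 1) * L + L := by
    obtain ⟨q', rfl⟩ : ∃ q', q = q' + 1 := ⟨q - 1, by omega⟩
    simp only [Nat.add_sub_cancel]; ring
  have hpos : 0 < (q - 1) * L := Nat.mul_pos (by omega) hL
  split_ifs with h
  · rw [Nat.card_Icc]
    have h3 : (i + 1) * L = i * L + L := by ring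
    refine ⟨by omega, by omega, fun d hd _ => ?_⟩
    have : (i + 1) * L + 1 - i * L - 1 = L := by omega
    rw [this]; exact hd
  · rw [Finset.card_insert_of_notMem (by simp only [mem_Ico]; omega), Nat.card_Ico]
    refine ⟨by omega, by omega, fun d hd hn => ?_⟩
    rw [Nat.add_sub_cancel]
    exact Nat.dvd_sub hn (hd.mul_left _)

theorem NB_three (n L q p : ℕ) (hL : 1 ≤ L) :
    ((range q).filter fun i => p ∈ NB n L q i).card ≤ 3 := by
  have hsub : ((range q).filter fun i => p ∈ NB n L q i) ⊆ {p / L, p / L - 1, q - 1} := by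
    intro i hi
    obtain ⟨h1, h2⟩ := mem_filter.1 hi
    rw [mem_range] at h1
    simp only [mem_insert, mem_singleton]
    unfold NB at h2
    split_ifs at h2 with h
    · obtain ⟨h3, h4⟩ := mem_Icc.1 h2
      have h5 : i ≤ p / L := (Nat.le_div_iff_mul_le hL).2 h3
      have h6 : p / L ≤ i + 1 := by
        calc p / L ≤ ((i + 1) * L) / L := Nat.div_le_div_right h4
          _ = i + 1 := Nat.mul_div_cancel _ hL
      omega
    · omega
  exact (card_le_card hsub).trans Finset.card_le_three

theorem tpl_sum {β : Type} [Fintype β] (P : Finset (Finset β)) (k Z : ℕ) (hk : ∀ A ∈ P, A.card = k)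
    (hk1 : 1 ≤ k) (hZ : ∀ p, (P.filter fun A => p ∈ A).card ≤ Z) (p : β) (c : ℝ) (hc : 0 ≤ c) :
    ∑ z ∈ P ×ˢ P, (if p ∈ z.1 ∪ z.2 then (if Disjoint z.1 z.2 then c / Fintype.card β else c) else 0) ≤
      2 * (Z * ((k + 1) * Z * c)) := by
  have hβ : 0 < Fintype.card β := Fintype.card_pos_iff.2 ⟨p⟩
  have hβr : (0 : ℝ) < Fintype.card β := by exact_mod_cast hβ
  set h : Finset β → Finset β → ℝ := fun A B => if Disjoint A B then c / Fintype.card β else c with hh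
  have h0 : ∀ A B, 0 ≤ h A B := by
    intro A B; simp only [hh]; split_ifs <;> positivity
  have hPc : (P.card : ℝ) ≤ Fintype.card β * Z := by
    have hsub : P ⊆ (univ : Finset β).biUnion fun p => P.filter fun A => p ∈ A := by
      intro A hA
      obtain ⟨x, hx⟩ : A.Nonempty := card_pos.1 (by rw [hk A hA]; omega)
      exact mem_biUnion.2 ⟨x, mem_univ _, mem_filter.2 ⟨hA, hx⟩⟩
    have := (card_le_card hsub).trans (Finset.card_biUnion_le_card_mul _ _ Z fun x _ => hZ x)
    rw [Finset.card_univ] at this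
    exact_mod_cast this
  have hin : ∀ A ∈ P, ∑ B ∈ P, h A B ≤ (k + 1) * Z * c := by
    intro A hA
    have e1 : ∀ B ∈ P, h A B ≤ c / Fintype.card β + (if ¬ Disjoint A B then c else 0) := by
      intro B _
      simp only [hh]
      have : 0 ≤ c / Fintype.card β := by positivity
      split_ifs with h1
      · simp
      · linarith
    refine (sum_le_sum e1).trans ?_
    rw [Finset.sum_add_distrib, Finset.sum_const, ← sum_filter, Finset.sum_const, nsmul_eq_mul, nsmul_eq_mul]
    have h2 : ((P.filter fun B => ¬ Disjoint A B).card : ℝ) ≤ k * Z := by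
      have hsub : (P.filter fun B => ¬ Disjoint A B) ⊆ A.biUnion fun p => P.filter fun B => p ∈ B := by
        intro B hB
        obtain ⟨hB1, hB2⟩ := mem_filter.1 hB
        obtain ⟨x, hx1, hx2⟩ := Finset.not_disjoint_iff.1 hB2
        exact mem_biUnion.2 ⟨x, hx1, mem_filter.2 ⟨hB1, hx2⟩⟩
      have := (card_le_card hsub).trans (Finset.card_biUnion_le_card_mul _ _ Z fun x _ => hZ x)
      rw [hk A hA] at this
      exact_mod_cast this
    have h3 : (P.card : ℝ) * (c / Fintype.card β) ≤ Z * c := by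
      rw [← mul_div_assoc, div_le_iff₀ hβr]
      have := mul_le_mul_of_nonneg_right hPc hc
      linarith
    have h4 := mul_le_mul_of_nonneg_right h2 hc
    linarith
  have hK : (0 : ℝ) ≤ (k + 1) * Z * c := by positivity
  have hone : ∑ A ∈ P.filter (fun A => p ∈ A), ∑ B ∈ P, h A B ≤ Z * ((k + 1) * Z * c) := by
    refine (Finset.sum_le_card_nsmul _ _ _ fun A hA => hin A (mem_filter.1 hA).1).trans ?_
    rw [nsmul_eq_mul]
    exact mul_le_mul_of_nonneg_right (Nat.cast_le.2 (hZ p)) hK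
  have hterm : ∀ z ∈ P ×ˢ P, (if p ∈ z.1 ∪ z.2 then (if Disjoint z.1 z.2 then c / Fintype.card β else c) else 0) ≤
      (if p ∈ z.1 then h z.1 z.2 else 0) + (if p ∈ z.2 then h z.2 z.1 else 0) := by
    intro z _
    have hs : h z.2 z.1 = h z.1 z.2 := by simp only [hh, disjoint_comm]
    rw [hs]
    change (if p ∈ z.1 ∪ z.2 then h z.1 z.2 else 0) ≤ _
    have := h0 z.1 z.2
    simp only [mem_union]
    split_ifs with h1 h2 h3 h4 h5 h6 <;> first | linarith | tauto
  refine (sum_le_sum hterm).trans ?_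
  rw [Finset.sum_add_distrib, Finset.sum_product, Finset.sum_product_right]
  have hswap : ∀ F : Finset β → Finset β → ℝ, ∑ A ∈ P, ∑ B ∈ P, (if p ∈ A then F A B else 0) =
      ∑ A ∈ P.filter (fun A => p ∈ A), ∑ B ∈ P, F A B := by
    intro F
    rw [sum_filter]
    refine Finset.sum_congr rfl fun A _ => ?_
    split_ifs
    · rfl
    · simp
  rw [hswap (fun A B => h A B)]
  linarith
end

open Finset
open scoped Classical
noncomputable section
variable {k : ℕ}

theorem block_bad (G : HGraph k) {ι : Type} [Fintype ι] (r : ι) (x : G.Vt) (j : ℕ) (d : ℝ) :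
    ((univ.filter fun Y : ι → G.Vt => Function.Injective Y ∧ ¬ (G.ind (img Y)).MD j d).filter
      fun Y => Y r = x).card ≤
    (univ.filter fun Z : {s // s ≠ r} → G.Vt => Function.Injective Z ∧ Disjoint ({x.1} : Finset ℕ) (img Z) ∧
      ¬ (G.ind ({x.1} ∪ img Z)).MD j d).card := by
  refine Finset.card_le_card_of_injOn (fun Y s => Y s.1) ?_ ?_
  · intro Y hY
    obtain ⟨hY1, hYr⟩ := mem_filter.1 hY
    obtain ⟨hinj, hmd⟩ := (mem_filter.1 hY1).2
    refine mem_filter.2 ⟨mem_univ _, ?_, ?_, ?_⟩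
    · intro a b hab
      exact Subtype.ext (hinj hab)
    · rw [Finset.disjoint_singleton_left, mem_img]
      rintro ⟨s, hs⟩
      have : Y s.1 = Y r := by rw [hYr]; exact Subtype.ext hs
      exact s.2 (hinj this)
    · have : ({x.1} : Finset ℕ) ∪ img (fun s : {s // s ≠ r} => Y s.1) = img Y := by
        ext y
        simp only [mem_union, mem_singleton, mem_img]
        constructor
        · rintro (rfl | ⟨s, hs⟩)
          · exact ⟨r, by rw [hYr]⟩
          · exact ⟨s.1, hs⟩
        · rintro ⟨s, hs⟩
          by_cases h : s = r
          · left; rw [← hs, h, hYr]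
          · exact Or.inr ⟨⟨s, h⟩, hs⟩
      rw [this]; exact hmd
  · intro Y hY Y' hY' h
    have e1 := (mem_filter.1 hY).2
    have e2 := (mem_filter.1 hY').2
    funext s
    by_cases hs : s = r
    · rw [hs, e1, e2]
    · exact congrFun h ⟨s, hs⟩

/-- image of the positions `P` under the partial assignment `Y` -/
def imP {G : HGraph k} {β : Type} {R : Finset β} (Y : {p // p ∈ R} → G.Vt) (P : Finset β) : Finset ℕ :=
  (univ.filter fun r : {p // p ∈ R} => r.1 ∈ P).image fun r => (Y r).1

theorem pairs_count (G : HGraph k) (χ : Finset ℕ → ℕ) (b : ℝ) (hb0 : 0 ≤ b) (hb : GloballyBounded G χ b) (x : ℕ) :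
    (((G.edges ×ˢ G.edges).filter fun z => χ z.1 = χ z.2 ∧ (x ∈ z.1 ∨ x ∈ z.2)).card : ℝ) ≤
      2 * (G.verts.card : ℝ) ^ (k - 1) * b := by
  have hsub : ((G.edges ×ˢ G.edges).filter fun z => χ z.1 = χ z.2 ∧ (x ∈ z.1 ∨ x ∈ z.2)) ⊆
      (G.edges.filter fun e => {x} ⊆ e).biUnion fun e =>
        ((G.edges.filter fun f => χ f = χ e).image fun f => (e, f)) ∪
        ((G.edges.filter fun f => χ f = χ e).image fun f => (f, e)) := by
    rintro ⟨e, f⟩ hz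
    obtain ⟨h1, h2, h3⟩ := mem_filter.1 hz
    obtain ⟨he, hf⟩ := mem_product.1 h1
    simp only at he hf h2 h3
    rcases h3 with h3 | h3
    · refine mem_biUnion.2 ⟨e, mem_filter.2 ⟨he, by simpa using h3⟩, mem_union_left _ ?_⟩
      exact mem_image.2 ⟨f, mem_filter.2 ⟨hf, h2.symm⟩, rfl⟩
    · refine mem_biUnion.2 ⟨f, mem_filter.2 ⟨hf, by simpa using h3⟩, mem_union_right _ ?_⟩
      exact mem_image.2 ⟨e, mem_filter.2 ⟨he, h2⟩, rfl⟩
  have h1 : (((G.edges ×ˢ G.edges).filter fun z => χ z.1 = χ z.2 ∧ (x ∈ z.1 ∨ x ∈ z.2)).card : ℝ) ≤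
      ∑ e ∈ G.edges.filter (fun e => {x} ⊆ e),
        (((((G.edges.filter fun f => χ f = χ e).image fun f => (e, f)) ∪
        ((G.edges.filter fun f => χ f = χ e).image fun f => (f, e))).card : ℕ) : ℝ) := by
    exact_mod_cast (card_le_card hsub).trans Finset.card_biUnion_le
  have h2 : ∀ e ∈ G.edges.filter (fun e => {x} ⊆ e),
      (((((G.edges.filter fun f => χ f = χ e).image fun f => (e, f)) ∪
        ((G.edges.filter fun f => χ f = χ e).image fun f => (f, e))).card : ℕ) : ℝ) ≤ 2 * b := by
    intro e _
    have h3 := hb (χ e)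
    have h4 : ((((G.edges.filter fun f => χ f = χ e).image fun f => (e, f)) ∪
        ((G.edges.filter fun f => χ f = χ e).image fun f => (f, e))).card : ℝ) ≤
        (G.edges.filter fun f => χ f = χ e).card + (G.edges.filter fun f => χ f = χ e).card := by
      exact_mod_cast (card_union_le _ _).trans
        (Nat.add_le_add Finset.card_image_le Finset.card_image_le)
    linarith
  refine (h1.trans (Finset.sum_le_card_nsmul _ _ _ h2)).trans ?_
  rw [nsmul_eq_mul]
  have h5 : ((G.edges.filter (fun e => {x} ⊆ e)).card : ℝ) ≤ (G.verts.card : ℝ) ^ (k - 1) := by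
    have := G.card_super_le {x}
    rw [card_singleton] at this
    exact_mod_cast this
  have := mul_le_mul_of_nonneg_right h5 (by linarith : (0:ℝ) ≤ 2 * b)
  linarith

theorem colour_bad (G : HGraph k) (χ : Finset ℕ → ℕ) (b : ℝ) (hb0 : 0 ≤ b) (hb : GloballyBounded G χ b)
    (hk : 1 ≤ k) {β : Type} (P1 P2 : Finset β) (h1 : P1.card = k) (h2 : P2.card = k)
    (r : {p // p ∈ P1 ∪ P2}) (x : G.Vt) :
    (((univ.filter fun Y : {p // p ∈ P1 ∪ P2} → G.Vt => Function.Injective Y ∧ imP Y P1 ∈ G.edges ∧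
      imP Y P2 ∈ G.edges ∧ χ (imP Y P1) = χ (imP Y P2)).filter fun Y => Y r = x).card : ℝ) ≤
    (2 * k : ℝ) ^ (2 * k) * (2 * (G.verts.card : ℝ) ^ (k - 1) * b) := by
  set S := ((univ.filter fun Y : {p // p ∈ P1 ∪ P2} → G.Vt => Function.Injective Y ∧ imP Y P1 ∈ G.edges ∧
      imP Y P2 ∈ G.edges ∧ χ (imP Y P1) = χ (imP Y P2)).filter fun Y => Y r = x) with hS
  have hpc := pairs_count G χ b hb0 hb x.1
  set Q := ((G.edges ×ˢ G.edges).filter fun z => χ z.1 = χ z.2 ∧ (x.1 ∈ z.1 ∨ x.1 ∈ z.2)) with hQ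
  have hmem : ∀ (Y : {p // p ∈ P1 ∪ P2} → G.Vt) (s : {p // p ∈ P1 ∪ P2}),
      (Y s).1 ∈ imP Y P1 ∪ imP Y P2 := by
    intro Y s
    rcases mem_union.1 s.2 with h | h
    · exact mem_union_left _ (mem_image.2 ⟨s, mem_filter.2 ⟨mem_univ _, h⟩, rfl⟩)
    · exact mem_union_right _ (mem_image.2 ⟨s, mem_filter.2 ⟨mem_univ _, h⟩, rfl⟩)
  have hmap : ∀ Y ∈ S, (imP Y P1, imP Y P2) ∈ Q := by
    intro Y hY
    obtain ⟨hY1, hYr⟩ := mem_filter.1 hY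
    obtain ⟨-, a1, a2, a3⟩ := (mem_filter.1 hY1).2
    refine mem_filter.2 ⟨mem_product.2 ⟨a1, a2⟩, a3, ?_⟩
    have := hmem Y r
    rw [hYr] at this
    exact mem_union.1 this
  have hfib : ∀ z ∈ Q, (S.filter fun Y => (imP Y P1, imP Y P2) = z).card ≤ (2 * k) ^ (2 * k) := by
    rintro ⟨e, f⟩ hz
    obtain ⟨a1, -, -⟩ := mem_filter.1 hz
    obtain ⟨he, hf⟩ := mem_product.1 a1
    have hT : (univ.filter fun y : G.Vt => y.1 ∈ e ∪ f).card ≤ 2 * k := by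
      refine le_trans (Finset.card_le_card_of_injOn (t := e ∪ f) Subtype.val ?_ Subtype.val_injective.injOn) ?_
      · intro y hy; exact (mem_filter.1 hy).2
      · refine (card_union_le _ _).trans ?_
        rw [G.edge_card e he, G.edge_card f hf]; omega
    have hsub : (S.filter fun Y => (imP Y P1, imP Y P2) = (e, f)) ⊆
        Fintype.piFinset fun _ : {p // p ∈ P1 ∪ P2} => univ.filter fun y : G.Vt => y.1 ∈ e ∪ f := by
      intro Y hY
      have h3 := (mem_filter.1 hY).2
      rw [Prod.mk.injEq] at h3
      refine Fintype.mem_piFinset.2 fun s => mem_filter.2 ⟨mem_univ _, ?_⟩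
      have := hmem Y s
      rwa [h3.1, h3.2] at this
    refine (card_le_card hsub).trans ?_
    rw [Fintype.card_piFinset, Finset.prod_const, Finset.card_univ, Fintype.card_coe]
    refine (Nat.pow_le_pow_left hT _).trans (Nat.pow_le_pow_right (by omega) ?_)
    refine (card_union_le _ _).trans ?_
    omega
  have hle : S.card ≤ Q.card * (2 * k) ^ (2 * k) := by
    rw [Finset.card_eq_sum_card_fiberwise (f := fun Y => (imP Y P1, imP Y P2)) (t := Q) hmap]
    refine (Finset.sum_le_card_nsmul _ _ _ hfib).trans ?_
    rw [smul_eq_mul]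
  calc (S.card : ℝ) ≤ (Q.card : ℝ) * (2 * k : ℝ) ^ (2 * k) := by exact_mod_cast hle
    _ ≤ (2 * (G.verts.card : ℝ) ^ (k - 1) * b) * (2 * k : ℝ) ^ (2 * k) :=
        mul_le_mul_of_nonneg_right hpc (by positivity)
    _ = _ := by ring
end

open Finset
open scoped Classical
noncomputable section
variable {k : ℕ}

theorem mem_univ_any {T : Type} {f : Fintype T} (y : T) : y ∈ @Finset.univ T f := @Finset.mem_univ T f y

theorem memf_any {T : Type} {p : T → Prop} {d : DecidablePred p} {s : Finset T} {y : T} :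
    y ∈ @Finset.filter T p d s ↔ y ∈ s ∧ p y := @Finset.mem_filter T p d s y

theorem block_bad2 (G : HGraph k) (j : ℕ) (d : ℝ) (L n : ℕ)
    (hsamp : ∀ (ι : Type) [Fintype ι], L ≤ Fintype.card ι → Fintype.card ι ≤ 2 * L → ∀ x : G.Vt,
      ((univ.filter fun Z : ι → G.Vt => Function.Injective Z ∧ Disjoint ({x.1} : Finset ℕ) (img Z) ∧
      ¬ (G.ind ({x.1} ∪ img Z)).MD j d).card : ℝ) ≤ 1 / (288 * L) * (n : ℝ) ^ Fintype.card ι)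
    {ι : Type} [Fintype ι] (h1 : L + 1 ≤ Fintype.card ι) (h2 : Fintype.card ι ≤ 2 * L + 1) (r : ι) (x : G.Vt) :
    (((univ.filter fun Y : ι → G.Vt => Function.Injective Y ∧ ¬ (G.ind (img Y)).MD j d).filter
      fun Y => Y r = x).card : ℝ) ≤ 1 / (288 * L) * (n : ℝ) ^ (Fintype.card ι - 1) := by
  have hcr : Fintype.card {s : ι // s ≠ r} = Fintype.card ι - 1 := by
    rw [Fintype.card_subtype_compl, Fintype.card_subtype_eq]
  have h3 := hsamp {s : ι // s ≠ r} (by omega) (by omega) x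
  rw [hcr] at h3
  have h4 : (((univ.filter fun Y : ι → G.Vt => Function.Injective Y ∧ ¬ (G.ind (img Y)).MD j d).filter
      fun Y => Y r = x).card : ℝ) ≤ ((univ.filter fun Z : {s : ι // s ≠ r} → G.Vt => Function.Injective Z ∧
      Disjoint ({x.1} : Finset ℕ) (img Z) ∧ ¬ (G.ind ({x.1} ∪ img Z)).MD j d).card : ℝ) :=
    Nat.cast_le.2 (block_bad G r x j d)
  refine h4.trans (le_trans (le_of_eq ?_) h3)
  congr!

set_option maxHeartbeats 1000000 in
theorem good_pi (hk : 2 ≤ k) (G : HGraph k) (n : ℕ) (hn : G.verts.card = n) (χ : Finset ℕ → ℕ) (μ : ℝ)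
    (hμ0 : 0 ≤ μ) (hχ : GloballyBounded G χ (μ * (n : ℝ) ^ (k - 1))) (j : ℕ) (d : ℝ) (L q Z : ℕ) (hL : k ≤ L)
    {β : Type} [Fintype β] (hβ : Fintype.card β = n)
    (Bl : Fin q → Finset β) (hB1 : ∀ i, L + 1 ≤ (Bl i).card) (hB2 : ∀ i, (Bl i).card ≤ 2 * L + 1)
    (hB3 : ∀ p, ∃ T : Finset (Fin q), T.card ≤ 3 ∧ ∀ i, p ∈ Bl i → i ∈ T) (hn2 : 2 * (2 * L + 1) ^ 2 ≤ n)
    (hsamp : ∀ (ι : Type) [Fintype ι], L ≤ Fintype.card ι → Fintype.card ι ≤ 2 * L → ∀ x : G.Vt,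
      ((univ.filter fun Z : ι → G.Vt => Function.Injective Z ∧ Disjoint ({x.1} : Finset ℕ) (img Z) ∧
      ¬ (G.ind ({x.1} ∪ img Z)).MD j d).card : ℝ) ≤ 1 / (288 * L) * (n : ℝ) ^ Fintype.card ι)
    (hZ : Z = 3 * 2 ^ (2 * L + 1))
    (hμ : 2 * ((Z : ℝ) * ((k + 1) * Z * (2 * (2 * k : ℝ) ^ (2 * k) * μ))) ≤ 1 / (96 * L)) :
    ∃ π : β ≃ G.Vt, (∀ i, (G.ind ((Bl i).image fun p => (π p).1)).MD j d) ∧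
      ∀ P1 P2 : Finset β, P1.card = k → P2.card = k → (∃ i, P1 ⊆ Bl i) → (∃ i, P2 ⊆ Bl i) →
        (∀ a ∈ P1, a ∈ P2 → ∀ b ∈ P1, b ∈ P2 → a = b) → P1.image (fun p => (π p).1) ∈ G.edges → P2.image (fun p => (π p).1) ∈ G.edges →
        χ (P1.image fun p => (π p).1) ≠ χ (P2.image fun p => (π p).1) := by
  have hcα : Fintype.card G.Vt = n := (Fintype.card_coe _).trans hn
  have hn0 : 0 < n := lt_of_lt_of_le (by positivity) hn2
  have hnr : (0 : ℝ) < n := by exact_mod_cast hn0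
  have : Nonempty G.Vt := Fintype.card_pos_iff.1 (by omega)
  have hL0 : (0 : ℝ) < L := by exact_mod_cast (by omega : 0 < L)
  have hL1 : (1 : ℝ) ≤ L := by exact_mod_cast (by omega : 1 ≤ L)
  set c : ℝ := 2 * (2 * k : ℝ) ^ (2 * k) * μ with hc
  have hc0 : 0 ≤ c := by positivity
  have hB3 : ∀ p, (univ.filter fun i => p ∈ Bl i).card ≤ 3 := by
    intro p
    obtain ⟨T, h1, h2⟩ := hB3 p
    exact (card_le_card fun i hi => h2 i (mem_filter.1 hi).2).trans h1
  have hblock : ∀ i (r : {p // p ∈ Bl i}) (x : G.Vt) (S : Finset ({p // p ∈ Bl i} → G.Vt)),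
      (∀ Y ∈ S, Function.Injective Y ∧ ¬ (G.ind (img Y)).MD j d) → (∀ Y ∈ S, Y r = x) →
      (S.card : ℝ) ≤ 1 / (288 * L) * (n : ℝ) ^ ((Bl i).card - 1) := by
    intro i r x S hS1 hS2
    have h1 := hB1 i
    have h2 := hB2 i
    have h3 := block_bad2 G j d L n hsamp (ι := {p // p ∈ Bl i}) (by rw [Fintype.card_coe]; omega)
      (by rw [Fintype.card_coe]; omega) r x
    rw [Fintype.card_coe] at h3
    refine le_trans (Nat.cast_le.2 (card_le_card ?_)) h3
    intro Y hY
    exact mem_filter.2 ⟨mem_filter.2 ⟨mem_univ_any _, hS1 Y hY⟩, hS2 Y hY⟩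
  set P : Finset (Finset β) := univ.filter fun A => A.card = k ∧ ∃ i, A ⊆ Bl i with hP
  set TS := (P ×ˢ P).filter fun z => (z.1 ∩ z.2).card ≤ 1 with hTS
  have hPZ : ∀ p, (P.filter fun A => p ∈ A).card ≤ Z := by
    intro p
    have hsub : (P.filter fun A => p ∈ A) ⊆ (univ.filter fun i => p ∈ Bl i).biUnion fun i => (Bl i).powerset := by
      intro A hA
      obtain ⟨h1, h2⟩ := mem_filter.1 hA
      obtain ⟨-, i, hi⟩ := (mem_filter.1 h1).2
      exact mem_biUnion.2 ⟨i, mem_filter.2 ⟨mem_univ _, hi h2⟩, Finset.mem_powerset.2 hi⟩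
    refine (card_le_card hsub).trans ((Finset.card_biUnion_le_card_mul _ _ (2 ^ (2 * L + 1)) ?_).trans ?_)
    · intro i _
      rw [Finset.card_powerset]
      exact Nat.pow_le_pow_right (by norm_num) (hB2 i)
    · rw [hZ]; exact Nat.mul_le_mul_right _ (hB3 p)
  let R : (Fin q ⊕ {z // z ∈ TS}) → Finset β := Sum.elim Bl fun z => z.1.1 ∪ z.1.2
  obtain ⟨Bad, hBad1, hBad2⟩ : ∃ Bad : ∀ θ, Finset ({x // x ∈ R θ} → G.Vt),
      (∀ (i : Fin q) (Y : {p // p ∈ Bl i} → G.Vt), Y ∈ Bad (Sum.inl i) ↔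
        (Function.Injective Y ∧ ¬ (G.ind (img Y)).MD j d)) ∧
      (∀ (z : {z // z ∈ TS}) (Y : {p // p ∈ z.1.1 ∪ z.1.2} → G.Vt), Y ∈ Bad (Sum.inr z) ↔ (Function.Injective Y ∧
        imP Y z.1.1 ∈ G.edges ∧ imP Y z.1.2 ∈ G.edges ∧ χ (imP Y z.1.1) = χ (imP Y z.1.2))) := by
    refine ⟨fun θ => Sum.rec (motive := fun θ => Finset ({x // x ∈ R θ} → G.Vt))
      (fun i => (univ.filter fun Y : {p // p ∈ Bl i} → G.Vt => Function.Injective Y ∧ ¬ (G.ind (img Y)).MD j d))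
      (fun z => (univ.filter fun Y : {p // p ∈ z.1.1 ∪ z.1.2} → G.Vt => Function.Injective Y ∧
        imP Y z.1.1 ∈ G.edges ∧ imP Y z.1.2 ∈ G.edges ∧ χ (imP Y z.1.1) = χ (imP Y z.1.2))) θ, ?_, ?_⟩
    · intro i Y
      exact memf_any.trans (and_iff_right (mem_univ_any _))
    · intro z Y
      exact memf_any.trans (and_iff_right (mem_univ_any _))
  let η : (Fin q ⊕ {z // z ∈ TS}) → ℝ := Sum.elim (fun _ => 1 / (288 * L))
    fun z => if Disjoint z.1.1 z.1.2 then c / Fintype.card β else c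
  have hTm : ∀ z ∈ TS, z.1.card = k ∧ z.2.card = k ∧ (z.1 ∩ z.2).card ≤ 1 := by
    intro z hz
    obtain ⟨h1, h2⟩ := mem_filter.1 hz
    obtain ⟨h3, h4⟩ := mem_product.1 h1
    exact ⟨(mem_filter.1 h3).2.1, (mem_filter.1 h4).2.1, h2⟩
  obtain ⟨π, hπ⟩ := lll2 (β := β) (α := G.Vt) (by rw [hcα, hβ]) R Bad (by
      rintro (i | z) Y hY
      · exact ((hBad1 i Y).1 hY).1
      · exact ((hBad2 z Y).1 hY).1) (2 * L + 1) (by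
      rintro (i | z)
      · exact card_pos.1 (lt_of_lt_of_le (by omega) (hB1 i))
      · have h1 := (hTm z.1 z.2).1
        have : z.1.1.Nonempty := card_pos.1 (by omega)
        exact this.mono subset_union_left) (by
      rintro (i | z)
      · exact hB2 i
      · refine (card_union_le _ _).trans ?_
        have := hTm z.1 z.2
        omega) (by rw [hcα]; exact hn2) η (by
      rintro (i | z)
      · change (0:ℝ) ≤ 1 / (288 * L); positivity
      · change (0:ℝ) ≤ if Disjoint z.1.1 z.1.2 then c / Fintype.card β else c
        split_ifs <;> positivity) (by
      rintro (i | z) r x S hS1 hS2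
      · rw [hcα]
        exact hblock i r x S (fun Y hY => (hBad1 i Y).1 (hS1 hY)) hS2
      · obtain ⟨h1, h2, h3⟩ := hTm z.1 z.2
        have hcb := colour_bad G χ _ (by positivity) hχ (by omega) z.1.1 z.1.2 h1 h2 r x
        have hS3 : (S.card : ℝ) ≤ _ := le_trans (Nat.cast_le.2 (card_le_card fun Y hY =>
          memf_any.2 ⟨memf_any.2 ⟨mem_univ_any _, (hBad2 z Y).1 (hS1 hY)⟩, hS2 Y hY⟩)) hcb
        refine hS3.trans ?_
        rw [hcα, hn]
        change _ ≤ (if Disjoint z.1.1 z.1.2 then c / Fintype.card β else c) *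
          (n : ℝ) ^ ((z.1.1 ∪ z.1.2).card - 1)
        have hu := Finset.card_union_add_card_inter z.1.1 z.1.2
        have e0 : (2 * (k : ℝ)) ^ (2 * k) * (2 * (n : ℝ) ^ (k - 1) * (μ * (n : ℝ) ^ (k - 1))) =
            c * (n : ℝ) ^ (2 * k - 2) := by
          have : 2 * k - 2 = (k - 1) + (k - 1) := by omega
          rw [hc, this, pow_add]; ring
        rw [e0]
        split_ifs with hd
        · have h4 : (z.1.1 ∩ z.1.2).card = 0 := by
            rw [Finset.disjoint_iff_inter_eq_empty.1 hd]; rfl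
          have h5 : (z.1.1 ∪ z.1.2).card - 1 = (2 * k - 2) + 1 := by omega
          rw [h5, pow_succ, hβ]
          refine le_of_eq ?_
          field_simp
        · have h4 : (z.1.1 ∩ z.1.2).card ≠ 0 := by
            intro h
            exact hd (Finset.disjoint_iff_inter_eq_empty.2 (Finset.card_eq_zero.1 h))
          have h5 : (z.1.1 ∪ z.1.2).card - 1 = 2 * k - 2 := by omega
          rw [h5]) (1 / (48 * L)) (by
      push_cast
      rw [mul_one_div, div_le_iff₀ (by positivity)]
      linarith) (by
      intro p
      rw [Fintype.sum_sum_type]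
      have t1 : ∑ i : Fin q, (if p ∈ R (Sum.inl i) then η (Sum.inl i) else 0) ≤ 1 / (96 * L) := by
        change ∑ i : Fin q, (if p ∈ Bl i then (1 / (288 * (L : ℝ))) else 0) ≤ 1 / (96 * L)
        rw [← sum_filter, Finset.sum_const, nsmul_eq_mul]
        have h3 : ((univ.filter fun i => p ∈ Bl i).card : ℝ) ≤ 3 := by exact_mod_cast hB3 p
        refine (mul_le_mul_of_nonneg_right h3 (by positivity)).trans (le_of_eq ?_)
        field_simp
        norm_num
      have t2 : ∑ z : {z // z ∈ TS}, (if p ∈ R (Sum.inr z) then η (Sum.inr z) else 0) ≤ 1 / (96 * L) := by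
        change ∑ z : {z // z ∈ TS}, (if p ∈ z.1.1 ∪ z.1.2 then
          (if Disjoint z.1.1 z.1.2 then c / Fintype.card β else c) else 0) ≤ _
        rw [Finset.sum_coe_sort TS (fun z => (if p ∈ z.1 ∪ z.2 then
          (if Disjoint z.1 z.2 then c / Fintype.card β else c) else 0))]
        refine le_trans (Finset.sum_le_sum_of_subset_of_nonneg (Finset.filter_subset _ _) ?_)
          ((tpl_sum P k Z (fun A hA => (mem_filter.1 hA).2.1) (by omega) hPZ p c hc0).trans hμ)
        intro z _ _
        split_ifs <;> positivity
      have t3 : 1 / (96 * (L : ℝ)) + 1 / (96 * L) = 1 / (48 * L) := by field_simp; norm_num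
      linarith)
  refine ⟨π, ?_, ?_⟩
  · intro i
    have h1 := hπ (Sum.inl i)
    by_contra hmd
    refine h1 ((hBad1 i _).2 ⟨?_, ?_⟩)
    · intro a b hab
      exact Subtype.ext (π.injective hab)
    · have him : img (fun r : {x // x ∈ Bl i} => π r) = (Bl i).image fun p => (π p).1 := ?_
      · change ¬ (G.ind (img (fun r : {x // x ∈ Bl i} => π r))).MD j d
        rw [him]; exact hmd
      ext y
      simp only [mem_img, mem_image]
      constructor
      · rintro ⟨a, ha⟩; exact ⟨a.1, a.2, ha⟩
      · rintro ⟨a, ha, hy⟩; exact ⟨⟨a, ha⟩, hy⟩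
  · intro P1 P2 h1 h2 h3 h4 h5' he hf hcol
    have h5 : (P1 ∩ P2).card ≤ 1 := card_le_one.2 fun a ha b hb =>
      h5' a (mem_inter.1 ha).1 (mem_inter.1 ha).2 b (mem_inter.1 hb).1 (mem_inter.1 hb).2
    have hz : (P1, P2) ∈ TS := mem_filter.2 ⟨mem_product.2
      ⟨mem_filter.2 ⟨mem_univ _, h1, h3⟩, mem_filter.2 ⟨mem_univ _, h2, h4⟩⟩, h5⟩
    have him : ∀ Q : Finset β, Q ⊆ P1 ∪ P2 →
        imP (fun r : {p // p ∈ P1 ∪ P2} => π r) Q = Q.image fun p => (π p).1 := by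
      intro Q hQ
      ext y
      simp only [imP, mem_image, mem_filter, mem_univ, true_and]
      constructor
      · rintro ⟨a, ha, hy⟩; exact ⟨a.1, ha, hy⟩
      · rintro ⟨a, ha, hy⟩; exact ⟨⟨a, hQ ha⟩, ha, hy⟩
    refine hπ (Sum.inr ⟨_, hz⟩) ((hBad2 ⟨_, hz⟩ _).2 ⟨?_, ?_⟩)
    · intro a b hab
      exact Subtype.ext (π.injective hab)
    · change imP (fun r : {p // p ∈ P1 ∪ P2} => π r) P1 ∈ G.edges ∧
        imP (fun r : {p // p ∈ P1 ∪ P2} => π r) P2 ∈ G.edges ∧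
        χ (imP (fun r : {p // p ∈ P1 ∪ P2} => π r) P1) = χ (imP (fun r : {p // p ∈ P1 ∪ P2} => π r) P2)
      rw [him P1 subset_union_left, him P2 subset_union_right]
      exact ⟨he, hf, hcol⟩
end

open Finset
open scoped Classical
noncomputable section
variable {k : ℕ}

theorem samp_L (j k : ℕ) (hjk : j < k) (δ ε : ℝ) (hδ : 0 ≤ δ) (hε : 0 < ε) :
    ∃ m1 : ℕ, ∀ L : ℕ, m1 ≤ L → 1 ≤ L → ∀ (G : HGraph k), G.MD j (δ + ε) →
    ∀ (ι : Type) [Fintype ι], L ≤ Fintype.card ι → Fintype.card ι ≤ 2 * L → ∀ x : G.Vt,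
      ((univ.filter fun Z : ι → G.Vt => Function.Injective Z ∧ Disjoint ({x.1} : Finset ℕ) (img Z) ∧
      ¬ (G.ind ({x.1} ∪ img Z)).MD j (δ + ε / 2)).card : ℝ) ≤ 1 / (288 * L) * (G.verts.card : ℝ) ^ Fintype.card ι := by
  obtain ⟨m0, hm0⟩ := sample_low j k hjk δ ε hδ hε 1
  obtain ⟨m1, hm1⟩ := asymp_exp (j + 1) (ε ^ 2 / 32) (288 * 3 ^ j) 1 (by positivity) one_pos
  refine ⟨max m0 m1, fun L hL hL1 G hG ι _ h1 h2 x => ?_⟩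
  have h3 := hm0 G hG {x.1} (Finset.singleton_subset_iff.2 x.2) (card_singleton _) ι
    (((le_max_left _ _).trans hL).trans h1)
  refine h3.trans (mul_le_mul_of_nonneg_right ?_ (by positivity))
  have h4 := hm1 L ((le_max_right _ _).trans hL)
  have hLr : (1 : ℝ) ≤ L := by exact_mod_cast hL1
  have h1r : (L : ℝ) ≤ Fintype.card ι := by exact_mod_cast h1
  have h2r : (Fintype.card ι : ℝ) ≤ 2 * L := by exact_mod_cast h2
  have e1 : (((1 : ℕ) : ℝ) + Fintype.card ι) ^ j ≤ (3 * L) ^ j := by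
    apply pow_le_pow_left₀ (by positivity)
    push_cast; linarith
  have e2 : Real.exp (-(ε ^ 2 / 32 * Fintype.card ι)) ≤ Real.exp (-(ε ^ 2 / 32 * L)) := by
    apply Real.exp_le_exp.2
    have : ε ^ 2 / 32 * (L : ℝ) ≤ ε ^ 2 / 32 * Fintype.card ι := mul_le_mul_of_nonneg_left h1r (by positivity)
    linarith
  refine (mul_le_mul e1 e2 (Real.exp_pos _).le (by positivity)).trans ?_
  rw [le_div_iff₀ (by positivity)]
  refine le_trans (le_of_eq ?_) h4
  rw [mul_pow, pow_succ]; ring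

theorem final_cycle (hk : 2 ≤ k) (G : HGraph k) (n L q : ℕ) (hn : G.verts.card = n) (hL : k ≤ L)
    (hd : (k - 1) ∣ n) (hdL : (k - 1) ∣ L) (hq : 2 ≤ q) (hqL : q * L ≤ n) (hqL2 : n < (q + 1) * L)
    (hn3 : (k - 1) * 3 ≤ n) (χ : Finset ℕ → ℕ) (j : ℕ) (d : ℝ)
    (hh : ∀ G : HGraph k, L ≤ G.verts.card → (k - 1) ∣ G.verts.card - 1 →
      G.MD j d → ∀ u ∈ G.verts, ∀ v ∈ G.verts, u ≠ v → LP G.edges u v G.verts)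
    (hπ : ∀ (Bl : Fin q → Finset (Fin n)), (∀ i, L + 1 ≤ (Bl i).card) → (∀ i, (Bl i).card ≤ 2 * L + 1) →
      (∀ p, ∃ T : Finset (Fin q), T.card ≤ 3 ∧ ∀ i, p ∈ Bl i → i ∈ T) →
      ∃ π : Fin n ≃ G.Vt, (∀ i, (G.ind ((Bl i).image fun p => (π p).1)).MD j d) ∧
      ∀ P1 P2 : Finset (Fin n), P1.card = k → P2.card = k → (∃ i, P1 ⊆ Bl i) → (∃ i, P2 ⊆ Bl i) →
        (∀ a ∈ P1, a ∈ P2 → ∀ b ∈ P1, b ∈ P2 → a = b) → P1.image (fun p => (π p).1) ∈ G.edges →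
        P2.image (fun p => (π p).1) ∈ G.edges →
        χ (P1.image fun p => (π p).1) ≠ χ (P2.image fun p => (π p).1)) :
    ∃ H : LooseHamCycle k G, RainbowEdges χ H.cedges := by
  have hL1 : 1 ≤ L := by omega
  obtain ⟨Bl, hBl⟩ : ∃ Bl : Fin q → Finset (Fin n), ∀ i p, p ∈ Bl i ↔ p.1 ∈ NB n L q i :=
    ⟨fun i => univ.filter fun p => p.1 ∈ NB n L q i, fun i p => by simp⟩
  have hBim : ∀ i, (Bl i).map Fin.valEmbedding = NB n L q i := by
    intro i
    ext p
    simp only [mem_map, Fin.valEmbedding_apply]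
    constructor
    · rintro ⟨a, ha, rfl⟩; exact (hBl i a).1 ha
    · intro hp
      exact ⟨⟨p, NB_sub n L q i hL1 hq hqL p hp⟩, (hBl i _).2 hp, rfl⟩
  have hBc : ∀ i, (Bl i).card = (NB n L q i).card := fun i => by rw [← hBim i, card_map]
  have hNc := fun i => NB_card n L q i hL1 hq hqL hqL2
  obtain ⟨π, hπ1, hπ2⟩ := hπ Bl (fun i => by rw [hBc]; exact (hNc i).1)
    (fun i => by rw [hBc]; exact (hNc i).2.1) (fun p => by
      refine ⟨univ.filter fun i => p ∈ Bl i, ?_, fun i hi => mem_filter.2 ⟨mem_univ _, hi⟩⟩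
      rw [← card_map Fin.valEmbedding]
      refine (card_le_card ?_).trans (NB_three n L q p.1 hL1)
      intro i hi
      obtain ⟨a, ha, rfl⟩ := mem_map.1 hi
      exact mem_filter.2 ⟨mem_range.2 a.2, (hBl a p).1 (mem_filter.1 ha).2⟩)
  set g : Fin n → ℕ := fun p => (π p).1 with hg
  have hginj : Function.Injective g := fun a b hab => π.injective (Subtype.ext hab)
  obtain ⟨f, hf⟩ : ∃ f : ℕ → ℕ, ∀ p : Fin n, f p.1 = g p :=
    ⟨fun p => if h : p < n then g ⟨p, h⟩ else 0, fun p => by simp⟩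
  have hfinj : Set.InjOn f (Set.Iio n) := by
    intro a ha b hb hab
    have h1 := hf ⟨a, ha⟩
    have h2 := hf ⟨b, hb⟩
    have h3 : g ⟨a, ha⟩ = g ⟨b, hb⟩ := by rw [← h1, ← h2]; exact hab
    exact congrArg Fin.val (hginj h3)
  have hNim : ∀ i, (NB n L q i.1).image f = (Bl i).image g := by
    intro i
    rw [← hBim i, Finset.map_eq_image, Finset.image_image]
    exact image_congr fun p _ => hf p
  have hrng : (range n).image f = G.verts := by
    ext y
    simp only [mem_image, mem_range]
    constructor
    · rintro ⟨p, hp, rfl⟩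
      rw [hf ⟨p, hp⟩]; exact (π ⟨p, hp⟩).2
    · intro hy
      refine ⟨(π.symm ⟨y, hy⟩).1, (π.symm ⟨y, hy⟩).2, ?_⟩
      rw [hf, hg]; simp
  let G' : HGraph k := ⟨G.verts, G.edges.filter fun e => ∃ i, e ⊆ (Bl i).image g,
    fun e he => G.edge_sub e (mem_filter.1 he).1, fun e he => G.edge_card e (mem_filter.1 he).1⟩
  obtain ⟨e, a, c, hcyc⟩ := concat G'.edges f n L q hfinj hL1 hq hqL (by
    intro i hi
    rw [hNim ⟨i, hi⟩]
    have hcard : ((Bl ⟨i, hi⟩).image g).card = (NB n L q i).card := by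
      rw [card_image_of_injective _ hginj, hBc]
    have hin : ∀ p ∈ NB n L q i, f p ∈ (Bl ⟨i, hi⟩).image g := by
      intro p hp
      rw [← hNim ⟨i, hi⟩]; exact mem_image_of_mem _ hp
    have hqL' : (q - 1) * L + L = q * L := by
      obtain ⟨q', rfl⟩ : ∃ q', q = q' + 1 := ⟨q - 1, by omega⟩
      simp only [Nat.add_sub_cancel]; ring
    have m1 : i * L ∈ NB n L q i := by
      unfold NB
      split_ifs with h
      · rw [mem_Icc]; constructor
        · exact le_rfl
        · exact Nat.mul_le_mul_right _ (by omega)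
      · have : i = q - 1 := by omega
        rw [this]
        refine mem_insert_of_mem (mem_Ico.2 ⟨le_rfl, by omega⟩)
    have m2 : (if i + 1 < q then (i + 1) * L else 0) ∈ NB n L q i := by
      unfold NB
      split_ifs with h
      · rw [mem_Icc]; constructor
        · exact Nat.mul_le_mul_right _ (by omega)
        · exact le_rfl
      · exact mem_insert_self _ _
    have hne : i * L ≠ (if i + 1 < q then (i + 1) * L else 0) := by
      split_ifs with h
      · have : (i + 1) * L = i * L + L := by ring
        omega
      · have : 0 < i * L := Nat.mul_pos (by omega) hL1
        omega
    have hlp := hh (G.ind ((Bl ⟨i, hi⟩).image g)) (by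
        rw [HGraph.ind_verts, hcard]; have := (hNc i).1; omega)
      (by rw [HGraph.ind_verts, hcard]; exact (hNc i).2.2 _ hdL hd) (hπ1 ⟨i, hi⟩) _ (hin _ m1) _ (hin _ m2)
      (fun h => hne (hfinj (NB_sub n L q i hL1 hq hqL _ m1) (NB_sub n L q i hL1 hq hqL _ m2) h))
    refine hlp.mono ?_
    intro e he _
    obtain ⟨h1, h2⟩ := (HGraph.mem_ind _ _ _).1 he
    exact mem_filter.2 ⟨h1, ⟨i, hi⟩, h2⟩)
  rw [hrng] at hcyc
  obtain ⟨H'⟩ := CycAt.toHam hk (G := G') hcyc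
  refine ⟨⟨H'.σ, H'.injOn, H'.image_eq, fun i hi => (mem_filter.1 (H'.edges_mem i hi)).1⟩, ?_⟩
  change RainbowEdges χ H'.cedges
  intro e he e' he' hcol
  by_contra hne
  have hint := LooseHamCycle.cedges_inter hk H' (by change _ ∣ G.verts.card; rw [hn]; exact hd)
    (by change _ ≤ G.verts.card; rw [hn]; exact hn3) e e' he he' hne
  have hpre : ∀ e ∈ H'.cedges, e ∈ G.edges ∧ ∃ P : Finset (Fin n), P.card = k ∧ (∃ i, P ⊆ Bl i) ∧ P.image g = e := by
    intro e he
    obtain ⟨i, hi, rfl⟩ := mem_image.1 he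
    obtain ⟨h1, i', h2⟩ := mem_filter.1 (H'.edges_mem i (mem_range.1 hi))
    refine ⟨h1, ?_⟩
    obtain ⟨P, hP1, hP2⟩ := Finset.subset_image_iff.1 h2
    refine ⟨P, ?_, ⟨i', hP1⟩, hP2⟩
    rw [← card_image_of_injective P hginj, hP2]
    exact G.edge_card _ h1
  obtain ⟨hE1, P1, c1, b1, rfl⟩ := hpre e he
  obtain ⟨hE2, P2, c2, b2, rfl⟩ := hpre e' he'
  refine hπ2 P1 P2 c1 c2 b1 b2 ?_ hE1 hE2 hcol
  intro a ha ha' b hb hb'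
  exact hginj (card_le_one.1 hint _ (mem_inter.2 ⟨mem_image_of_mem _ ha, mem_image_of_mem _ ha'⟩)
    _ (mem_inter.2 ⟨mem_image_of_mem _ hb, mem_image_of_mem _ hb'⟩))

theorem main_aux (j k : ℕ) (hj : 1 ≤ j) (hjk : j < k)
    (ε : ℝ) (hε : 0 < ε) :
    ∃ μ : ℝ, 0 < μ ∧ ∃ n₀ : ℕ, ∀ n : ℕ, n₀ ≤ n → (k - 1) ∣ n →
      ∀ G : HGraph k, G.verts.card = n →
        G.MinDegGe j ((looseHamThreshold j k + ε) * (n : ℝ) ^ (k - j)) →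
        ∀ χ : Finset ℕ → ℕ, GloballyBounded G χ (μ * (n : ℝ) ^ (k - 1)) →
          ∃ H : LooseHamCycle k G, RainbowEdges χ H.cedges := by
  have hk : 2 ≤ k := by omega
  obtain ⟨N1, hN1⟩ := hcn j k hj hjk (ε / 2) (by linarith)
  obtain ⟨m1, hm1⟩ := samp_L j k hjk (looseHamThreshold j k) ε (thr_nonneg j k) hε
  obtain ⟨L, hLN, hLm, hLk, hdL⟩ : ∃ L, N1 ≤ L ∧ m1 ≤ L ∧ k ≤ L ∧ (k - 1) ∣ L := by
    have : 1 ≤ k - 1 := by omega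
    have h : N1 + m1 + k ≤ (k - 1) * (N1 + m1 + k) := Nat.le_mul_of_pos_left _ this
    exact ⟨(k - 1) * (N1 + m1 + k), by omega, by omega, by omega, Dvd.intro _ rfl⟩
  have hL0 : (0 : ℝ) < L := by exact_mod_cast (by omega : 0 < L)
  have hk0 : (0 : ℝ) < k := by exact_mod_cast (by omega : 0 < k)
  obtain ⟨Z, hZ⟩ : ∃ Z : ℕ, Z = 3 * 2 ^ (2 * L + 1) := ⟨_, rfl⟩
  have hZ0 : (0 : ℝ) < Z := by
    have : 0 < Z := by rw [hZ]; positivity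
    exact_mod_cast this
  set A : ℝ := 2 * ((Z : ℝ) * ((k + 1) * Z * (2 * (2 * k : ℝ) ^ (2 * k)))) with hA
  have hA0 : 0 < A := by positivity
  refine ⟨1 / (96 * L) / A, by positivity, 2 * (2 * L + 1) ^ 2 + 3 * k + 2 * L, ?_⟩
  intro n hn hd G hG hmd χ hχ
  have hmd' : G.MD j (looseHamThreshold j k + ε) := by
    unfold HGraph.MD; rw [hG]; exact hmd
  have hL1 : 1 ≤ L := by omega
  refine final_cycle hk G n L (n / L) hG hLk hd hdL ?_ (Nat.div_mul_le_self _ _) ?_ ?_ χ j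
    (looseHamThreshold j k + ε / 2) ?_ ?_
  · rw [Nat.le_div_iff_mul_le (by omega)]; omega
  · rw [Nat.add_mul, one_mul]; exact Nat.lt_div_mul_add hL1
  · omega
  · intro G' h1 h2 h3
    exact hN1 G' (by omega) h2 h3
  · intro Bl hB1 hB2 hB3
    refine good_pi hk G n hG χ _ (by positivity) hχ j _ L (n / L) Z hLk (Fintype.card_fin n) Bl hB1 hB2 hB3
      (by omega) ?_ hZ ?_
    · intro ι _ h1 h2 x
      have := hm1 L hLm hL1 G hmd' ι h1 h2 x
      rw [hG] at this
      exact this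
    · refine le_of_eq ?_
      have : 2 * ((Z : ℝ) * ((k + 1) * Z * (2 * (2 * k : ℝ) ^ (2 * k) * (1 / (96 * L) / A)))) = A * (1 / (96 * L) / A) := by
        rw [hA]; ring
      rw [this, mul_div_cancel₀ _ hA0.ne']
end

/-- above the loose Hamilton cycle threshold, every globally
`μn^{k-1}`-bounded colouring admits a rainbow loose Hamilton cycle. -/
theorem rainbow_loose_hamilton_cycle (j k : ℕ) (hj : 1 ≤ j) (hjk : j < k)
    (ε : ℝ) (hε : 0 < ε) :
    ∃ μ : ℝ, 0 < μ ∧ ∃ n₀ : ℕ, ∀ n : ℕ, n₀ ≤ n → (k - 1) ∣ n →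
      ∀ G : HGraph k, G.verts.card = n →
        G.MinDegGe j ((looseHamThreshold j k + ε) * (n : ℝ) ^ (k - j)) →
        ∀ χ : Finset ℕ → ℕ, GloballyBounded G χ (μ * (n : ℝ) ^ (k - 1)) →
          ∃ H : LooseHamCycle k G, RainbowEdges χ H.cedges := by
  exact main_aux j k hj hjk ε hε

end
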